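/- arXiv:2112.10698 — 10 statements merged into one kernel-verified Lean document; each statement's English description precedes it below -/
import Mathlib

section
/- For any convex body K in ℝ³, C(K, int(K)) ≤ max{ C(E ∪ V_p, 𝒫) : p ∈ [0,1]⁶ }, where 𝒫 is the family of rectangular parallelepipeds in ℝ³ with edges parallel to the coordinate axes whose three edge lengths sum to strictly less than 1, and C(A, 𝒫) denotes the smallest number of translates of members of 𝒫 needed to cover A. -/
open Set Pointwise

/-- The 1-skeleton (union of the 12 edges) of the unit cube `[0,1]³`:
points of the cube having at least two coordinates in `{0,1}`. -/
def cubeSkel : Set (Fin 3 → ℝ) :=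
  {x | (∀ i, x i ∈ Icc (0:ℝ) 1) ∧
    ∃ i j : Fin 3, i ≠ j ∧ (x i = 0 ∨ x i = 1) ∧ (x j = 0 ∨ x j = 1)}

/-- The six-point configuration `V_p` on the faces of the cube. -/
def Vpts (p : Fin 6 → ℝ) : Set (Fin 3 → ℝ) :=
  {![0, p 0, p 1], ![1, p 0, p 1], ![p 2, 0, p 3],
   ![p 2, 1, p 3], ![p 4, p 5, 0], ![p 4, p 5, 1]}

/-- `O_p`, the (closed) convex hull of `V_p`. -/
def Oc (p : Fin 6 → ℝ) : Set (Fin 3 → ℝ) := convexHull ℝ (Vpts p)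

/-- `C(A,B)`: the smallest number of translates of `B` whose union contains `A`
(`⊤` if no finite cover exists). -/
noncomputable def coverNum (A B : Set (Fin 3 → ℝ)) : ℕ∞ :=
  sInf {n : ℕ∞ | ∃ T : Finset (Fin 3 → ℝ), (T.card : ℕ∞) = n ∧ A ⊆ ⋃ t ∈ T, (t +ᵥ B)}

/-- `C(A,ℬ)`: the smallest number of translates of members of `ℬ` needed to cover `A`. -/
noncomputable def coverNumFam (A : Set (Fin 3 → ℝ)) (ℬ : Set (Set (Fin 3 → ℝ))) : ℕ∞ :=
  sInf {n : ℕ∞ | ∃ T : Finset ((Fin 3 → ℝ) × Set (Fin 3 → ℝ)),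
    (T.card : ℕ∞) = n ∧ (∀ x ∈ T, x.2 ∈ ℬ) ∧ A ⊆ ⋃ x ∈ T, (x.1 +ᵥ x.2)}

/-- The family `𝒫` of axis-parallel rectangular parallelepipeds
whose three edge lengths sum to strictly less than `1`. -/
def boxFam : Set (Set (Fin 3 → ℝ)) :=
  {B | ∃ a b : Fin 3 → ℝ, (∀ i, a i < b i) ∧ (∑ i, (b i - a i)) < 1 ∧ B = Icc a b}

/-- An Auerbach-type normalization: up to a linear isomorphism, a compact set with nonempty
interior has width at most `1` in every coordinate direction and contains unit segments in all
coordinate directions. -/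
theorem exists_equiv_unit_segments {K : Set (Fin 3 → ℝ)} (hcomp : IsCompact K)
    (hint : (interior K).Nonempty) :
    ∃ f : (Fin 3 → ℝ) ≃L[ℝ] (Fin 3 → ℝ),
      (∀ i, ∃ a ∈ K, ∃ b ∈ K, f b = f a + Pi.single i 1) ∧
      ∀ x ∈ K, ∀ y ∈ K, ∀ i, f x i - f y i ≤ 1 := by
  have hD : IsCompact (K - K) := by
    rw [sub_eq_add_neg]
    exact hcomp.add hcomp.neg
  obtain ⟨c, hc⟩ := hint
  obtain ⟨ε, hε, hball⟩ := Metric.isOpen_iff.1 isOpen_interior c hc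
  have hS : IsCompact (Set.univ.pi fun _ : Fin 3 => K - K) := isCompact_univ_pi fun _ => hD
  let M₀ : Matrix (Fin 3) (Fin 3) ℝ := Matrix.diagonal fun _ => ε / 2
  have hM₀ : (M₀ : Fin 3 → Fin 3 → ℝ) ∈ Set.univ.pi fun _ : Fin 3 => K - K := by
    intro i _
    refine ⟨c + Pi.single i (ε / 2), interior_subset (hball ?_), c, interior_subset hc, ?_⟩
    · rw [Metric.mem_ball, dist_eq_norm, add_sub_cancel_left, Pi.norm_single,
        Real.norm_eq_abs, abs_of_pos (by positivity)]
      linarith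
    · ext j
      by_cases h : i = j
      · subst h; simp [M₀]
      · simp [M₀, h, Ne.symm h]
  obtain ⟨M, hM, hmax⟩ := hS.exists_isMaxOn ⟨_, hM₀⟩
    (f := fun A : Fin 3 → Fin 3 → ℝ => Matrix.det (Matrix.of A))
    (Continuous.matrix_det (by fun_prop)).continuousOn
  have hdet : 0 < Matrix.det (Matrix.of M) := by
    refine lt_of_lt_of_le ?_ (hmax hM₀)
    have : Matrix.of M₀ = M₀ := rfl
    simp only [this, M₀, Matrix.det_diagonal]
    positivity
  have hli : LinearIndependent ℝ M :=
    Matrix.linearIndependent_rows_iff_isUnit (A := Matrix.of M) |>.2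
      ((Matrix.isUnit_iff_isUnit_det _).2 hdet.ne'.isUnit)
  let b := basisOfLinearIndependentOfCardEqFinrank hli (by simp)
  have hb : ∀ i, b i = M i := fun i => by simp [b]
  refine ⟨b.equivFunL, fun i => ?_, fun x hx y hy i => ?_⟩
  · obtain ⟨x, hx, y, hy, hxy⟩ := hM i (mem_univ i)
    refine ⟨y, hy, x, hx, ?_⟩
    have h1 : x = y + b i := by rw [hb, ← hxy]; simp
    have h2 : b.equivFunL (b i) = Pi.single i 1 := by
      ext j
      simp [Pi.single_apply, Finsupp.single_apply, eq_comm]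
    rw [h1, map_add, h2]
  · have hmem : Function.update M i (x - y) ∈ Set.univ.pi fun _ : Fin 3 => K - K := by
      intro j _
      by_cases h : j = i
      · subst h; simpa using Set.sub_mem_sub hx hy
      · simpa [h] using hM j (mem_univ j)
    have h1 := hmax hmem
    have h2 : Matrix.of (Function.update M i (x - y)) =
        (Matrix.of M).updateRow i (∑ k, b.equivFun (x - y) k • Matrix.of M k) := by
      have : ∑ k, b.equivFun (x - y) k • Matrix.of M k = x - y := by
        conv_rhs => rw [← b.sum_equivFun (x - y)]
        exact Finset.sum_congr rfl fun k _ => by rw [hb]; rfl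
      rw [this]; rfl
    simp only [mem_ofPred_eq] at h1
    rw [h2, Matrix.det_updateRow_sum, smul_eq_mul] at h1
    have h3 : b.equivFun (x - y) i ≤ 1 := by
      by_contra! h
      nlinarith
    simpa using h3

/-- If every point of a compact convex set can be pushed into the interior along one of finitely
many directions, then a common step length works for all points. -/
theorem exists_uniform_step {ι : Type*} {L : Set (Fin 3 → ℝ)} (hconv : Convex ℝ L)
    (hcomp : IsCompact L) (T : Finset ι) (τ : ι → Fin 3 → ℝ)
    (h : ∀ x ∈ L, ∃ i ∈ T, ∃ l > (0 : ℝ), x + l • τ i ∈ interior L) :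
    ∃ l : ℝ, ∀ x ∈ L, ∃ i ∈ T, x + l • τ i ∈ interior L := by
  have key : ∃ l₀ > (0 : ℝ), ∀ l, 0 < l → l ≤ l₀ → ∀ x ∈ L, x ∈ L →
      ∃ i ∈ T, x + l • τ i ∈ interior L := by
    refine hcomp.induction_on (p := fun s => ∃ l₀ > (0 : ℝ), ∀ l, 0 < l → l ≤ l₀ → ∀ x ∈ s,
      x ∈ L → ∃ i ∈ T, x + l • τ i ∈ interior L) ⟨1, one_pos, by simp⟩ ?_ ?_ ?_
    · rintro s t hst ⟨l₀, h0, hl⟩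
      exact ⟨l₀, h0, fun l h1 h2 x hx => hl l h1 h2 x (hst hx)⟩
    · rintro s t ⟨l₀, h0, hl⟩ ⟨l₁, h0', hl'⟩
      refine ⟨min l₀ l₁, lt_min h0 h0', fun l h1 h2 x hx => hx.elim
        (hl l h1 (h2.trans (min_le_left _ _)) x) (hl' l h1 (h2.trans (min_le_right _ _)) x)⟩
    · intro x hx
      obtain ⟨i, hi, l₀, h0, hmem⟩ := h x hx
      have hopen : IsOpen ((fun y => y + l₀ • τ i) ⁻¹' interior L) :=
        isOpen_interior.preimage (by fun_prop)
      refine ⟨_, mem_nhdsWithin_of_mem_nhds (hopen.mem_nhds hmem), l₀, h0, ?_⟩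
      intro l h1 h2 y hy hyL
      refine ⟨i, hi, ?_⟩
      have := hconv.combo_self_interior_mem_interior hyL hy (a := 1 - l / l₀) (b := l / l₀)
        (by rw [sub_nonneg, div_le_one h0]; exact h2) (by positivity) (by ring)
      convert this using 1
      ext j
      simp
      field_simp
      ring
  obtain ⟨l₀, h0, hl⟩ := key
  exact ⟨l₀, fun x hx => hl l₀ h0 le_rfl x hx hx⟩

/-- A convex set with interior points that contains unit segments in all coordinate directions
contains, in its interior, a translate of each member of `boxFam`. -/
theorem exists_translate_box_subset_interior {L : Set (Fin 3 → ℝ)} (hconv : Convex ℝ L)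
    (hint : (interior L).Nonempty) (q : Fin 3 → Fin 3 → ℝ) (hq : ∀ i, q i ∈ L)
    (hq' : ∀ i, q i + Pi.single i 1 ∈ L) {B : Set (Fin 3 → ℝ)} (hB : B ∈ boxFam) :
    ∃ t, ∀ y ∈ B, y + t ∈ interior L := by
  obtain ⟨a, b, hab, hsum, rfl⟩ := hB
  obtain ⟨c, hc⟩ := hint
  set σ := ∑ i, (b i - a i) with hσ
  have hσ0 : 0 < σ := Finset.sum_pos (fun i _ => sub_pos.2 (hab i)) Finset.univ_nonempty
  refine ⟨(∑ i, (b i - a i) • q i) + (1 - σ) • c - a, fun y hy => ?_⟩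
  have hseg : ∀ i, q i + ((y i - a i) / (b i - a i)) • (Pi.single i 1 : Fin 3 → ℝ) ∈ L := by
    intro i
    have hpos := sub_pos.2 (hab i)
    refine hconv.add_smul_mem (hq i) (hq' i) ⟨div_nonneg (sub_nonneg.2 (hy.1 i)) hpos.le, ?_⟩
    rw [div_le_one hpos]
    linarith [hy.2 i]
  have hcomb := hconv.sum_mem (t := Finset.univ) (w := fun i => (b i - a i) / σ)
    (fun i _ => div_nonneg (sub_pos.2 (hab i)).le hσ0.le)
    (by rw [← Finset.sum_div, ← hσ, div_self hσ0.ne']) (fun i _ => hseg i)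
  have := hconv.combo_self_interior_mem_interior hcomb hc (a := σ) (b := 1 - σ) hσ0.le
    (by linarith) (by ring)
  convert this using 1
  have hterm : ∀ i, σ • ((b i - a i) / σ) •
      (q i + ((y i - a i) / (b i - a i)) • (Pi.single i 1 : Fin 3 → ℝ)) =
      (b i - a i) • q i + Pi.single i (y i - a i) := by
    intro i
    have hpos := sub_pos.2 (hab i)
    rw [smul_smul, mul_div_cancel₀ _ hσ0.ne', smul_add, smul_smul,
      mul_div_cancel₀ _ hpos.ne', ← Pi.single_smul, smul_eq_mul, mul_one]
  rw [Finset.smul_sum, Finset.sum_congr rfl fun i _ => hterm i, Finset.sum_add_distrib]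
  have hs : ∑ i, (Pi.single i (y i - a i) : Fin 3 → ℝ) = y - a :=
    Finset.univ_sum_single (y - a)
  rw [hs]
  abel

/-- A ray starting in the cube leaves it. -/
theorem exists_ray_exit {x d : Fin 3 → ℝ} (hx : ∀ i, x i ∈ Icc (0 : ℝ) 1) (hd : d ≠ 0) :
    ∃ s : ℝ, 0 ≤ s ∧ (∀ i, (x + s • d) i ∈ Icc (0 : ℝ) 1) ∧
      ∃ j, d j ≠ 0 ∧ ((x + s • d) j = 0 ∨ (x + s • d) j = 1) := by
  let e : Fin 3 → ℝ := fun j => if 0 < d j then (1 - x j) / d j else x j / (-d j)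
  obtain ⟨k, hk⟩ := Function.ne_iff.1 hd
  obtain ⟨j, hj, hmin⟩ := Finset.exists_min_image (Finset.univ.filter fun j => d j ≠ 0) e
    ⟨k, by simpa using hk⟩
  have hj' : d j ≠ 0 := by simpa using hj
  have he : 0 ≤ e j := by
    dsimp only [e]
    split_ifs with h
    · exact div_nonneg (by linarith [(hx j).2]) h.le
    · exact div_nonneg (hx j).1 (by linarith)
  refine ⟨e j, he, fun i => ?_, j, hj', ?_⟩
  · simp only [Pi.add_apply, Pi.smul_apply, smul_eq_mul, mem_Icc]
    obtain ⟨h0, h1⟩ := hx i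
    rcases lt_trichotomy (d i) 0 with hi | hi | hi
    · have hle := hmin i (by simp [hi.ne])
      have hei : e i = x i / (-d i) := if_neg hi.not_gt
      rw [hei, le_div_iff₀ (by linarith)] at hle
      constructor <;> nlinarith
    · simp [hi, h0, h1]
    · have hle := hmin i (by simp [hi.ne'])
      have hei : e i = (1 - x i) / d i := if_pos hi
      rw [hei, le_div_iff₀ hi] at hle
      constructor <;> nlinarith
  · simp only [Pi.add_apply, Pi.smul_apply, smul_eq_mul]
    by_cases h : 0 < d j
    · right
      simp only [e, if_pos h]
      field_simp
      ring
    · left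
      simp only [e, if_neg h]
      field_simp
      ring

/-- The gauge of the `j`-th coordinate strip of the cube, seen from the point `x`. -/
noncomputable def stripGauge (x r : Fin 3 → ℝ) (j : Fin 3) : ℝ :=
  max (r j / (1 - x j)) (-r j / x j)

theorem stripGauge_nonneg {x : Fin 3 → ℝ} (hx : ∀ i, x i ∈ Ioo (0 : ℝ) 1) (r : Fin 3 → ℝ)
    (j : Fin 3) : 0 ≤ stripGauge x r j := by
  obtain ⟨h0, h1⟩ := hx j
  rcases le_total 0 (r j) with h | h
  · exact le_max_of_le_left (div_nonneg h (by linarith))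
  · exact le_max_of_le_right (div_nonneg (by linarith) h0.le)

theorem le_stripGauge_mul {x : Fin 3 → ℝ} (hx : ∀ i, x i ∈ Ioo (0 : ℝ) 1) (r : Fin 3 → ℝ)
    (j : Fin 3) : r j ≤ stripGauge x r j * (1 - x j) ∧ -r j ≤ stripGauge x r j * x j := by
  obtain ⟨h0, h1⟩ := hx j
  exact ⟨(div_le_iff₀ (by linarith)).1 (le_max_left _ _),
    (div_le_iff₀ h0).1 (le_max_right _ _)⟩

theorem stripGauge_mul_eq {x : Fin 3 → ℝ} (hx : ∀ i, x i ∈ Ioo (0 : ℝ) 1) (r : Fin 3 → ℝ)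
    (j : Fin 3) : r j = stripGauge x r j * (1 - x j) ∨ -r j = stripGauge x r j * x j := by
  obtain ⟨h0, h1⟩ := hx j
  rcases max_choice (r j / (1 - x j)) (-r j / x j) with h | h
  · left
    rw [stripGauge, h, div_mul_cancel₀ _ (by linarith)]
  · right
    rw [stripGauge, h, div_mul_cancel₀ _ h0.ne']

theorem stripGauge_eq_zero {x : Fin 3 → ℝ} (hx : ∀ i, x i ∈ Ioo (0 : ℝ) 1) {r : Fin 3 → ℝ}
    {j : Fin 3} : stripGauge x r j = 0 ↔ r j = 0 := by
  refine ⟨fun h => ?_, fun h => by simp [stripGauge, h]⟩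
  have := le_stripGauge_mul hx r j
  rw [h] at this
  linarith [this.1, this.2]

theorem continuous_stripGauge (x : Fin 3 → ℝ) (j : Fin 3) :
    Continuous fun r => stripGauge x r j := by
  unfold stripGauge
  fun_prop

/-- A direction in which two of the coordinate strips are left simultaneously and first leads
to the 1-skeleton of the cube. -/
theorem add_smul_mem_cubeSkel {x r : Fin 3 → ℝ} (hx : ∀ i, x i ∈ Ioo (0 : ℝ) 1) {i j : Fin 3}
    (hij : i ≠ j) (hpos : 0 < stripGauge x r i) (heq : stripGauge x r j = stripGauge x r i)
    (hle : ∀ k, stripGauge x r k ≤ stripGauge x r i) :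
    x + (stripGauge x r i)⁻¹ • r ∈ cubeSkel := by
  set g := stripGauge x r i with hg
  have hend : ∀ k, stripGauge x r k = g →
      (x + g⁻¹ • r) k = 0 ∨ (x + g⁻¹ • r) k = 1 := by
    intro k hk
    simp only [Pi.add_apply, Pi.smul_apply, smul_eq_mul]
    rcases stripGauge_mul_eq hx r k with h | h <;> rw [hk] at h
    · right
      rw [h]
      field_simp
      ring
    · left
      have : r k = -(g * x k) := by linarith
      rw [this]
      field_simp
      ring
  refine ⟨fun k => ?_, i, j, hij, hend i rfl, hend j heq⟩
  obtain ⟨h0, h1⟩ := hx k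
  obtain ⟨h2, h3⟩ := le_stripGauge_mul hx r k
  have h4 := hle k
  simp only [Pi.add_apply, Pi.smul_apply, smul_eq_mul, mem_Icc]
  have h5 : g⁻¹ * r k ≤ 1 - x k := by
    rw [inv_mul_le_iff₀ hpos]
    nlinarith
  have h6 : -x k ≤ g⁻¹ * r k := by
    rw [le_inv_mul_iff₀ hpos]
    nlinarith
  constructor <;> linarith

/-- A continuous function that changes sign on a convex set not contained in a line through the
origin has a nonzero zero there. -/
theorem Convex.exists_ne_zero_eq_zero {C : Set (Fin 3 → ℝ)} (hC : Convex ℝ C)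
    {h : (Fin 3 → ℝ) → ℝ} (hh : Continuous h) {d₁ d₂ m : Fin 3 → ℝ}
    (h₁ : d₁ ∈ C) (h₂ : d₂ ∈ C) (hm : m ∈ C) (hd₁ : d₁ ≠ 0) (hd₂ : d₂ ≠ 0)
    (hmd : ∀ c : ℝ, m ≠ c • d₁) (hpos : 0 ≤ h d₁) (hneg : h d₂ ≤ 0) :
    ∃ r ∈ C, r ≠ 0 ∧ h r = 0 := by
  have hseg : ∀ u ∈ C, ∀ v ∈ C, u ≠ 0 → (∀ c : ℝ, v ≠ c • u) → h u * h v ≤ 0 →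
      ∃ r ∈ C, r ≠ 0 ∧ h r = 0 := by
    intro u hu v hv hu0 huv hsign
    have h0 : (0 : ℝ) ∈ h '' segment ℝ u v := by
      have hp := (convex_segment (𝕜 := ℝ) u v).isPreconnected
      rcases mul_nonpos_iff.1 hsign with ⟨ha, hb⟩ | ⟨ha, hb⟩
      · exact hp.intermediate_value (right_mem_segment ℝ u v) (left_mem_segment ℝ u v)
          hh.continuousOn ⟨hb, ha⟩
      · exact hp.intermediate_value (left_mem_segment ℝ u v) (right_mem_segment ℝ u v)
          hh.continuousOn ⟨ha, hb⟩
    obtain ⟨r, hr, hr0⟩ := h0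
    refine ⟨r, hC.segment_subset hu hv hr, ?_, hr0⟩
    rintro rfl
    obtain ⟨a, b, ha, hb, hab, hz⟩ := hr
    rcases eq_or_ne b 0 with rfl | hb0
    · have : a = 1 := by linarith
      exact hu0 (by simpa [this] using hz)
    · refine huv (-(a / b)) ?_
      have : b • v = -(a • u) := by rw [eq_neg_iff_add_eq_zero, add_comm, hz]
      rw [← inv_smul_smul₀ hb0 v, this, smul_neg, smul_smul, neg_smul, div_eq_inv_mul]
  by_cases hdep : ∃ c : ℝ, d₂ = c • d₁
  · obtain ⟨c, rfl⟩ := hdep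
    rcases le_total (h m) 0 with hm0 | hm0
    · exact hseg d₁ h₁ m hm hd₁ hmd (mul_nonpos_of_nonneg_of_nonpos hpos hm0)
    · refine hseg _ h₂ m hm hd₂ (fun c' hc' => hmd (c' * c) ?_)
        (mul_nonpos_of_nonpos_of_nonneg hneg hm0)
      rw [hc', smul_smul]
  · push Not at hdep
    exact hseg d₁ h₁ d₂ h₂ hd₁ hdep (mul_nonpos_of_nonneg_of_nonpos hpos hneg)

/-- A convex cone that meets every coordinate plane outside the origin and is not contained in a
line contains, seen from an interior point of the cube, a point of the 1-skeleton. -/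
theorem exists_add_mem_cubeSkel {C : ConvexCone ℝ (Fin 3 → ℝ)} {x : Fin 3 → ℝ}
    (hx : ∀ i, x i ∈ Ioo (0 : ℝ) 1) (hplane : ∀ i, ∃ r ∈ C, r ≠ 0 ∧ r i = 0)
    (hline : ∀ d : Fin 3 → ℝ, ∃ m ∈ C, ∀ c : ℝ, m ≠ c • d) :
    ∃ r ∈ C, x + r ∈ cubeSkel := by
  let h : Fin 3 → (Fin 3 → ℝ) → ℝ := fun i r =>
    stripGauge x r i - max (stripGauge x r (i + 1)) (stripGauge x r (i + 2))
  have hh : ∀ i, Continuous (h i) := fun i =>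
    (continuous_stripGauge x i).sub
      ((continuous_stripGauge x (i + 1)).max (continuous_stripGauge x (i + 2)))
  have hothers : ∀ i k : Fin 3, k = i ∨ k = i + 1 ∨ k = i + 2 := by decide
  have hne1 : ∀ i : Fin 3, i ≠ i + 1 := by decide
  have hne2 : ∀ i : Fin 3, i ≠ i + 2 := by decide
  obtain ⟨d₁, h₁, hd₁, hd₁0⟩ := hplane 0
  obtain ⟨j, -, hj⟩ := Finset.exists_max_image Finset.univ (stripGauge x d₁) Finset.univ_nonempty
  have hpos : 0 ≤ h j d₁ := sub_nonneg.2 (max_le (hj _ (Finset.mem_univ _))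
    (hj _ (Finset.mem_univ _)))
  obtain ⟨d₂, h₂, hd₂, hd₂0⟩ := hplane j
  have hneg : h j d₂ ≤ 0 := by
    simp only [h, (stripGauge_eq_zero hx).2 hd₂0]
    linarith [le_max_of_le_left (c := stripGauge x d₂ (j + 2)) (stripGauge_nonneg hx d₂ (j + 1))]
  obtain ⟨m, hm, hmd⟩ := hline d₁
  obtain ⟨r, hr, hr0, hzero⟩ :=
    C.convex.exists_ne_zero_eq_zero (hh j) h₁ h₂ hm hd₁ hd₂ hmd hpos hneg
  have heq : stripGauge x r j = max (stripGauge x r (j + 1)) (stripGauge x r (j + 2)) :=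
    sub_eq_zero.1 hzero
  have hle : ∀ k, stripGauge x r k ≤ stripGauge x r j := by
    intro k
    rcases hothers j k with rfl | rfl | rfl
    · exact le_rfl
    · exact (le_max_left _ _).trans heq.ge
    · exact (le_max_right _ _).trans heq.ge
  have hgpos : 0 < stripGauge x r j := by
    refine (stripGauge_nonneg hx r j).lt_of_ne fun h0 => hr0 ?_
    ext k
    exact (stripGauge_eq_zero hx).1 (((hle k).trans h0.ge).antisymm (stripGauge_nonneg hx r k))
  refine ⟨(stripGauge x r j)⁻¹ • r, C.smul_mem (inv_pos.2 hgpos) hr, ?_⟩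
  rcases max_choice (stripGauge x r (j + 1)) (stripGauge x r (j + 2)) with hc | hc
  · exact add_smul_mem_cubeSkel hx (hne1 j) hgpos (by rw [heq, hc]) hle
  · exact add_smul_mem_cubeSkel hx (hne2 j) hgpos (by rw [heq, hc]) hle

/-- From every point `x` of a convex subset of the cube that touches all faces at opposite points,
one reaches the 1-skeleton or a touching point by moving away from some point of the set. -/
theorem exists_add_smul_sub_mem {L : Set (Fin 3 → ℝ)} (hconv : Convex ℝ L)
    (hL : ∀ x ∈ L, ∀ i, x i ∈ Icc (0 : ℝ) 1) (q : Fin 3 → Fin 3 → ℝ) (hq : ∀ i, q i ∈ L)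
    (hq' : ∀ i, q i + Pi.single i 1 ∈ L) (hqi : ∀ i, q i i = 0) {x : Fin 3 → ℝ} (hx : x ∈ L) :
    ∃ s : ℝ, 0 ≤ s ∧ ∃ z ∈ L, (x + s • (x - z) ∈ cubeSkel ∨
      ∃ i, x + s • (x - z) = q i ∨ x + s • (x - z) = q i + Pi.single i 1) := by
  have hface : ∀ i, ∀ z ∈ L, (z = q i ∨ z = q i + Pi.single i 1) → x i = z i →
      (z i = 0 ∨ z i = 1) → ∃ s : ℝ, 0 ≤ s ∧ ∃ z ∈ L, (x + s • (x - z) ∈ cubeSkel ∨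
      ∃ i, x + s • (x - z) = q i ∨ x + s • (x - z) = q i + Pi.single i 1) := by
    intro i z hz hzq hxz hz01
    by_cases hxe : x = z
    · refine ⟨0, le_rfl, z, hz, Or.inr ⟨i, ?_⟩⟩
      simpa [hxe] using hzq
    · obtain ⟨s, hs, hmem, j, hj, hj01⟩ := exists_ray_exit (hL x hx) (sub_ne_zero.2 hxe)
      refine ⟨s, hs, z, hz, Or.inl ⟨hmem, i, j, ?_, ?_, hj01⟩⟩
      · rintro rfl
        exact hj (by simp [hxz])
      · simpa [hxz] using hz01
  by_cases hin : ∀ i, x i ∈ Ioo (0 : ℝ) 1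
  · have hconv' : Convex ℝ ({x} - L) := (convex_singleton x).sub hconv
    let C := ConvexCone.hull ℝ ({x} - L)
    have hCmem : ∀ z ∈ L, x - z ∈ C := fun z hz =>
      ConvexCone.subset_hull (Set.sub_mem_sub rfl hz)
    have hC0 : (0 : Fin 3 → ℝ) ∈ C := by simpa using hCmem x hx
    have hCsmul : ∀ c : ℝ, 0 ≤ c → ∀ r ∈ C, c • r ∈ C := by
      intro c hc r hr
      rcases hc.eq_or_lt with rfl | hc
      · simpa using hC0
      · exact C.smul_mem hc hr
    have hplane : ∀ i, ∃ r ∈ C, r ≠ 0 ∧ r i = 0 := by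
      intro i
      obtain ⟨h0, h1⟩ := hin i
      by_cases hxi : x = q i + Pi.single i (x i)
      · have hplus : Pi.single i (x i) ∈ C := by
          have := hCmem _ (hq i)
          rwa [sub_eq_iff_eq_add'.2 hxi] at this
        have hminus : -Pi.single i (1 - x i) ∈ C := by
          have := hCmem _ (hq' i)
          convert this using 1
          nth_rewrite 2 [hxi]
          rw [Pi.single_sub]
          abel
        have hline : ∀ c : ℝ, Pi.single i c ∈ C := by
          intro c
          rcases le_total 0 c with hc | hc
          · have := hCsmul (c / x i) (div_nonneg hc h0.le) _ hplus
            rwa [← Pi.single_smul, smul_eq_mul, div_mul_cancel₀ _ h0.ne'] at this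
          · have h1' : 0 < 1 - x i := by linarith
            have := hCsmul (-c / (1 - x i)) (div_nonneg (by linarith) h1'.le) _ hminus
            rwa [smul_neg, ← Pi.single_smul, smul_eq_mul, div_mul_cancel₀ _ h1'.ne',
              Pi.single_neg, neg_neg] at this
        have hji : i + 1 ≠ i := (by decide : ∀ k : Fin 3, k + 1 ≠ k) i
        refine ⟨(x - q (i + 1)) + Pi.single i (-(x - q (i + 1)) i),
          C.add_mem (hCmem _ (hq _)) (hline _), fun h => ?_, by simp⟩
        have := congrFun h (i + 1)
        simp [hji, hqi] at this
        exact (hin (i + 1)).1.ne' this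
      · refine ⟨(1 - x i) • (x - q i) + x i • (x - (q i + Pi.single i 1)),
          C.add_mem (C.smul_mem (by linarith) (hCmem _ (hq i)))
            (C.smul_mem h0 (hCmem _ (hq' i))), fun h => hxi ?_, ?_⟩
        · have h2 : (Pi.single i (x i) : Fin 3 → ℝ) = x i • Pi.single i 1 := by
            rw [← Pi.single_smul, smul_eq_mul, mul_one]
          rw [h2, ← sub_eq_zero, ← h]
          module
        · simp [hqi]
          ring
    have hline : ∀ d : Fin 3 → ℝ, ∃ m ∈ C, ∀ c : ℝ, m ≠ c • d := by
      intro d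
      by_contra! hcon
      have hsingle : ∀ i, ∃ c : ℝ, (Pi.single i 1 : Fin 3 → ℝ) = c • d := by
        intro i
        obtain ⟨c, hc⟩ := hcon _ (hCmem _ (hq i))
        obtain ⟨c', hc'⟩ := hcon _ (hCmem _ (hq' i))
        refine ⟨c - c', ?_⟩
        rw [sub_smul, ← hc, ← hc']
        abel
      obtain ⟨c, hc⟩ := hsingle 0
      obtain ⟨c', hc'⟩ := hsingle 1
      have e0 := congrFun hc 0
      have e1 := congrFun hc 1
      have e2 := congrFun hc' 1
      simp at e0 e1 e2
      rcases e1 with e1 | e1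
      · simp [e1] at e0
      · simp [e1] at e2
    obtain ⟨r, hr, hmem⟩ := exists_add_mem_cubeSkel hin hplane hline
    obtain ⟨s, hs, _, ⟨_, rfl, z, hz, rfl⟩, rfl⟩ := (ConvexCone.mem_hull_of_convex hconv').1 hr
    exact ⟨s, hs.le, z, hz, Or.inl hmem⟩
  · push Not at hin
    obtain ⟨i, hi⟩ := hin
    have hxi := hL x hx i
    rcases hxi.1.eq_or_lt with h0 | h0
    · exact hface i (q i) (hq i) (Or.inl rfl) (by rw [hqi, ← h0]) (Or.inl (hqi i))
    · have h1 : x i = 1 := hxi.2.antisymm (not_lt.1 fun h => hi ⟨h0, h⟩)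
      exact hface i _ (hq' i) (Or.inr rfl) (by simp [hqi, h1]) (Or.inr (by simp [hqi]))

/-- The covering estimate for a convex body normalized to be inscribed in the unit cube. -/
theorem coverNum_le_coverNumFam_of_inscribed {L : Set (Fin 3 → ℝ)} (hconv : Convex ℝ L)
    (hcomp : IsCompact L) (hint : (interior L).Nonempty)
    (hL : ∀ x ∈ L, ∀ i, x i ∈ Icc (0 : ℝ) 1) (q : Fin 3 → Fin 3 → ℝ) (hq : ∀ i, q i ∈ L)
    (hq' : ∀ i, q i + Pi.single i 1 ∈ L) (hqi : ∀ i, q i i = 0) {V : Set (Fin 3 → ℝ)}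
    (hV : ∀ i, q i ∈ V ∧ q i + Pi.single i 1 ∈ V) :
    coverNum L (interior L) ≤ coverNumFam (cubeSkel ∪ V) boxFam := by
  classical
  refine le_sInf ?_
  rintro _ ⟨T, rfl, hT, hcov⟩
  have hshift : ∀ b : (Fin 3 → ℝ) × Set (Fin 3 → ℝ), ∃ t : Fin 3 → ℝ,
      b ∈ T → ∀ y ∈ b.1 +ᵥ b.2, y + t ∈ interior L := by
    intro b
    by_cases hb : b ∈ T
    · obtain ⟨t, ht⟩ := exists_translate_box_subset_interior hconv hint q hq hq' (hT b hb)
      refine ⟨t - b.1, fun _ y hy => ?_⟩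
      obtain ⟨w, hw, rfl⟩ := hy
      simpa [add_comm, add_left_comm, sub_eq_add_neg] using ht w hw
    · exact ⟨0, fun h => absurd h hb⟩
  choose τ hτ using hshift
  obtain ⟨l, hl⟩ := exists_uniform_step hconv hcomp T τ (by
    intro x hx
    obtain ⟨s, hs, z, hz, hy⟩ := exists_add_smul_sub_mem hconv hL q hq hq' hqi hx
    have hyV : x + s • (x - z) ∈ cubeSkel ∪ V := by
      rcases hy with hy | ⟨i, hy | hy⟩
      · exact Or.inl hy
      · exact Or.inr (hy ▸ (hV i).1)
      · exact Or.inr (hy ▸ (hV i).2)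
    obtain ⟨b, hb, hyb⟩ := mem_iUnion₂.1 (hcov hyV)
    have hs1 : 0 < 1 + s := by linarith
    refine ⟨b, hb, (1 + s)⁻¹, inv_pos.2 hs1, ?_⟩
    have := hconv.combo_self_interior_mem_interior hz (hτ b hb _ hyb)
      (a := s * (1 + s)⁻¹) (b := (1 + s)⁻¹) (by positivity) (by positivity)
      (by field_simp; ring)
    convert this using 1
    ext j
    simp
    field_simp
    ring)
  refine le_trans (sInf_le ⟨T.image fun b => -(l • τ b), rfl, fun x hx => ?_⟩)
    (by exact_mod_cast Finset.card_image_le)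
  obtain ⟨b, hb, hmem⟩ := hl x hx
  refine mem_iUnion₂.2 ⟨-(l • τ b), Finset.mem_image_of_mem _ hb, x + l • τ b, hmem, ?_⟩
  simp

/-- Covering numbers do not increase under passing to an affine preimage. -/
theorem coverNum_le_coverNum_image (f : (Fin 3 → ℝ) ≃L[ℝ] (Fin 3 → ℝ)) (A B : Set (Fin 3 → ℝ))
    (w : Fin 3 → ℝ) :
    coverNum A B ≤ coverNum (w +ᵥ f '' A) (w +ᵥ f '' B) := by
  classical
  refine le_sInf ?_
  rintro _ ⟨T, rfl, hT⟩
  refine le_trans (sInf_le ⟨T.image f.symm, rfl, fun x hx => ?_⟩)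
    (by exact_mod_cast Finset.card_image_le)
  obtain ⟨t, ht, hmem⟩ := mem_iUnion₂.1 (hT (vadd_mem_vadd_set (a := w) (mem_image_of_mem f hx)))
  obtain ⟨_, ⟨_, ⟨b, hb, rfl⟩, rfl⟩, he⟩ := hmem
  refine mem_iUnion₂.2 ⟨f.symm t, Finset.mem_image_of_mem _ ht, b, hb, ?_⟩
  simp only [vadd_eq_add] at he ⊢
  apply f.injective
  rw [map_add, f.apply_symm_apply]
  have : w + (t + f b) = w + f x := by rw [← he]; abel
  exact add_left_cancel this

theorem coverNum_le_iSup_coverNumFam_boxes (K : Set (Fin 3 → ℝ))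
    (hconv : Convex ℝ K) (hcomp : IsCompact K) (hint : (interior K).Nonempty) :
    coverNum K (interior K) ≤
      ⨆ p ∈ {p : Fin 6 → ℝ | ∀ i, p i ∈ Icc (0:ℝ) 1},
        coverNumFam (cubeSkel ∪ Vpts p) boxFam := by
  obtain ⟨f, hseg, hwidth⟩ := exists_equiv_unit_segments hcomp hint
  choose a ha b hb hab using hseg
  let w : Fin 3 → ℝ := fun i => -f (a i) i
  let L : Set (Fin 3 → ℝ) := w +ᵥ f '' K
  have hLint : interior L = w +ᵥ f '' interior K := by
    rw [interior_vadd, ← f.coe_toHomeomorph, ← f.toHomeomorph.image_interior]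
  have hLconv : Convex ℝ L := (hconv.linear_image f.toLinearMap).vadd w
  have hLcomp : IsCompact L := (hcomp.image f.continuous).vadd w
  have hcube : ∀ x ∈ L, ∀ i, x i ∈ Icc (0 : ℝ) 1 := by
    rintro _ ⟨_, ⟨x, hx, rfl⟩, rfl⟩ i
    have h1 := hwidth x hx _ (ha i) i
    have h2 := hwidth _ (hb i) x hx i
    rw [hab] at h2
    simp only [Pi.add_apply, Pi.single_eq_same] at h2
    simp only [vadd_eq_add, Pi.add_apply, w, mem_Icc]
    constructor <;> linarith
  let q : Fin 3 → Fin 3 → ℝ := fun i => w + f (a i)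
  have hq : ∀ i, q i ∈ L := fun i => vadd_mem_vadd_set (mem_image_of_mem f (ha i))
  have hq' : ∀ i, q i + Pi.single i 1 ∈ L := by
    intro i
    have : q i + Pi.single i 1 = w +ᵥ f (b i) := by
      rw [hab, vadd_eq_add, ← add_assoc]
    rw [this]
    exact vadd_mem_vadd_set (mem_image_of_mem f (hb i))
  have hqi : ∀ i, q i i = 0 := fun i => by simp [q, w]
  let p : Fin 6 → ℝ := ![q 0 1, q 0 2, q 1 0, q 1 2, q 2 0, q 2 1]
  have hp : ∀ i, p i ∈ Icc (0 : ℝ) 1 := by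
    intro i
    fin_cases i <;> exact hcube _ (hq _) _
  have hV : ∀ i, q i ∈ Vpts p ∧ q i + Pi.single i 1 ∈ Vpts p := by
    have h0 : q 0 = ![0, p 0, p 1] := by
      ext j; fin_cases j <;> simp [p, hqi]
    have h0' : q 0 + Pi.single 0 1 = ![1, p 0, p 1] := by
      ext j; fin_cases j <;> simp [p, hqi]
    have h1 : q 1 = ![p 2, 0, p 3] := by
      ext j; fin_cases j <;> simp [p, hqi]
    have h1' : q 1 + Pi.single 1 1 = ![p 2, 1, p 3] := by
      ext j; fin_cases j <;> simp [p, hqi]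
    have h2 : q 2 = ![p 4, p 5, 0] := by
      ext j; fin_cases j <;> simp [p, hqi]
    have h2' : q 2 + Pi.single 2 1 = ![p 4, p 5, 1] := by
      ext j; fin_cases j <;> simp [p, hqi]
    intro i
    fin_cases i
    · exact ⟨by simp [Vpts, ← h0], by simp [Vpts, ← h0']⟩
    · exact ⟨by simp [Vpts, ← h1], by simp [Vpts, ← h1']⟩
    · exact ⟨by simp [Vpts, ← h2], by simp [Vpts, ← h2']⟩
  refine le_trans (coverNum_le_coverNum_image f K (interior K) w) ?_
  rw [← hLint]
  refine le_trans (coverNum_le_coverNumFam_of_inscribed hLconv hLcomp ?_ hcube q hq hq' hqi hV)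
    (le_iSup₂_of_le p hp le_rfl)
  rw [hLint]
  exact (hint.image f).vadd_set
end

section
/- For any convex body K in ℝ³, C(K, int(K)) ≤ max{ C(E ∪ V_p, int(O_p)) : p ∈ [0,1]⁶ }. -/
open Set Pointwise

/-- If `x = l • z + (1 - l) • k` with `0 < l ≤ 1` and `k ∈ S`, then `z` lies on the ray that leaves
`x` in the direction opposite to a point of `S`. -/
def ReachesAwayFrom (S : Set (Fin 3 → ℝ)) (x z : Fin 3 → ℝ) : Prop :=
  ∃ l : ℝ, 0 < l ∧ l ≤ 1 ∧ ∃ k ∈ S, x = l • z + (1 - l) • k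

theorem ReachesAwayFrom.trans {S : Set (Fin 3 → ℝ)} (hS : Convex ℝ S) {x y z : Fin 3 → ℝ}
    (hxy : ReachesAwayFrom S x y) (hyz : ReachesAwayFrom S y z) : ReachesAwayFrom S x z := by
  obtain ⟨l, hl, hl1, k, hk, rfl⟩ := hxy
  obtain ⟨m, hm, hm1, k', hk', rfl⟩ := hyz
  have hlm : l * m ≤ 1 := mul_le_one₀ hl1 hm.le hm1
  refine ⟨l * m, by positivity, hlm, ?_⟩
  rcases hlm.eq_or_lt with h | h
  · have h1 : l = 1 := by nlinarith
    have h2 : m = 1 := by nlinarith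
    exact ⟨k, hk, by simp [h1, h2]⟩
  · have hpos : 0 < 1 - l * m := by linarith
    refine ⟨(l * (1 - m) / (1 - l * m)) • k' + ((1 - l) / (1 - l * m)) • k,
      hS hk' hk ?_ ?_ ?_, ?_⟩
    · have : 0 ≤ 1 - m := by linarith
      positivity
    · have : 0 ≤ 1 - l := by linarith
      positivity
    · field_simp
      ring
    · ext i
      simp only [Pi.add_apply, Pi.smul_apply, smul_eq_mul]
      field_simp
      ring

theorem exists_endpoint_combination {a q : ℝ} (ha : a ∈ Icc (0:ℝ) 1) (hq : q ∈ Icc (0:ℝ) 1) :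
    ∃ l ∈ Icc (0:ℝ) 1, ∃ e : ℝ, (e = 0 ∨ e = 1) ∧ a = l * e + (1 - l) * q := by
  obtain ⟨ha0, ha1⟩ := ha
  obtain ⟨hq0, hq1⟩ := hq
  rcases lt_trichotomy a q with h | h | h
  · have hq' : 0 < q := by linarith
    refine ⟨(q - a) / q, ⟨div_nonneg (by linarith) hq0, ?_⟩, 0, Or.inl rfl, ?_⟩
    · rw [div_le_one hq']
      linarith
    · field_simp
      ring
  · exact ⟨0, by simp, 0, Or.inl rfl, by simp [h]⟩
  · have hq' : 0 < 1 - q := by linarith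
    refine ⟨(a - q) / (1 - q), ⟨div_nonneg (by linarith) hq'.le, ?_⟩, 1, Or.inr rfl, ?_⟩
    · rw [div_le_one hq']
      linarith
    · field_simp
      ring

theorem div_combination_mem_Icc {l m e r : ℝ} (hl : 0 < l) (hm : 0 ≤ m) (hml : m ≤ l)
    (he : e = 0 ∨ e = 1) (hr : r ∈ Icc (0:ℝ) 1) : r + m / l * (e - r) ∈ Icc (0:ℝ) 1 := by
  have h0 : 0 ≤ m / l := by positivity
  have h1 : m / l ≤ 1 := (div_le_one hl).2 hml
  obtain ⟨hr0, hr1⟩ := hr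
  rcases he with rfl | rfl <;> constructor <;> nlinarith

/-- In the unit square, the ray from a point away from another one hits the boundary. -/
theorem exists_square_boundary_combination {a b q r : ℝ} (ha : a ∈ Icc (0:ℝ) 1)
    (hb : b ∈ Icc (0:ℝ) 1) (hq : q ∈ Icc (0:ℝ) 1) (hr : r ∈ Icc (0:ℝ) 1)
    (hne : ¬(a = q ∧ b = r)) :
    ∃ l : ℝ, 0 < l ∧ l ≤ 1 ∧ ∃ c ∈ Icc (0:ℝ) 1, ∃ d ∈ Icc (0:ℝ) 1,
      ((c = 0 ∨ c = 1) ∨ (d = 0 ∨ d = 1)) ∧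
      a = l * c + (1 - l) * q ∧ b = l * d + (1 - l) * r := by
  obtain ⟨l, hl, e, he, rfl⟩ := exists_endpoint_combination ha hq
  obtain ⟨m, hm, f, hf, rfl⟩ := exists_endpoint_combination hb hr
  have unit_mem : ∀ {t : ℝ}, t = 0 ∨ t = 1 → t ∈ Icc (0:ℝ) 1 := by
    rintro t (rfl | rfl) <;> simp
  rcases le_total m l with hml | hml
  · have hl0 : 0 < l := by
      refine hl.1.lt_of_ne' fun h => hne ?_
      have : m = 0 := le_antisymm (h ▸ hml) hm.1
      simp [h, this]
    exact ⟨l, hl0, hl.2, e, unit_mem he, _, div_combination_mem_Icc hl0 hm.1 hml hf hr,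
      Or.inl he, rfl, by field_simp; ring⟩
  · have hm0 : 0 < m := by
      refine hm.1.lt_of_ne' fun h => hne ?_
      have : l = 0 := le_antisymm (h ▸ hml) hl.1
      simp [h, this]
    exact ⟨m, hm0, hm.2, _, div_combination_mem_Icc hm0 hl.1 hml he hq, f, unit_mem hf,
      Or.inr hf, by field_simp; ring, rfl⟩

theorem reachesAwayFrom_self {S : Set (Fin 3 → ℝ)} {x : Fin 3 → ℝ} (hS : S.Nonempty) :
    ReachesAwayFrom S x x := by
  obtain ⟨k, hk⟩ := hS
  exact ⟨1, one_pos, le_rfl, k, hk, by simp⟩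

theorem Vpts_subset_Oc (p : Fin 6 → ℝ) : Vpts p ⊆ Oc p := subset_convexHull ℝ _

theorem exists_reachesAwayFrom_of_mem_face_one {p : Fin 6 → ℝ} (hp : ∀ i, p i ∈ Icc (0:ℝ) 1)
    {a e b : ℝ} (ha : a ∈ Icc (0:ℝ) 1) (he : e = 0 ∨ e = 1) (hb : b ∈ Icc (0:ℝ) 1) :
    ∃ z ∈ cubeSkel ∪ Vpts p, ReachesAwayFrom (Oc p) ![a, e, b] z := by
  have hv : ![p 2, e, p 3] ∈ Vpts p := by
    rcases he with rfl | rfl <;> simp [Vpts]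
  by_cases hne : a = p 2 ∧ b = p 3
  · obtain ⟨rfl, rfl⟩ := hne
    exact ⟨_, Or.inr hv, reachesAwayFrom_self ⟨_, Vpts_subset_Oc p hv⟩⟩
  · obtain ⟨l, hl, hl1, c, hc, d, hd, hcd, hac, hbd⟩ :=
      exists_square_boundary_combination ha hb (hp 2) (hp 3) hne
    refine ⟨![c, e, d], Or.inl ⟨?_, ?_⟩, l, hl, hl1, _, Vpts_subset_Oc p hv, ?_⟩
    · intro i
      fin_cases i
      · exact hc
      · rcases he with rfl | rfl <;> simp
      · exact hd
    · rcases hcd with h | h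
      · exact ⟨0, 1, by decide, h, he⟩
      · exact ⟨2, 1, by decide, h, he⟩
    · ext i
      fin_cases i
      · simpa using hac
      · simp; ring
      · simpa using hbd

theorem exists_reachesAwayFrom_of_mem_face_two {p : Fin 6 → ℝ} (hp : ∀ i, p i ∈ Icc (0:ℝ) 1)
    {a b e : ℝ} (ha : a ∈ Icc (0:ℝ) 1) (hb : b ∈ Icc (0:ℝ) 1) (he : e = 0 ∨ e = 1) :
    ∃ z ∈ cubeSkel ∪ Vpts p, ReachesAwayFrom (Oc p) ![a, b, e] z := by
  have hv : ![p 4, p 5, e] ∈ Vpts p := by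
    rcases he with rfl | rfl <;> simp [Vpts]
  by_cases hne : a = p 4 ∧ b = p 5
  · obtain ⟨rfl, rfl⟩ := hne
    exact ⟨_, Or.inr hv, reachesAwayFrom_self ⟨_, Vpts_subset_Oc p hv⟩⟩
  · obtain ⟨l, hl, hl1, c, hc, d, hd, hcd, hac, hbd⟩ :=
      exists_square_boundary_combination ha hb (hp 4) (hp 5) hne
    refine ⟨![c, d, e], Or.inl ⟨?_, ?_⟩, l, hl, hl1, _, Vpts_subset_Oc p hv, ?_⟩
    · intro i
      fin_cases i
      · exact hc
      · exact hd
      · rcases he with rfl | rfl <;> simp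
    · rcases hcd with h | h
      · exact ⟨0, 2, by decide, h, he⟩
      · exact ⟨1, 2, by decide, h, he⟩
    · ext i
      fin_cases i
      · simpa using hac
      · simpa using hbd
      · simp; ring

theorem exists_reachesAwayFrom_of_mem_cube {p : Fin 6 → ℝ} (hp : ∀ i, p i ∈ Icc (0:ℝ) 1)
    {x : Fin 3 → ℝ} (hx : ∀ i, x i ∈ Icc (0:ℝ) 1) :
    ∃ z ∈ cubeSkel ∪ Vpts p, ReachesAwayFrom (Oc p) x z := by
  have hv0 : ![0, p 0, p 1] ∈ Vpts p := by simp [Vpts]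
  have hv1 : ![1, p 0, p 1] ∈ Vpts p := by simp [Vpts]
  have hx0 := hx 0
  have hconv : Convex ℝ (Oc p) := convex_convexHull ℝ _
  by_cases hne : x 1 = p 0 ∧ x 2 = p 1
  · rcases hx0.1.eq_or_lt with h | h
    · refine ⟨_, Or.inr hv0, 1, one_pos, le_rfl, _, Vpts_subset_Oc p hv0, ?_⟩
      ext i
      fin_cases i <;> simp [← h, hne]
    · refine ⟨_, Or.inr hv1, x 0, h, hx0.2, _, Vpts_subset_Oc p hv0, ?_⟩
      ext i
      fin_cases i
      · simp
      · simp [hne.1]; ring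
      · simp [hne.2]; ring
  · obtain ⟨l, hl, hl1, c, hc, d, hd, hcd, hac, hbd⟩ :=
      exists_square_boundary_combination (hx 1) (hx 2) (hp 0) (hp 1) hne
    have hk : ![x 0, p 0, p 1] ∈ Oc p := by
      have := hconv (Vpts_subset_Oc p hv1) (Vpts_subset_Oc p hv0) hx0.1 (sub_nonneg.2 hx0.2)
        (by ring)
      convert this using 1
      ext i
      fin_cases i
      · simp
      · simp; ring
      · simp; ring
    have hxz : ReachesAwayFrom (Oc p) x ![x 0, c, d] := by
      refine ⟨l, hl, hl1, _, hk, ?_⟩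
      ext i
      fin_cases i
      · simp; ring
      · simpa using hac
      · simpa using hbd
    rcases hcd with h | h
    · obtain ⟨z, hz, hr⟩ := exists_reachesAwayFrom_of_mem_face_one hp hx0 h hd
      exact ⟨z, hz, hxz.trans hconv hr⟩
    · obtain ⟨z, hz, hr⟩ := exists_reachesAwayFrom_of_mem_face_two hp hx0 hc h
      exact ⟨z, hz, hxz.trans hconv hr⟩

/-- If every point of a compact convex set can be pushed into the interior by a positive fraction
of one of finitely many vectors, then that many translates of the interior cover the set. -/
theorem coverNum_interior_le_card {K : Set (Fin 3 → ℝ)} (hconv : Convex ℝ K) (hcomp : IsCompact K)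
    (T : Finset (Fin 3 → ℝ))
    (h : ∀ x ∈ K, ∃ t ∈ T, ∃ l : ℝ, 0 < l ∧ x - l • t ∈ interior K) :
    coverNum K (interior K) ≤ T.card := by
  classical
  have shrink : ∀ x ∈ K, ∀ (t : Fin 3 → ℝ) (l m : ℝ), 0 < m → m ≤ l →
      x - l • t ∈ interior K → x - m • t ∈ interior K := by
    intro x hx t l m hm hml hl
    have hl0 : 0 < l := hm.trans_le hml
    have := hconv.combo_interior_self_mem_interior hl hx (div_pos hm hl0)
      (sub_nonneg.2 ((div_le_one hl0).2 hml)) (by ring)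
    convert this using 1
    ext i
    simp only [Pi.sub_apply, Pi.add_apply, Pi.smul_apply, smul_eq_mul]
    field_simp
    ring
  let U : ℕ → Set (Fin 3 → ℝ) := fun n =>
    {x | ∃ t ∈ T, ∃ l : ℝ, 1 / ((n : ℝ) + 1) ≤ l ∧ x - l • t ∈ interior K}
  have hU : ∀ n, IsOpen (U n) := by
    intro n
    have : U n = ⋃ t ∈ T, ⋃ l ∈ Ici (1 / ((n : ℝ) + 1)), {x | x - l • t ∈ interior K} := by
      ext x
      simp [U]
    rw [this]
    exact isOpen_biUnion fun t _ => isOpen_biUnion fun l _ =>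
      isOpen_interior.preimage (by fun_prop : Continuous fun x : Fin 3 → ℝ => x - l • t)
  have hmono : Monotone U := by
    rintro m n hmn x ⟨t, ht, l, hl, hx⟩
    exact ⟨t, ht, l, (Nat.one_div_le_one_div hmn).trans hl, hx⟩
  obtain ⟨n, hn⟩ := hcomp.elim_directed_cover U hU (fun x hx => by
    obtain ⟨t, ht, l, hl, hxl⟩ := h x hx
    obtain ⟨n, hn⟩ := exists_nat_one_div_lt hl
    exact mem_iUnion.2 ⟨n, t, ht, l, hn.le, hxl⟩) hmono.directed_le
  calc coverNum K (interior K)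
      ≤ ((T.image fun t => (1 / ((n : ℝ) + 1)) • t).card : ℕ∞) := by
        refine sInf_le ⟨_, rfl, fun x hx => ?_⟩
        obtain ⟨t, ht, l, hl, hxl⟩ := hn hx
        refine mem_biUnion (Finset.mem_image_of_mem _ ht) ?_
        rw [mem_vadd_set_iff_neg_vadd_mem, vadd_eq_add, neg_add_eq_sub]
        exact shrink x hx t l _ Nat.one_div_pos_of_nat hl hxl
    _ ≤ T.card := by exact_mod_cast Finset.card_image_le

/-- Auerbach's lemma for the difference body: a compact set with nonempty interior has three chords
that form a basis such that the set has width at most one along each dual functional. -/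
theorem exists_chords_width_le_one {K : Set (Fin 3 → ℝ)} (hcomp : IsCompact K)
    (hint : (interior K).Nonempty) :
    ∃ A : Matrix (Fin 3) (Fin 3) ℝ, A.det ≠ 0 ∧ (∀ i, A i ∈ K - K) ∧
      ∀ y : Fin 3 → ℝ, Matrix.vecMul y A ∈ K - K → ∀ i, y i ≤ 1 := by
  have hD : IsCompact (K - K) := by
    rw [sub_eq_add_neg]
    exact hcomp.add hcomp.neg
  obtain ⟨c, hc⟩ := hint
  have hnhds : ∀ᶠ d : ℝ in nhds 0, ∀ i, c + d • (Pi.single i 1 : Fin 3 → ℝ) ∈ K := by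
    refine Filter.eventually_all.2 fun i => ?_
    have hcont : Continuous fun d : ℝ => c + d • (Pi.single i 1 : Fin 3 → ℝ) := by fun_prop
    exact hcont.continuousAt.eventually (by simpa using mem_interior_iff_mem_nhds.1 hc)
  obtain ⟨d, hd, hd0⟩ := ((hnhds.filter_mono nhdsWithin_le_nhds).and
    (self_mem_nhdsWithin : ∀ᶠ d : ℝ in nhdsWithin 0 (Ioi 0), d ∈ Ioi (0:ℝ))).exists
  have hcK : c ∈ K := interior_subset hc
  have hdI : d • (1 : Matrix (Fin 3) (Fin 3) ℝ) ∈
      (univ.pi fun _ => K - K : Set (Fin 3 → Fin 3 → ℝ)) := by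
    intro i _
    refine ⟨_, hd i, c, hcK, ?_⟩
    ext j
    simp [Matrix.one_apply, Pi.single_apply, eq_comm]
  obtain ⟨A, hA, hmax⟩ := (isCompact_univ_pi fun _ : Fin 3 => hD).exists_isMaxOn ⟨_, hdI⟩
    (f := fun A : Fin 3 → Fin 3 → ℝ => Matrix.det (Matrix.of A))
    (Continuous.continuousOn (Continuous.matrix_det continuous_id))
  have hdet : 0 < Matrix.det (Matrix.of A) := by
    refine lt_of_lt_of_le ?_ (hmax hdI)
    have : 0 < (d • (1 : Matrix (Fin 3) (Fin 3) ℝ)).det := by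
      rw [Matrix.det_smul]
      simpa using pow_pos hd0 3
    exact this
  refine ⟨Matrix.of A, hdet.ne', fun i => hA i (mem_univ i), fun y hy i => ?_⟩
  have hmem : Matrix.updateRow (Matrix.of A) i (Matrix.vecMul y (Matrix.of A)) ∈
      (univ.pi fun _ => K - K : Set (Fin 3 → Fin 3 → ℝ)) := by
    intro j _
    rcases eq_or_ne j i with rfl | hji
    · simpa [Matrix.updateRow_self] using hy
    · rw [Matrix.updateRow_ne hji]
      exact hA j (mem_univ j)
  have hle : (Matrix.updateRow (Matrix.of A) i (Matrix.vecMul y (Matrix.of A))).det ≤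
      (Matrix.of A).det := hmax hmem
  rw [Matrix.vecMul_eq_sum, Matrix.det_updateRow_sum, smul_eq_mul] at hle
  exact le_of_mul_le_mul_right (by linarith) hdet

/-- A compact set with nonempty interior is affinely equivalent to a subset of the unit cube that
contains some configuration `Vpts p`. -/
theorem exists_affine_Vpts_subset_cube {K : Set (Fin 3 → ℝ)} (hcomp : IsCompact K)
    (hint : (interior K).Nonempty) :
    ∃ (L : (Fin 3 → ℝ) ≃L[ℝ] (Fin 3 → ℝ)) (c : Fin 3 → ℝ) (p : Fin 6 → ℝ),
      (∀ i, p i ∈ Icc (0:ℝ) 1) ∧ (∀ x ∈ K, ∀ i, (L x - c) i ∈ Icc (0:ℝ) 1) ∧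
      ∀ v ∈ Vpts p, L.symm (v + c) ∈ K := by
  obtain ⟨A, hdet, hA, hwidth⟩ := exists_chords_width_le_one hcomp hint
  have hunit : IsUnit A.det := hdet.isUnit
  let L : (Fin 3 → ℝ) ≃L[ℝ] (Fin 3 → ℝ) :=
    (LinearEquiv.ofLinearMap (Matrix.vecMulLinear A⁻¹) (Matrix.vecMulLinear A)
      (LinearMap.ext fun x => by simp [Matrix.vecMul_vecMul, Matrix.mul_nonsing_inv _ hunit])
      (LinearMap.ext fun x => by simp [Matrix.vecMul_vecMul, Matrix.nonsing_inv_mul _ hunit])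
      ).toContinuousLinearEquiv
  have hwidthL : ∀ x ∈ K, ∀ y ∈ K, ∀ i, L x i - L y i ≤ 1 := by
    intro x hx y hy i
    have hmem : Matrix.vecMul (L (x - y)) A ∈ K - K := by
      have : Matrix.vecMul (L (x - y)) A = x - y := L.symm_apply_apply (x - y)
      rw [this]
      exact sub_mem_sub hx hy
    simpa using hwidth _ hmem i
  have hLA : ∀ i, L (A i) = Pi.single i 1 := by
    intro i
    rw [← L.eq_symm_apply]
    change _ = Matrix.vecMul (Pi.single i 1) A
    simp [Matrix.row]
  choose a ha b hb hab using hA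
  have hLab : ∀ i, L (a i) = L (b i) + Pi.single i 1 := by
    intro i
    rw [← hLA i, ← hab i]
    simp
  let c : Fin 3 → ℝ := fun i => L (b i) i
  have hcube : ∀ x ∈ K, ∀ i, (L x - c) i ∈ Icc (0:ℝ) 1 := by
    intro x hx i
    refine ⟨?_, hwidthL x hx _ (hb i) i⟩
    have h1 := hwidthL _ (ha i) x hx i
    have h2 := congrFun (hLab i) i
    simp only [Pi.add_apply, Pi.single_eq_same] at h2
    simp only [Pi.sub_apply, c]
    linarith
  refine ⟨L, c, ![(L (b 0) - c) 1, (L (b 0) - c) 2, (L (b 1) - c) 0, (L (b 1) - c) 2,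
    (L (b 2) - c) 0, (L (b 2) - c) 1], ?_, hcube, ?_⟩
  · intro i
    fin_cases i <;> exact hcube _ (hb _) _
  · have key : ∀ v x, x ∈ K → v = L x - c → L.symm (v + c) ∈ K := by
      rintro v x hx rfl
      simpa using hx
    have hLb : ∀ i v, (∀ j, v j = if j = i then 0 else (L (b i) - c) j) → v = L (b i) - c := by
      intro i v h
      ext j
      rw [h j]
      split_ifs with hji
      · simp [hji, c]
      · rfl
    have hLa : ∀ i v, (∀ j, v j = if j = i then 1 else (L (b i) - c) j) → v = L (a i) - c := by
      intro i v h
      ext j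
      rw [h j, hLab]
      split_ifs with hji
      · simp [hji, c]
      · simp [Pi.single_eq_of_ne hji]
    rintro v (rfl | rfl | rfl | rfl | rfl | rfl)
    · exact key _ _ (hb 0) (hLb 0 _ fun j => by fin_cases j <;> simp)
    · exact key _ _ (ha 0) (hLa 0 _ fun j => by fin_cases j <;> simp)
    · exact key _ _ (hb 1) (hLb 1 _ fun j => by fin_cases j <;> simp)
    · exact key _ _ (ha 1) (hLa 1 _ fun j => by fin_cases j <;> simp)
    · exact key _ _ (hb 2) (hLb 2 _ fun j => by fin_cases j <;> simp)
    · exact key _ _ (ha 2) (hLa 2 _ fun j => by fin_cases j <;> simp)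

theorem coverNum_le_iSup_coverNum_int_Oc (K : Set (Fin 3 → ℝ))
    (hconv : Convex ℝ K) (hcomp : IsCompact K) (hint : (interior K).Nonempty) :
    coverNum K (interior K) ≤
      ⨆ p ∈ {p : Fin 6 → ℝ | ∀ i, p i ∈ Icc (0:ℝ) 1},
        coverNum (cubeSkel ∪ Vpts p) (interior (Oc p)) := by
  classical
  obtain ⟨L, c, p, hp, hcube, hV⟩ := exists_affine_Vpts_subset_cube hcomp hint
  refine le_trans ?_ (le_iSup₂_of_le p hp le_rfl)
  refine le_sInf ?_
  rintro n ⟨T, rfl, hT⟩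
  have hOc : ∀ v ∈ Oc p, L.symm (v + c) ∈ K := by
    have hpre : Convex ℝ {v | L.symm (v + c) ∈ K} := by
      intro v hv w hw s t hs ht hst
      have := hconv hv hw hs ht hst
      rw [← map_smul, ← map_smul, ← map_add] at this
      have heq : s • (v + c) + t • (w + c) = s • v + t • w + c := by
        rw [smul_add, smul_add, add_add_add_comm, ← add_smul, hst, one_smul]
      rwa [heq] at this
    exact convexHull_min hV hpre
  have hOcInt : ∀ x, L x - c ∈ interior (Oc p) → x ∈ interior K := by
    have hopen : IsOpen {x | L x - c ∈ interior (Oc p)} :=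
      isOpen_interior.preimage (by fun_prop : Continuous fun x => L x - c)
    refine fun x hx => interior_maximal (fun y hy => ?_) hopen hx
    simpa using hOc _ (interior_subset hy)
  refine (coverNum_interior_le_card hconv hcomp (T.image L.symm) fun x hx => ?_).trans
    (by exact_mod_cast Finset.card_image_le)
  obtain ⟨z, hz, l, hl, hl1, k, hk, hxz⟩ := exists_reachesAwayFrom_of_mem_cube hp (hcube x hx)
  obtain ⟨t, ht, hzt⟩ := mem_iUnion₂.1 (hT hz)
  rw [mem_vadd_set_iff_neg_vadd_mem, vadd_eq_add, neg_add_eq_sub] at hzt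
  refine ⟨L.symm t, Finset.mem_image_of_mem _ ht, l, hl, ?_⟩
  have hzK : L.symm (z - t + c) ∈ interior K := hOcInt _ (by simpa using hzt)
  have := hconv.combo_interior_self_mem_interior hzK (hOc k hk) hl (sub_nonneg.2 hl1) (by ring)
  convert this using 1
  apply L.injective
  simp only [map_sub, map_add, map_smul, L.apply_symm_apply]
  rw [sub_eq_iff_eq_add.1 hxz]
  module
end

section
/- Let P = ∏_{i=1}^{6} [a_i, a_i+δ_i] ⊆ [0,1]⁶ with all δ_i > 0, let U_P be the set of 64 vertices of P, and let Q_P = ⋂_{v ∈ U_P} O_v. Then for every p ∈ P one has Q_P ⊆ O_p. -/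
open Set Pointwise

/-- If `x` lies in the convex hull of `A ∪ (B + t • d)` for two values of `t`, then it does for every
value in between. -/
theorem convex_setOf_mem_convexHull_union_vadd {E : Type*} [AddCommGroup E] [Module ℝ E]
    {A B : Set E} (hA : A.Nonempty) (hB : B.Nonempty) (d x : E) :
    Convex ℝ {t : ℝ | x ∈ convexHull ℝ (A ∪ ((t • d) +ᵥ B))} := by
  have key : ∀ t : ℝ, x ∈ convexHull ℝ (A ∪ ((t • d) +ᵥ B)) →
      ∃ k ∈ convexHull ℝ A, ∃ l ∈ convexHull ℝ B, ∃ α c : ℝ,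
        0 ≤ α ∧ 0 ≤ c ∧ α + c = 1 ∧ α • k + c • (t • d + l) = x := by
    intro t ht
    rw [convexHull_union hA hB.vadd_set, mem_convexJoin] at ht
    obtain ⟨k, hk, m, hm, α, c, hα, hc, hαc, hx⟩ := ht
    rw [convexHull_vadd] at hm
    obtain ⟨l, hl, rfl⟩ := hm
    exact ⟨k, hk, l, hl, α, c, hα, hc, hαc, hx⟩
  rintro t₀ h₀ t₁ h₁ μ₀ μ₁ hμ₀ hμ₁ hμ
  obtain ⟨k₀, hk₀, l₀, hl₀, α₀, c₀, hα₀, hc₀, hs₀, hx₀⟩ := key t₀ h₀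
  obtain ⟨k₁, hk₁, l₁, hl₁, α₁, c₁, hα₁, hc₁, hs₁, hx₁⟩ := key t₁ h₁
  simp only [smul_eq_mul, mem_ofPred_eq]
  set t := μ₀ * t₀ + μ₁ * t₁ with ht
  have hAs : convexHull ℝ A ⊆ convexHull ℝ (A ∪ ((t • d) +ᵥ B)) :=
    convexHull_mono subset_union_left
  rcases hc₀.eq_or_lt with rfl | hc₀
  · obtain rfl : α₀ = 1 := by linarith
    rw [one_smul, zero_smul, add_zero] at hx₀
    exact hAs (hx₀ ▸ hk₀)
  rcases hc₁.eq_or_lt with rfl | hc₁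
  · obtain rfl : α₁ = 1 := by linarith
    rw [one_smul, zero_smul, add_zero] at hx₁
    exact hAs (hx₁ ▸ hk₁)
  have hm : t • d + (μ₀ • l₀ + μ₁ • l₁) ∈ convexHull ℝ (A ∪ ((t • d) +ᵥ B)) := by
    refine convexHull_mono subset_union_right ?_
    rw [convexHull_vadd]
    exact vadd_mem_vadd_set (convex_convexHull ℝ B hl₀ hl₁ hμ₀ hμ₁ hμ)
  have hD : 0 < μ₀ * c₁ + μ₁ * c₀ := by
    rcases hμ₀.eq_or_lt with rfl | h
    · obtain rfl : μ₁ = 1 := by linarith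
      linarith
    · have := mul_pos h hc₁
      positivity
  set D := μ₀ * c₁ + μ₁ * c₀ with hDdef
  have hν : μ₀ * c₁ / D + μ₁ * c₀ / D = 1 := by rw [← add_div, div_self hD.ne']
  have hsum := (convex_convexHull ℝ (A ∪ ((t • d) +ᵥ B))).sum_mem (t := Finset.univ)
    (w := ![μ₀ * c₁ / D * α₀, μ₁ * c₀ / D * α₁, c₀ * c₁ / D])
    (z := ![k₀, k₁, t • d + (μ₀ • l₀ + μ₁ • l₁)])
    (by
      intro i _
      fin_cases i
      · change 0 ≤ μ₀ * c₁ / D * α₀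
        positivity
      · change 0 ≤ μ₁ * c₀ / D * α₁
        positivity
      · change 0 ≤ c₀ * c₁ / D
        positivity)
    (by
      simp only [Fin.sum_univ_three, Matrix.cons_val]
      obtain rfl : α₀ = 1 - c₀ := by linarith
      obtain rfl : α₁ = 1 - c₁ := by linarith
      linear_combination hν - c₀ * c₁ / D * hμ)
    (by
      intro i _
      fin_cases i
      exacts [hAs hk₀, hAs hk₁, hm])
  convert hsum using 1
  simp only [Fin.sum_univ_three, Matrix.cons_val]
  calc x = (μ₀ * c₁ / D) • x + (μ₁ * c₀ / D) • x := by rw [← add_smul, hν, one_smul]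
    _ = (μ₀ * c₁ / D) • (α₀ • k₀ + c₀ • (t₀ • d + l₀)) +
        (μ₁ * c₀ / D) • (α₁ • k₁ + c₁ • (t₁ • d + l₁)) := by rw [hx₀, hx₁]
    _ = _ := by
      rw [ht]
      module

/-- A set whose sections along every coordinate line are order-connected contains a box as soon as
it contains the vertices of the box. -/
theorem mem_of_forall_vertices_mem {ι : Type*} [Finite ι] [DecidableEq ι] {s : Set (ι → ℝ)}
    (hs : ∀ f i, OrdConnected {t : ℝ | Function.update f i t ∈ s}) {a b : ι → ℝ}
    (hv : ∀ v : ι → ℝ, (∀ i, v i = a i ∨ v i = b i) → v ∈ s)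
    {p : ι → ℝ} (hp : ∀ i, p i ∈ Icc (a i) (b i)) : p ∈ s := by
  have := Fintype.ofFinite ι
  suffices H : ∀ F : Finset ι, ∀ f : ι → ℝ, (∀ i, f i ∈ Icc (a i) (b i)) →
      (∀ i ∉ F, f i = a i ∨ f i = b i) → f ∈ s from
    H Finset.univ p hp fun i hi => absurd (Finset.mem_univ i) hi
  intro F
  induction F using Finset.induction_on with
  | empty => exact fun f _ hf => hv f fun i => hf i (Finset.notMem_empty i)
  | insert i F _ ih =>
    intro f hf hfF
    have hab : a i ≤ b i := (hf i).1.trans (hf i).2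
    have hend : ∀ t, t = a i ∨ t = b i → Function.update f i t ∈ s := by
      intro t ht
      refine ih _ (fun j => ?_) (fun j hj => ?_) <;> rcases eq_or_ne j i with rfl | hji
      · rcases ht with rfl | rfl <;> simp [hab]
      · simpa [hji] using hf j
      · simpa using ht
      · simpa [hji] using hfF j (by simp [hji, hj])
    have := (hs f i).out (hend _ (.inl rfl)) (hend _ (.inr rfl)) (hf i)
    simpa using this

/-- Moving one parameter of `Vpts` translates one of its three pairs along a fixed direction. -/
theorem exists_Vpts_update_eq_union_vadd (p : Fin 6 → ℝ) (i : Fin 6) :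
    ∃ (A B : Set (Fin 3 → ℝ)) (d : Fin 3 → ℝ), A.Nonempty ∧ B.Nonempty ∧
      ∀ t : ℝ, Vpts (Function.update p i t) = A ∪ ((t • d) +ᵥ B) := by
  let X (y z : ℝ) : Set (Fin 3 → ℝ) := {![0, y, z], ![1, y, z]}
  let Y (x z : ℝ) : Set (Fin 3 → ℝ) := {![x, 0, z], ![x, 1, z]}
  let Z (x y : ℝ) : Set (Fin 3 → ℝ) := {![x, y, 0], ![x, y, 1]}
  have hV : ∀ q : Fin 6 → ℝ, Vpts q = X (q 0) (q 1) ∪ Y (q 2) (q 3) ∪ Z (q 4) (q 5) := by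
    intro q
    simp only [Vpts, X, Y, Z, insert_union, singleton_union]
  have hX : ∀ y z, (X y z).Nonempty := fun y z => insert_nonempty _ _
  have hY : ∀ x z, (Y x z).Nonempty := fun x z => insert_nonempty _ _
  have hZ : ∀ x y, (Z x y).Nonempty := fun x y => insert_nonempty _ _
  fin_cases i
  · refine ⟨Y (p 2) (p 3) ∪ Z (p 4) (p 5), X 0 (p 1), ![0, 1, 0], (hY _ _).inl, hX _ _,
      fun t => ?_⟩
    rw [hV, union_assoc, union_comm]
    simp [X, ← image_vadd, image_pair]
  · refine ⟨Y (p 2) (p 3) ∪ Z (p 4) (p 5), X (p 0) 0, ![0, 0, 1], (hY _ _).inl, hX _ _,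
      fun t => ?_⟩
    rw [hV, union_assoc, union_comm]
    simp [X, ← image_vadd, image_pair]
  · refine ⟨X (p 0) (p 1) ∪ Z (p 4) (p 5), Y 0 (p 3), ![1, 0, 0], (hX _ _).inl, hY _ _,
      fun t => ?_⟩
    rw [hV, union_right_comm]
    simp [Y, ← image_vadd, image_pair]
  · refine ⟨X (p 0) (p 1) ∪ Z (p 4) (p 5), Y (p 2) 0, ![0, 0, 1], (hX _ _).inl, hY _ _,
      fun t => ?_⟩
    rw [hV, union_right_comm]
    simp [Y, ← image_vadd, image_pair]
  · refine ⟨X (p 0) (p 1) ∪ Y (p 2) (p 3), Z 0 (p 5), ![1, 0, 0], (hX _ _).inl, hZ _ _,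
      fun t => ?_⟩
    rw [hV]
    simp [Z, ← image_vadd, image_pair]
  · refine ⟨X (p 0) (p 1) ∪ Y (p 2) (p 3), Z (p 4) 0, ![0, 1, 0], (hX _ _).inl, hZ _ _,
      fun t => ?_⟩
    rw [hV]
    simp [Z, ← image_vadd, image_pair]

theorem QP_subset_Oc (a δ : Fin 6 → ℝ) (hδ : ∀ i, 0 < δ i)
    (ha : ∀ i, 0 ≤ a i) (hb : ∀ i, a i + δ i ≤ 1)
    (p : Fin 6 → ℝ) (hp : ∀ i, p i ∈ Icc (a i) (a i + δ i)) :
    (⋂ v ∈ {v : Fin 6 → ℝ | ∀ i, v i = a i ∨ v i = a i + δ i}, Oc v) ⊆ Oc p := by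
  intro x hx
  refine mem_of_forall_vertices_mem (s := {q | x ∈ Oc q}) (fun q i => ?_)
    (fun v hv => mem_iInter₂.1 hx v hv) hp
  obtain ⟨A, B, d, hA, hB, hV⟩ := exists_Vpts_update_eq_union_vadd q i
  simp only [mem_ofPred_eq, Oc, hV]
  exact (convex_setOf_mem_convexHull_union_vadd hA hB d x).ordConnected
end

section
/- Suppose q, r ∈ [0,1]⁶ differ in exactly one coordinate (i.e., the segment [q,r] is parallel to a coordinate axis of ℝ⁶) and p lies on the segment [q,r]. Then O_q ∩ O_r ⊆ O_p. -/
open Set Pointwise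

/-- A strict linear bound on the six points of `Vpts p`, written out in coordinates. -/
lemma forall_Vpts_lt_iff (p : Fin 6 → ℝ) (f : (Fin 3 → ℝ) →L[ℝ] ℝ) (u : ℝ) :
    (∀ v ∈ Vpts p, f v < u) ↔
      p 0 * f (Pi.single 1 1) + p 1 * f (Pi.single 2 1) < u ∧
      f (Pi.single 0 1) + p 0 * f (Pi.single 1 1) + p 1 * f (Pi.single 2 1) < u ∧
      p 2 * f (Pi.single 0 1) + p 3 * f (Pi.single 2 1) < u ∧
      p 2 * f (Pi.single 0 1) + f (Pi.single 1 1) + p 3 * f (Pi.single 2 1) < u ∧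
      p 4 * f (Pi.single 0 1) + p 5 * f (Pi.single 1 1) < u ∧
      p 4 * f (Pi.single 0 1) + p 5 * f (Pi.single 1 1) + f (Pi.single 2 1) < u := by
  have hf (v : Fin 3 → ℝ) : f v =
      v 0 * f (Pi.single 0 1) + v 1 * f (Pi.single 1 1) + v 2 * f (Pi.single 2 1) := by
    conv_lhs => rw [pi_eq_sum_univ' v]
    simp [Fin.sum_univ_three, map_add, map_smul]
  simp only [Vpts, mem_insert_iff, mem_singleton_iff, forall_eq_or_imp, forall_eq]
  simp [hf ![_, _, _]]

/-- If `p` lies on an axis-parallel segment `[q, r]`, an open half-space containing `Vpts p`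
contains `Vpts q` or `Vpts r`. -/
lemma forall_Vpts_lt_or_of_mem_segment {q r p : Fin 6 → ℝ} {i : Fin 6}
    (hqr : ∀ j, j ≠ i → q j = r j) (hp : p ∈ segment ℝ q r)
    {f : (Fin 3 → ℝ) →L[ℝ] ℝ} {u : ℝ} (hf : ∀ v ∈ Vpts p, f v < u) :
    (∀ v ∈ Vpts q, f v < u) ∨ ∀ v ∈ Vpts r, f v < u := by
  obtain ⟨s, t, hs, ht, hst, rfl⟩ := hp
  set p := s • q + t • r with hp
  have hpi (j : Fin 6) : p j = s * q j + t * r j := by simp [hp]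
  have hpq (j : Fin 6) (hj : j ≠ i) : q j = p j := by
    rw [hpi, ← hqr j hj, ← add_mul, hst, one_mul]
  have hpr (j : Fin 6) (hj : j ≠ i) : r j = p j := by rw [← hqr j hj, hpq j hj]
  have key (w : ℝ) : q i * w ≤ p i * w ∨ r i * w ≤ p i * w := by
    obtain rfl : s = 1 - t := by linarith
    rw [hpi]
    rcases le_total (q i * w) (r i * w) with h | h
    · left; nlinarith
    · right; nlinarith
  clear_value p
  simp only [forall_Vpts_lt_iff] at hf ⊢
  obtain ⟨h₁, h₂, h₃, h₄, h₅, h₆⟩ := hf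
  fin_cases i <;> simp [Fin.forall_fin_succ] at hpq hpr key <;> simp only [hpq, hpr]
  · exact (key (f (Pi.single 1 1))).imp (by grind) (by grind)
  · exact (key (f (Pi.single 2 1))).imp (by grind) (by grind)
  · exact (key (f (Pi.single 0 1))).imp (by grind) (by grind)
  · exact (key (f (Pi.single 2 1))).imp (by grind) (by grind)
  · exact (key (f (Pi.single 0 1))).imp (by grind) (by grind)
  · exact (key (f (Pi.single 1 1))).imp (by grind) (by grind)

/-- A strict linear bound on `Vpts p` extends to its convex hull. -/
lemma lt_of_mem_Oc {p : Fin 6 → ℝ} {f : (Fin 3 → ℝ) →L[ℝ] ℝ} {u : ℝ}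
    (hf : ∀ v ∈ Vpts p, f v < u) {x : Fin 3 → ℝ} (hx : x ∈ Oc p) : f x < u :=
  convexHull_min hf (convex_halfSpace_lt f.toLinearMap.isLinear u) hx

lemma isClosed_Oc (p : Fin 6 → ℝ) : IsClosed (Oc p) :=
  (show (Vpts p).Finite by simp [Vpts]).isClosed_convexHull ℝ

theorem Oc_inter_Oc_subset_Oc (q r p : Fin 6 → ℝ)
    (hq : ∀ i, q i ∈ Icc (0:ℝ) 1) (hr : ∀ i, r i ∈ Icc (0:ℝ) 1)
    (hdiff : ∃ i, q i ≠ r i ∧ ∀ j, j ≠ i → q j = r j)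
    (hp : p ∈ segment ℝ q r) :
    Oc q ∩ Oc r ⊆ Oc p := by
  rintro x ⟨hxq, hxr⟩
  by_contra hx
  obtain ⟨i, -, hi⟩ := hdiff
  obtain ⟨f, u, hf, hu⟩ :=
    geometric_hahn_banach_closed_point (convex_convexHull ℝ _) (isClosed_Oc p) hx
  rcases forall_Vpts_lt_or_of_mem_segment hi hp
    (fun v hv => hf v (subset_convexHull ℝ _ hv)) with h | h
  · exact (lt_of_mem_Oc h hxq).not_gt hu
  · exact (lt_of_mem_Oc h hxr).not_gt hu
end

section
/- Let P = ∏_{i=1}^{6} [a_i, a_i+δ_i] ⊆ [0,1]⁶ with all δ_i > 0, let U_P be the set of 64 vertices of P, let Q_P = ⋂_{v ∈ U_P} O_v, and let R_P = ⋃_{p ∈ P} V_p. Then max{ C(E ∪ V_p, int(O_p)) : p ∈ P } ≤ C(E ∪ R_P, Q_P). -/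
open Set Pointwise

/-- Pairwise distinct indices of the three coordinate axes. -/
def Distinct3 (i j k : Fin 3) : Prop := i ≠ j ∧ i ≠ k ∧ j ≠ k

lemma Distinct3.rotate {i j k : Fin 3} (h : Distinct3 i j k) : Distinct3 j k i :=
  ⟨h.2.2, h.1.symm, h.2.1.symm⟩

lemma Distinct3.swap {i j k : Fin 3} (h : Distinct3 i j k) : Distinct3 i k j :=
  ⟨h.2.1, h.1, h.2.2.symm⟩

lemma Distinct3.eq_or {i j k : Fin 3} (h : Distinct3 i j k) (a : Fin 3) :
    a = i ∨ a = j ∨ a = k := by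
  obtain ⟨h1, h2, h3⟩ := h
  omega

lemma Distinct3.sum_eq {i j k : Fin 3} (h : Distinct3 i j k) (g : Fin 3 → ℝ) :
    ∑ a, g a = g i + g j + g k := by
  obtain ⟨h1, h2, h3⟩ := h
  rw [Fin.sum_univ_three]
  fin_cases i <;> fin_cases j <;> fin_cases k <;> simp_all <;> ring

lemma Distinct3.dot_eq {i j k : Fin 3} (h : Distinct3 i j k) (f x : Fin 3 → ℝ) :
    f ⬝ᵥ x = f i * x i + f j * x j + f k * x k := h.sum_eq _

lemma exists_distinct3_of_ne {i j : Fin 3} (h : i ≠ j) : ∃ k, Distinct3 i j k := by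
  refine ⟨-(i + j), h, ?_, ?_⟩ <;> revert i j <;> decide

lemma exists_distinct3 (i : Fin 3) : ∃ j k, Distinct3 i j k := by
  refine ⟨i + 1, i + 2, ?_, ?_, ?_⟩ <;> revert i <;> decide

/-- The parameters of `Vpts` arranged by pair of opposite faces and coordinate; the diagonal is
irrelevant. -/
def pairCoord (p : Fin 6 → ℝ) : Fin 3 → Fin 3 → ℝ :=
  ![![0, p 0, p 1], ![p 2, 0, p 3], ![p 4, p 5, 0]]

/-- Membership in the six-point configuration with pair coordinates `q`. -/
def FacePoint (q : Fin 3 → Fin 3 → ℝ) (x : Fin 3 → ℝ) : Prop :=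
  ∃ j, (x j = 0 ∨ x j = 1) ∧ ∀ i, i ≠ j → x i = q j i

lemma facePoint_iff (q : Fin 3 → Fin 3 → ℝ) (x : Fin 3 → ℝ) :
    FacePoint q x ↔ ((x 0 = 0 ∨ x 0 = 1) ∧ x 1 = q 0 1 ∧ x 2 = q 0 2) ∨
      ((x 1 = 0 ∨ x 1 = 1) ∧ x 0 = q 1 0 ∧ x 2 = q 1 2) ∨
      ((x 2 = 0 ∨ x 2 = 1) ∧ x 0 = q 2 0 ∧ x 1 = q 2 1) := by
  simp [FacePoint, Fin.exists_fin_succ, Fin.forall_fin_succ]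

lemma mem_Vpts_iff (p : Fin 6 → ℝ) (x : Fin 3 → ℝ) :
    x ∈ Vpts p ↔ FacePoint (pairCoord p) x := by
  rw [facePoint_iff]
  simp only [Vpts, mem_insert_iff, mem_singleton_iff, pairCoord, funext_iff, Fin.forall_fin_succ]
  simp
  tauto

/-- An explicit parametrisation of the convex hull of the six-point configuration:
`μ j` is the total weight of the `j`-th pair and `σ j` the weight of its point with `j`-th
coordinate `1`. -/
def HullRep (q : Fin 3 → Fin 3 → ℝ) (x μ σ : Fin 3 → ℝ) : Prop :=
  (∀ i, 0 ≤ σ i ∧ σ i ≤ μ i) ∧ ∑ i, μ i = 1 ∧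
    ∀ i j k, Distinct3 i j k → x i = σ i + μ j * q j i + μ k * q k i

lemma convex_setOf_hullRep (q : Fin 3 → Fin 3 → ℝ) :
    Convex ℝ {x | ∃ μ σ, HullRep q x μ σ} := by
  rintro x ⟨μ, σ, h1, h2, h3⟩ y ⟨μ', σ', h1', h2', h3'⟩ a b ha hb hab
  refine ⟨a • μ + b • μ', a • σ + b • σ', fun i => ?_, ?_, fun i j k h => ?_⟩
  · have := h1 i
    have := h1' i
    simp only [Pi.add_apply, Pi.smul_apply, smul_eq_mul]
    constructor
    · have := mul_nonneg ha (h1 i).1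
      have := mul_nonneg hb (h1' i).1
      linarith
    · have := mul_le_mul_of_nonneg_left (h1 i).2 ha
      have := mul_le_mul_of_nonneg_left (h1' i).2 hb
      linarith
  · simp [Finset.sum_add_distrib, ← Finset.mul_sum, h2, h2', hab]
  · simp only [Pi.add_apply, Pi.smul_apply, smul_eq_mul, h3 i j k h, h3' i j k h]
    ring

lemma exists_hullRep_of_mem_Oc {p : Fin 6 → ℝ} {x : Fin 3 → ℝ} (hx : x ∈ Oc p) :
    ∃ μ σ, HullRep (pairCoord p) x μ σ := by
  refine convexHull_min (fun y hy => ?_) (convex_setOf_hullRep (pairCoord p)) hx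
  rw [mem_Vpts_iff] at hy
  obtain ⟨j, hj, hy⟩ := hy
  refine ⟨Pi.single j 1, Pi.single j (y j), fun i => ?_, by simp, fun a b c h => ?_⟩
  · by_cases hi : i = j
    · subst hi
      rcases hj with h | h <;> simp [h]
    · simp [hi]
  · rcases h.eq_or j with rfl | rfl | rfl
    · simp [h.1.symm, h.2.1.symm]
    · simp [h.1, h.2.2.symm, hy _ h.1]
    · simp [h.2.1, h.2.2, hy _ h.2.1]

/-- Admissible pair coordinates `q` in the unit square together with an admissible nonzero
displacement `d` of each of them. -/
def Admissible (q d : Fin 3 → Fin 3 → ℝ) : Prop :=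
  ∀ j i, j ≠ i → d j i ≠ 0 ∧ 0 ≤ q j i ∧ q j i ≤ 1 ∧ 0 ≤ q j i + d j i ∧ q j i + d j i ≤ 1

/-- `x` lies in the hull of every six-point configuration obtained from `q` by displacing some of
the coordinates by `d`. -/
def InCore (q d : Fin 3 → Fin 3 → ℝ) (x : Fin 3 → ℝ) : Prop :=
  ∀ r : Fin 3 → Fin 3 → ℝ, (∀ j i, j ≠ i → r j i = q j i ∨ r j i = q j i + d j i) →
    ∃ μ σ, HullRep r x μ σ

/-- `f` is an outer normal at `x` of the hull of the six-point configuration `q`. -/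
def IsNormal (q : Fin 3 → Fin 3 → ℝ) (f x : Fin 3 → ℝ) : Prop :=
  ∀ y, FacePoint q y → f ⬝ᵥ y ≤ f ⬝ᵥ x

/-- The `j`-th pair attains the support value of `f`, and displacing it does not decrease `f`. -/
def Tight (q d : Fin 3 → Fin 3 → ℝ) (f x : Fin 3 → ℝ) (j : Fin 3) : Prop :=
  ∀ i k, Distinct3 j i k →
    0 ≤ f i * d j i ∧ max (f j) 0 + f i * q j i + f k * q j k = f ⬝ᵥ x

lemma InCore.pos_lt_one {q d : Fin 3 → Fin 3 → ℝ} {x : Fin 3 → ℝ} (hqd : Admissible q d)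
    (hx : InCore q d x) (i : Fin 3) : 0 < x i ∧ x i < 1 := by
  obtain ⟨j, k, h⟩ := exists_distinct3 i
  obtain ⟨hij, hik, hjk⟩ := h
  have hji := hqd j i hij.symm
  have hki := hqd k i hik.symm
  have hdij := (hqd i j hij).1
  have key : ∀ (cj ck s : ℝ), (cj = q j i ∨ cj = q j i + d j i) →
      (ck = q k i ∨ ck = q k i + d k i) → (s = q i j ∨ s = q i j + d i j) →
      ∃ μ σ : Fin 3 → ℝ, (∀ i, 0 ≤ σ i ∧ σ i ≤ μ i) ∧ μ i + μ j + μ k = 1 ∧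
        x i = σ i + μ j * cj + μ k * ck ∧ (μ j = 0 → μ k = 0 → x j = s) := by
    intro cj ck s hcj hck hs
    obtain ⟨μ, σ, h1, h2, h3⟩ := hx (fun a b => if a = j ∧ b = i then cj else
      if a = k ∧ b = i then ck else if a = i ∧ b = j then s else q a b) (fun a b hab => by
        split_ifs with h1 h2 h3
        · rw [h1.1, h1.2]; exact hcj
        · rw [h2.1, h2.2]; exact hck
        · rw [h3.1, h3.2]; exact hs
        · exact Or.inl rfl)
    rw [Distinct3.sum_eq ⟨hij, hik, hjk⟩] at h2
    refine ⟨μ, σ, h1, h2, ?_, fun hj hk => ?_⟩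
    · rw [h3 i j k ⟨hij, hik, hjk⟩]
      simp [hjk.symm]
    · have h4 := h3 j i k ⟨hij.symm, hjk, hik⟩
      have h5 := h1 j
      have h6 : σ j = 0 := by linarith
      have h7 : μ i = 1 := by linarith
      rw [h4, h6, h7, hk]
      simp [hij, hik]
  constructor
  · obtain ⟨cj, hcj, hcj0⟩ : ∃ c, (c = q j i ∨ c = q j i + d j i) ∧ 0 < c := by
      rcases lt_or_gt_of_ne hji.1 with h | h
      · exact ⟨_, Or.inl rfl, by linarith⟩
      · exact ⟨_, Or.inr rfl, by linarith⟩
    obtain ⟨ck, hck, hck0⟩ : ∃ c, (c = q k i ∨ c = q k i + d k i) ∧ 0 < c := by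
      rcases lt_or_gt_of_ne hki.1 with h | h
      · exact ⟨_, Or.inl rfl, by linarith⟩
      · exact ⟨_, Or.inr rfl, by linarith⟩
    have main : ∀ s, (s = q i j ∨ s = q i j + d i j) → 0 ≤ x i ∧ (x i = 0 → x j = s) := by
      intro s hs
      obtain ⟨μ, σ, h1, h2, h3, h4⟩ := key cj ck s hcj hck hs
      have hj := mul_nonneg ((h1 j).1.trans (h1 j).2) hcj0.le
      have hk := mul_nonneg ((h1 k).1.trans (h1 k).2) hck0.le
      have hi := (h1 i).1
      refine ⟨by linarith, fun h0 => h4 ?_ ?_⟩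
      · have : μ j * cj = 0 := by linarith
        exact (mul_eq_zero.1 this).resolve_right hcj0.ne'
      · have : μ k * ck = 0 := by linarith
        exact (mul_eq_zero.1 this).resolve_right hck0.ne'
    refine lt_of_le_of_ne (main _ (Or.inl rfl)).1 fun h => hdij ?_
    have h1 := (main _ (Or.inl rfl)).2 h.symm
    have h2 := (main _ (Or.inr rfl)).2 h.symm
    linarith
  · obtain ⟨cj, hcj, hcj0⟩ : ∃ c, (c = q j i ∨ c = q j i + d j i) ∧ 0 < 1 - c := by
      rcases lt_or_gt_of_ne hji.1 with h | h
      · exact ⟨_, Or.inr rfl, by linarith⟩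
      · exact ⟨_, Or.inl rfl, by linarith⟩
    obtain ⟨ck, hck, hck0⟩ : ∃ c, (c = q k i ∨ c = q k i + d k i) ∧ 0 < 1 - c := by
      rcases lt_or_gt_of_ne hki.1 with h | h
      · exact ⟨_, Or.inr rfl, by linarith⟩
      · exact ⟨_, Or.inl rfl, by linarith⟩
    have main : ∀ s, (s = q i j ∨ s = q i j + d i j) → x i ≤ 1 ∧ (x i = 1 → x j = s) := by
      intro s hs
      obtain ⟨μ, σ, h1, h2, h3, h4⟩ := key cj ck s hcj hck hs
      have hj := mul_nonneg ((h1 j).1.trans (h1 j).2) hcj0.le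
      have hk := mul_nonneg ((h1 k).1.trans (h1 k).2) hck0.le
      have hi := (h1 i).2
      refine ⟨by linarith, fun h0 => h4 ?_ ?_⟩
      · have : μ j * (1 - cj) = 0 := by linarith
        exact (mul_eq_zero.1 this).resolve_right hcj0.ne'
      · have : μ k * (1 - ck) = 0 := by linarith
        exact (mul_eq_zero.1 this).resolve_right hck0.ne'
    refine lt_of_le_of_ne (main _ (Or.inl rfl)).1 fun h => hdij ?_
    have h1 := (main _ (Or.inl rfl)).2 h
    have h2 := (main _ (Or.inr rfl)).2 h
    linarith

lemma IsNormal.pair_le {q : Fin 3 → Fin 3 → ℝ} {f x : Fin 3 → ℝ} (hf : IsNormal q f x)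
    {j i k : Fin 3} (h : Distinct3 j i k) :
    max (f j) 0 + f i * q j i + f k * q j k ≤ f ⬝ᵥ x := by
  have key : ∀ s : ℝ, (s = 0 ∨ s = 1) → f j * s + f i * q j i + f k * q j k ≤ f ⬝ᵥ x := by
    intro s hs
    have := hf (fun a => if a = j then s else q j a) ⟨j, by simpa using hs, fun a ha => by simp [ha]⟩
    rw [h.dot_eq] at this
    simpa [h.1.symm, h.2.1.symm] using this
  have h0 := key 0 (Or.inl rfl)
  have h1 := key 1 (Or.inr rfl)
  rcases max_cases (f j) 0 with ⟨h, -⟩ | ⟨h, -⟩ <;> rw [h] <;> linarith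

/-- A hull representation whose active pairs are all tight. -/
lemma IsNormal.exists_tight_rep {q d : Fin 3 → Fin 3 → ℝ} {f x : Fin 3 → ℝ}
    (hx : InCore q d x) (hf : IsNormal q f x) (c : Fin 3 → Fin 3 → ℝ)
    (hc : ∀ j i, j ≠ i → c j i = q j i ∨ c j i = q j i + d j i) :
    ∃ μ σ : Fin 3 → ℝ, (∀ i, 0 ≤ σ i ∧ σ i ≤ μ i) ∧ ∑ i, μ i = 1 ∧
      (∀ i, f i * σ i = μ i * max (f i) 0) ∧ (∀ j, 0 < μ j → Tight q d f x j) ∧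
      (∀ i j k, Distinct3 i j k →
        (f i ≠ 0 → x i = σ i + μ j * q j i + μ k * q k i) ∧
        (f i = 0 → x i = σ i + μ j * c j i + μ k * c k i)) := by
  set r : Fin 3 → Fin 3 → ℝ := fun j i =>
    if 0 < f i * d j i then q j i else if f i * d j i < 0 then q j i + d j i else c j i with hr
  have hrle : ∀ j i, j ≠ i → f i * r j i ≤ f i * q j i ∧
      (f i * r j i = f i * q j i → 0 ≤ f i * d j i) := by
    intro j i hji
    simp only [hr]
    split_ifs with h1 h2
    · exact ⟨le_rfl, fun _ => h1.le⟩
    · refine ⟨by rw [mul_add]; linarith, fun h => ?_⟩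
      rw [mul_add] at h
      linarith
    · have h0 : f i * d j i = 0 := le_antisymm (not_lt.1 h1) (not_lt.1 h2)
      refine ⟨?_, fun _ => h0.ge⟩
      rcases hc j i hji with h | h <;> rw [h]
      rw [mul_add, h0, add_zero]
  have hreq : ∀ j i, f i = 0 → r j i = c j i := by
    intro j i h
    simp [hr, h]
  obtain ⟨μ, σ, h1, h2, h3⟩ := hx r (fun j i hji => by
    simp only [hr]
    split_ifs
    · exact Or.inl rfl
    · exact Or.inr rfl
    · exact hc j i hji)
  have hμ : ∀ i, 0 ≤ μ i := fun i => (h1 i).1.trans (h1 i).2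
  have hmax : ∀ i, 0 ≤ μ i * max (f i) 0 - f i * σ i := by
    intro i
    have := h1 i
    rcases max_cases (f i) 0 with ⟨h, h'⟩ | ⟨h, h'⟩ <;> rw [h] <;> nlinarith
  have hslack : ∀ j i k, Distinct3 j i k →
      0 ≤ μ j * (f ⬝ᵥ x - (max (f j) 0 + f i * q j i + f k * q j k)) ∧
      0 ≤ μ j * (f i * q j i - f i * r j i) ∧ 0 ≤ μ j * (f k * q j k - f k * r j k) := by
    intro j i k h
    refine ⟨mul_nonneg (hμ j) (by linarith [hf.pair_le h]), mul_nonneg (hμ j) ?_,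
      mul_nonneg (hμ j) ?_⟩
    · linarith [(hrle j i h.1).1]
    · linarith [(hrle j k h.2.1).1]
  have hzero : ∀ j i k, Distinct3 j i k → μ j * max (f j) 0 - f j * σ j = 0 ∧
      μ j * (f ⬝ᵥ x - (max (f j) 0 + f i * q j i + f k * q j k)) = 0 ∧
      μ j * (f i * q j i - f i * r j i) = 0 := by
    intro j i k h
    have e : f ⬝ᵥ x = f j * (σ j + μ i * r i j + μ k * r k j) +
        f i * (σ i + μ k * r k i + μ j * r j i) + f k * (σ k + μ j * r j k + μ i * r i k) := by
      rw [h.dot_eq, ← h3 j i k h, ← h3 i k j h.rotate, ← h3 k j i h.rotate.rotate]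
    have hs : μ j + μ i + μ k = 1 := by rw [← h.sum_eq, h2]
    have s1 := hslack j i k h
    have s2 := hslack i k j h.rotate
    have s3 := hslack k j i h.rotate.rotate
    have m1 := hmax j
    have m2 := hmax i
    have m3 := hmax k
    have tot : (f ⬝ᵥ x) * (μ j + μ i + μ k) = f ⬝ᵥ x := by rw [hs, mul_one]
    refine ⟨?_, ?_, ?_⟩ <;> nlinarith
  refine ⟨μ, σ, h1, h2, fun i => ?_, fun j hj i k h => ?_, fun i j k h => ⟨fun hi => ?_, fun hi => ?_⟩⟩
  · obtain ⟨j, k, h⟩ := exists_distinct3 i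
    linarith [(hzero i j k h).1]
  · obtain ⟨-, z2, z3⟩ := hzero j i k h
    have z2 := (mul_eq_zero.1 z2).resolve_left hj.ne'
    have z3 := (mul_eq_zero.1 z3).resolve_left hj.ne'
    exact ⟨(hrle j i h.1).2 (by linarith), by linarith⟩
  · have e : ∀ j i k, Distinct3 j i k → f i ≠ 0 → μ j * r j i = μ j * q j i := by
      intro j i k h hi
      have := (hzero j i k h).2.2
      rw [← mul_sub, mul_left_comm] at this
      have := (mul_eq_zero.1 this).resolve_left hi
      linarith
    rw [h3 i j k h, e j i k ⟨h.1.symm, h.2.2, h.2.1⟩ hi, e k i j h.rotate.rotate hi]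
  · rw [h3 i j k h, hreq _ _ hi, hreq _ _ hi]

/-- The two pairs meeting at `x` prescribe opposite displacements there: `x` is a contact point
with a normal orthogonal to the axis `j`. -/
def BadNormal (q d : Fin 3 → Fin 3 → ℝ) (j : Fin 3) (f x : Fin 3 → ℝ) : Prop :=
  f j = 0 ∧ ∀ i k, Distinct3 j i k → 0 < f i * d j i ∧ x i = q j i ∧ d j i * d k i < 0

section Normal

variable {q d : Fin 3 → Fin 3 → ℝ} {f x : Fin 3 → ℝ}

lemma IsNormal.of_not_tight (hqd : Admissible q d) (hx : InCore q d x) (hf : IsNormal q f x)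
    {j i k : Fin 3} (h : Distinct3 j i k) (hi : ¬ Tight q d f x i) (hk : ¬ Tight q d f x k) :
    f j = 0 ∧ f i ≠ 0 ∧ 0 < f i * d j i ∧ x i = q j i := by
  have hzero : ∀ {μ σ : Fin 3 → ℝ}, (∀ i, 0 ≤ σ i ∧ σ i ≤ μ i) → ∑ i, μ i = 1 →
      (∀ j, 0 < μ j → Tight q d f x j) → μ i = 0 ∧ μ k = 0 ∧ μ j = 1 ∧ σ i = 0 := by
    intro μ σ h1 h2 h4
    have hi0 : μ i = 0 := le_antisymm (not_lt.1 fun h => hi (h4 i h)) ((h1 i).1.trans (h1 i).2)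
    have hk0 : μ k = 0 := le_antisymm (not_lt.1 fun h => hk (h4 k h)) ((h1 k).1.trans (h1 k).2)
    rw [h.sum_eq] at h2
    exact ⟨hi0, hk0, by linarith, by linarith [h1 i]⟩
  obtain ⟨μ, σ, h1, h2, h3, h4, h5⟩ := hf.exists_tight_rep hx q fun _ _ _ => Or.inl rfl
  obtain ⟨μ', σ', h1', h2', h3', h4', h5'⟩ :=
    hf.exists_tight_rep hx (fun a b => q a b + d a b) fun _ _ _ => Or.inr rfl
  obtain ⟨z1, z2, z3, z4⟩ := hzero h1 h2 h4
  obtain ⟨z1', z2', z3', z4'⟩ := hzero h1' h2' h4'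
  have hij : Distinct3 i j k := ⟨h.1.symm, h.2.2, h.2.1⟩
  have hfi : f i ≠ 0 := by
    intro h0
    have e := (h5 i j k hij).2 h0
    have e' := (h5' i j k hij).2 h0
    simp only [z2, z3, z4, z2', z3', z4'] at e e'
    apply (hqd j i h.1).1
    linarith
  have hxi := (h5 i j k hij).1 hfi
  simp only [z2, z3, z4] at hxi
  have hfj : f j = 0 := by
    by_contra h0
    have hxj := (h5 j i k h).1 h0
    have hσ := h3 j
    simp only [z1, z2, z3] at hxj hσ
    have hb := hx.pos_lt_one hqd j
    have : f j * x j = max (f j) 0 := by rw [hxj]; linarith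
    rcases max_cases (f j) 0 with ⟨e, -⟩ | ⟨e, -⟩ <;> rw [e] at this
    · have := mul_left_cancel₀ h0 (this.trans (mul_one _).symm)
      linarith
    · have := (mul_eq_zero.1 this).resolve_left h0
      linarith
  have ht := (h4 j (by rw [z3]; exact one_pos) i k h).1
  refine ⟨hfj, hfi, lt_of_le_of_ne ht (mul_ne_zero hfi (hqd j i h.1).1).symm, by linarith⟩

lemma IsNormal.ne_zero_of_not_tight (hqd : Admissible q d) (hx : InCore q d x)
    (hf : IsNormal q f x) (hf0 : f ≠ 0) {i : Fin 3} (hi : ¬ Tight q d f x i) : f i ≠ 0 := by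
  intro h0
  set lo : Fin 3 → Fin 3 → ℝ := fun a b => min (q a b) (q a b + d a b) with hlo
  set hi' : Fin 3 → Fin 3 → ℝ := fun a b => max (q a b) (q a b + d a b) with hhi
  have hlt : ∀ a b, a ≠ b → lo a b < hi' a b := by
    intro a b hab
    rw [hlo, hhi]
    refine min_lt_max.2 fun h => (hqd a b hab).1 (by linarith)
  obtain ⟨μ, σ, h1, h2, h3, h4, h5⟩ := hf.exists_tight_rep hx lo fun _ _ _ => min_choice _ _
  obtain ⟨μ', σ', h1', h2', h3', h4', h5'⟩ := hf.exists_tight_rep hx hi' fun _ _ _ => max_choice _ _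
  have hzero : ∀ {μ σ : Fin 3 → ℝ}, (∀ i, 0 ≤ σ i ∧ σ i ≤ μ i) →
      (∀ j, 0 < μ j → Tight q d f x j) → μ i = 0 ∧ σ i = 0 := by
    intro μ σ h1 h4
    have hi0 : μ i = 0 := le_antisymm (not_lt.1 fun h => hi (h4 i h)) ((h1 i).1.trans (h1 i).2)
    exact ⟨hi0, by linarith [h1 i]⟩
  obtain ⟨z1, z2⟩ := hzero h1 h4
  obtain ⟨z1', z2'⟩ := hzero h1' h4'
  obtain ⟨j, k, h, hj0⟩ : ∃ j k, Distinct3 i j k ∧ f j ≠ 0 := by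
    obtain ⟨j, k, h⟩ := exists_distinct3 i
    by_cases hj : f j = 0
    · refine ⟨k, j, h.swap, fun hk => hf0 ?_⟩
      ext a
      rcases h.eq_or a with rfl | rfl | rfl <;> assumption
    · exact ⟨j, k, h, hj⟩
  have hji : Distinct3 j i k := ⟨h.1.symm, h.2.2, h.2.1⟩
  by_cases hk : Tight q d f x k
  · have hkj := (hk j i h.rotate.rotate.swap).1
    have hd := hqd k j h.2.2.symm
    have hsum : μ i + μ j + μ k = 1 := by rw [← h.sum_eq, h2]
    have hsum' : μ' i + μ' j + μ' k = 1 := by rw [← h.sum_eq, h2']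
    have hμ : μ j = μ' j := by
      have e := (h5 j i k hji).1 hj0
      have e' := (h5' j i k hji).1 hj0
      have s := h3 j
      have s' := h3' j
      have hkv : μ k = 1 - μ j := by linarith
      have hkv' : μ' k = 1 - μ' j := by linarith
      rw [z1, hkv] at e
      rw [z1', hkv'] at e'
      rcases lt_or_gt_of_ne hj0 with hneg | hpos
      · rw [max_eq_right hneg.le, mul_zero] at s s'
        have s := (mul_eq_zero.1 s).resolve_left hj0
        have s' := (mul_eq_zero.1 s').resolve_left hj0
        have hdn : d k j < 0 := lt_of_le_of_ne (by nlinarith) hd.1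
        have : 0 < q k j := by linarith
        refine mul_right_cancel₀ this.ne' ?_
        linarith
      · rw [max_eq_left hpos.le, mul_comm] at s s'
        have s := mul_right_cancel₀ hj0 s
        have s' := mul_right_cancel₀ hj0 s'
        have hdn : 0 < d k j := lt_of_le_of_ne (by nlinarith) hd.1.symm
        have : 0 < 1 - q k j := by linarith
        refine mul_right_cancel₀ this.ne' ?_
        linarith
    have hμk : μ k = μ' k := by linarith
    have e := (h5 i j k h).2 h0
    have e' := (h5' i j k h).2 h0
    rw [z2] at e
    rw [z2', ← hμ, ← hμk] at e'
    have l1 := hlt j i h.1.symm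
    have l2 := hlt k i h.2.1.symm
    have p1 : 0 ≤ μ j := (h1 j).1.trans (h1 j).2
    have p2 : 0 ≤ μ k := (h1 k).1.trans (h1 k).2
    rcases p1.eq_or_lt with p | p
    · have : μ k = 1 := by linarith
      rw [← p, this] at e e'
      linarith
    · nlinarith [mul_pos p (sub_pos.2 l1), mul_nonneg p2 (sub_pos.2 l2).le]
  · exact (hf.of_not_tight hqd hx hji hi hk).2.1 h0

lemma IsNormal.badNormal_or (hqd : Admissible q d) (hx : InCore q d x) (hf : IsNormal q f x)
    (hf0 : f ≠ 0) (u : Fin 3 → ℝ)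
    (hu : ∀ i j k, Distinct3 i j k → u i = SignType.sign (d j i) + SignType.sign (d k i)) :
    0 ≤ f ⬝ᵥ u ∧ (f ⬝ᵥ u = 0 → ∃ j, BadNormal q d j f x) := by
  have hge : ∀ j i, -|f i| ≤ f i * SignType.sign (d j i) := by
    intro j i
    rcases lt_trichotomy (d j i) 0 with h | h | h
    · simpa [sign_neg h] using le_abs_self (f i)
    · simp [h]
    · simpa [sign_pos h] using neg_abs_le (f i)
  have heq : ∀ j i, j ≠ i → 0 ≤ f i * d j i → f i * SignType.sign (d j i) = |f i| := by
    intro j i hji h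
    rcases lt_or_gt_of_ne (hqd j i hji).1 with h' | h'
    · have : f i ≤ 0 := by nlinarith
      simp [sign_neg h', abs_of_nonpos this]
    · have : 0 ≤ f i := by nlinarith
      simp [sign_pos h', abs_of_nonneg this]
  have hT : ∀ j i k, Distinct3 j i k → Tight q d f x j →
      f i * SignType.sign (d j i) = |f i| ∧ f k * SignType.sign (d j k) = |f k| := by
    intro j i k h ht
    exact ⟨heq j i h.1 (ht i k h).1, heq j k h.2.1 (ht k i h.swap).1⟩
  have hN : ∀ i, ¬ Tight q d f x i → 0 < |f i| := fun i hi =>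
    abs_pos.2 (hf.ne_zero_of_not_tight hqd hx hf0 hi)
  have hdot : ∀ i j k, Distinct3 i j k → f ⬝ᵥ u =
      f i * SignType.sign (d j i) + f i * SignType.sign (d k i) +
      (f j * SignType.sign (d i j) + f j * SignType.sign (d k j)) +
      (f k * SignType.sign (d i k) + f k * SignType.sign (d j k)) := by
    intro i j k h
    rw [h.dot_eq, hu i j k h, hu j i k ⟨h.1.symm, h.2.2, h.2.1⟩, hu k i j h.rotate.rotate]
    ring
  have two : ∀ i j k, Distinct3 i j k → ¬ Tight q d f x i → Tight q d f x j → Tight q d f x k →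
      0 < f ⬝ᵥ u := by
    intro i j k h hi hj hk
    obtain ⟨a1, a2⟩ := hT j i k ⟨h.1.symm, h.2.2, h.2.1⟩ hj
    obtain ⟨b1, b2⟩ := hT k i j h.rotate.rotate hk
    rw [hdot i j k h]
    linarith [hN i hi, hge i j, hge i k]
  have one : ∀ i j k, Distinct3 i j k → ¬ Tight q d f x i → ¬ Tight q d f x k →
      0 ≤ f ⬝ᵥ u ∧ (f ⬝ᵥ u = 0 → BadNormal q d j f x) := by
    intro i j k h hi hk
    have hji : Distinct3 j i k := ⟨h.1.symm, h.2.2, h.2.1⟩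
    obtain ⟨hj0, hi0, hi1, hi2⟩ := hf.of_not_tight hqd hx hji hi hk
    obtain ⟨-, hk0, hk1, hk2⟩ := hf.of_not_tight hqd hx hji.swap hk hi
    have e1 := heq j i hji.1 hi1.le
    have e2 := heq j k hji.2.1 hk1.le
    have e := hdot i j k h
    rw [hj0, e1, e2] at e
    refine ⟨by linarith [hge k i, hge i k], fun h0 => ?_⟩
    have opp : ∀ i k : Fin 3, f i ≠ 0 → j ≠ i → k ≠ i → 0 < f i * d j i →
        f i * SignType.sign (d k i) ≤ -|f i| → d j i * d k i < 0 := by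
      intro i k hi hji hki h1 h2
      have hlt : f i * d k i < 0 := by
        by_contra hc
        rw [heq k i hki (not_lt.1 hc)] at h2
        have := abs_pos.2 hi
        linarith
      have : (f i * f i) * (d j i * d k i) < 0 := by
        have := mul_neg_of_pos_of_neg h1 hlt
        linarith
      exact (pos_iff_neg_of_mul_neg this).1 (mul_self_pos.2 hi)
    have oi := opp i k hi0 h.1.symm h.2.1.symm hi1 (by linarith [hge k i, hge i k])
    have ok := opp k i hk0 h.2.2 h.2.1 hk1 (by linarith [hge k i, hge i k])
    refine ⟨hj0, fun a b hab => ?_⟩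
    have hb : ∀ c, c ≠ j → c = i ∨ c = k := fun c hc => by
      rcases h.eq_or c with h | h | h
      exacts [Or.inl h, absurd h hc, Or.inr h]
    rcases hb a hab.1.symm with rfl | rfl <;> rcases hb b hab.2.1.symm with rfl | rfl
    · exact absurd rfl hab.2.2
    · exact ⟨hi1, hi2, oi⟩
    · exact ⟨hk1, hk2, ok⟩
    · exact absurd rfl hab.2.2
  by_cases h0 : Tight q d f x 0 <;> by_cases h1 : Tight q d f x 1 <;>
    by_cases h2 : Tight q d f x 2
  · have d012 : Distinct3 0 1 2 := by simp [Distinct3]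
    have a := hT 0 1 2 d012 h0
    have b := hT 1 2 0 d012.rotate h1
    have c := hT 2 0 1 d012.rotate.rotate h2
    have pos : 0 < |f 0| + |f 1| + |f 2| := by
      by_contra hc
      apply hf0
      have := abs_nonneg (f 0)
      have := abs_nonneg (f 1)
      have := abs_nonneg (f 2)
      ext i
      refine abs_eq_zero.1 ?_
      fin_cases i <;> simp only [Fin.zero_eta, Fin.mk_one, Fin.reduceFinMk] <;>
        linarith
    have : 0 < f ⬝ᵥ u := by
      rw [hdot 0 1 2 d012]
      linarith
    exact ⟨this.le, fun h => absurd h this.ne'⟩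
  · have := two 2 0 1 (by simp [Distinct3]) h2 h0 h1
    exact ⟨this.le, fun h => absurd h this.ne'⟩
  · have := two 1 0 2 (by simp [Distinct3]) h1 h0 h2
    exact ⟨this.le, fun h => absurd h this.ne'⟩
  · obtain ⟨a, b⟩ := one 1 0 2 (by simp [Distinct3]) h1 h2
    exact ⟨a, fun h => ⟨_, b h⟩⟩
  · have := two 0 1 2 (by simp [Distinct3]) h0 h1 h2
    exact ⟨this.le, fun h => absurd h this.ne'⟩
  · obtain ⟨a, b⟩ := one 0 1 2 (by simp [Distinct3]) h0 h2
    exact ⟨a, fun h => ⟨_, b h⟩⟩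
  · obtain ⟨a, b⟩ := one 0 2 1 (by simp [Distinct3]) h0 h1
    exact ⟨a, fun h => ⟨_, b h⟩⟩
  · obtain ⟨a, b⟩ := one 0 1 2 (by simp [Distinct3]) h0 h2
    exact ⟨a, fun h => ⟨_, b h⟩⟩

end Normal

lemma IsCompact.exists_pos_forall_add_mul_pos {X : Type*} [TopologicalSpace X] {K : Set X}
    (hK : IsCompact K) {g h : X → ℝ} (hg : ContinuousOn g K) (hh : ContinuousOn h K)
    (hg0 : ∀ x ∈ K, 0 ≤ g x) (hgh : ∀ x ∈ K, g x = 0 → 0 < h x) :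
    ∃ ε > 0, ∀ x ∈ K, 0 < g x + ε * h x := by
  rcases K.eq_empty_or_nonempty with rfl | hne
  · exact ⟨1, one_pos, by simp⟩
  obtain ⟨B, hB⟩ := hK.exists_bound_of_continuousOn hh
  have hBx : ∀ x ∈ K, |h x| ≤ B := hB
  obtain ⟨x₀, hx₀, hmin⟩ := hK.exists_isMinOn hne (hg.sup hh)
  have hmin : ∀ x ∈ K, max (g x₀) (h x₀) ≤ max (g x) (h x) := fun x hx => hmin hx
  set m := max (g x₀) (h x₀) with hm
  have hm0 : 0 < m := by
    rcases (hg0 x₀ hx₀).eq_or_lt with h | h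
    · exact lt_max_of_lt_right (hgh x₀ hx₀ h.symm)
    · exact lt_max_of_lt_left h
  have hB0 : 0 ≤ B := (abs_nonneg _).trans (hBx x₀ hx₀)
  refine ⟨m / (B + 1), by positivity, fun x hx => ?_⟩
  have hε : 0 < m / (B + 1) := by positivity
  by_cases hhx : 0 < h x
  · have := mul_pos hε hhx
    linarith [hg0 x hx]
  · have h1 : m ≤ g x := by
      rcases le_max_iff.1 (hmin x hx) with h | h
      · exact h
      · linarith
    have h2 : -B ≤ h x := (neg_le_neg (hBx x hx)).trans (neg_abs_le _)
    have h3 : m / (B + 1) * (B + 1) = m := by field_simp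
    nlinarith

lemma finite_Vpts (p : Fin 6 → ℝ) : (Vpts p).Finite := by
  simp [Vpts]

lemma single_mem_vectorSpan_Vpts (p : Fin 6 → ℝ) (i : Fin 3) :
    (Pi.single i 1 : Fin 3 → ℝ) ∈ vectorSpan ℝ (Vpts p) := by
  have key : ∀ s, (s = 0 ∨ s = 1) →
      (fun a => if a = i then s else pairCoord p i a) ∈ Vpts p := by
    intro s hs
    rw [mem_Vpts_iff]
    exact ⟨i, by simpa using hs, fun a ha => by simp [ha]⟩
  have := vsub_mem_vectorSpan ℝ (key 1 (Or.inr rfl)) (key 0 (Or.inl rfl))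
  convert this using 1
  ext a
  by_cases h : a = i
  · subst h
    simp
  · simp [h]

lemma nonempty_interior_Oc (p : Fin 6 → ℝ) : (interior (Oc p)).Nonempty := by
  have hne : (Vpts p).Nonempty := ⟨_, Or.inl rfl⟩
  rw [Oc, interior_convexHull_nonempty_iff_affineSpan_eq_top,
    AffineSubspace.affineSpan_eq_top_iff_vectorSpan_eq_top_of_nonempty ℝ _ _ hne,
    Submodule.eq_top_iff']
  intro x
  rw [pi_eq_sum_univ' x]
  refine Submodule.sum_mem _ fun i _ => Submodule.smul_mem _ _ ?_
  convert single_mem_vectorSpan_Vpts p i using 1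

lemma exists_dotProduct_eq (φ : StrongDual ℝ (Fin 3 → ℝ)) :
    ∃ f : Fin 3 → ℝ, ∀ x, φ x = f ⬝ᵥ x := by
  refine ⟨fun i => φ (Pi.single i 1), fun x => ?_⟩
  conv_lhs => rw [← Finset.univ_sum_single x]
  rw [map_sum]
  refine Finset.sum_congr rfl fun i _ => ?_
  rw [mul_comm, ← smul_eq_mul, ← map_smul, ← Pi.single_smul, smul_eq_mul, mul_one]

/-- A point outside the interior of `Oc p` is separated from it by a normalised functional. -/
lemma exists_dotProduct_le_of_notMem_interior {p : Fin 6 → ℝ} {x : Fin 3 → ℝ}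
    (hx : x ∉ interior (Oc p)) :
    ∃ f ∈ Metric.sphere (0 : Fin 3 → ℝ) 1, ∀ y ∈ Oc p, f ⬝ᵥ y ≤ f ⬝ᵥ x := by
  have hconv : Convex ℝ (Oc p) := convex_convexHull ℝ _
  obtain ⟨φ, hφ⟩ := geometric_hahn_banach_open_point hconv.interior isOpen_interior hx
  have hcl : ∀ y ∈ Oc p, φ y ≤ φ x := by
    intro y hy
    have h1 := subset_closure hy
    rw [← hconv.closure_interior_eq_closure_of_nonempty_interior (nonempty_interior_Oc p)] at h1
    have h2 : closure (interior (Oc p)) ⊆ {y | φ y ≤ φ x} :=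
      closure_minimal (fun a ha => (hφ a ha).le) (isClosed_le φ.continuous continuous_const)
    exact h2 h1
  obtain ⟨f, hf⟩ := exists_dotProduct_eq φ
  obtain ⟨y₀, hy₀⟩ := nonempty_interior_Oc p
  have hf0 : f ≠ 0 := by
    rintro rfl
    have := hφ y₀ hy₀
    simp [hf] at this
  have hn : 0 < ‖f‖ := norm_pos_iff.2 hf0
  refine ⟨‖f‖⁻¹ • f, by simp [norm_smul, hn.ne'], fun y hy => ?_⟩
  rw [smul_dotProduct, smul_dotProduct]
  have := hcl y hy
  rw [hf, hf] at this
  exact mul_le_mul_of_nonneg_left this (inv_nonneg.2 hn.le)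

lemma dotProduct_le_of_mem_Oc {p : Fin 6 → ℝ} {f x : Fin 3 → ℝ} {M : ℝ} (hx : x ∈ Oc p)
    (h : ∀ y ∈ Vpts p, f ⬝ᵥ y ≤ M) : f ⬝ᵥ x ≤ M := by
  have hc : Convex ℝ {y | f ⬝ᵥ y ≤ M} := by
    intro y hy z hz a b ha hb hab
    simp only [mem_ofPred_eq, dotProduct_add, dotProduct_smul, smul_eq_mul] at *
    calc a * (f ⬝ᵥ y) + b * (f ⬝ᵥ z) ≤ a * M + b * M := by gcongr
      _ = M := by rw [← add_mul, hab, one_mul]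
  exact convexHull_min h hc hx

/-- If `u` has positive product with every normal at the points of a compact set, a small
translation in direction `-u` moves this set into the interior. -/
lemma exists_sub_mem_interior_Oc {p : Fin 6 → ℝ} {C : Set (Fin 3 → ℝ)} (hC : IsCompact C)
    (hCO : C ⊆ Oc p) (u : Fin 3 → ℝ)
    (hu : ∀ x ∈ C, ∀ f ≠ 0, IsNormal (pairCoord p) f x → 0 < f ⬝ᵥ u) :
    ∃ ε : ℝ, ∀ x ∈ C, x - ε • u ∈ interior (Oc p) := by
  set s := (finite_Vpts p).toFinset with hs
  have hs' : ∀ y, y ∈ s ↔ y ∈ Vpts p := by simp [hs]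
  have hK : IsCompact (C ×ˢ Metric.sphere (0 : Fin 3 → ℝ) 1) := hC.prod (isCompact_sphere _ _)
  obtain ⟨ε, hε, h⟩ := hK.exists_pos_forall_add_mul_pos
    (g := fun z => ∑ y ∈ s, max 0 (z.2 ⬝ᵥ y - z.2 ⬝ᵥ z.1)) (h := fun z => z.2 ⬝ᵥ u)
    (by fun_prop) (by fun_prop)
    (fun z _ => Finset.sum_nonneg fun y _ => le_max_left _ _) (by
      rintro ⟨x, f⟩ ⟨hx, hf⟩ h0
      refine hu x hx f (ne_zero_of_mem_unit_sphere ⟨f, hf⟩) fun y hy => ?_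
      rw [← mem_Vpts_iff, ← hs'] at hy
      have := (Finset.sum_eq_zero_iff_of_nonneg fun y _ => le_max_left _ _).1 h0 y hy
      have := this ▸ le_max_right 0 (f ⬝ᵥ y - f ⬝ᵥ x)
      linarith)
  refine ⟨ε / (s.card + 1), fun x hx => ?_⟩
  by_contra hcon
  obtain ⟨f, hf, hle⟩ := exists_dotProduct_le_of_notMem_interior hcon
  have hpos := h (x, f) ⟨hx, hf⟩
  have hδ : 0 < ε / (s.card + 1) := by positivity
  have hxx := hle x (hCO hx)
  rw [dotProduct_sub, dotProduct_smul, smul_eq_mul] at hxx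
  have hsum : ∑ y ∈ s, max 0 (f ⬝ᵥ y - f ⬝ᵥ x) ≤ ∑ y ∈ s, -(ε / (s.card + 1) * (f ⬝ᵥ u)) := by
    refine Finset.sum_le_sum fun y hy => max_le (by linarith) ?_
    have := hle y (subset_convexHull ℝ _ ((hs' y).1 hy))
    rw [dotProduct_sub, dotProduct_smul, smul_eq_mul] at this
    linarith
  rw [Finset.sum_const, nsmul_eq_mul] at hsum
  have e : ε * (f ⬝ᵥ u) = (s.card + 1) * (ε / (s.card + 1) * (f ⬝ᵥ u)) := by
    field_simp
  simp only [e] at hpos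
  linarith

/-- The point `x` of the hull has a normal of the kind described by `BadNormal`. -/
def Contact (q d : Fin 3 → Fin 3 → ℝ) (j : Fin 3) (x : Fin 3 → ℝ) : Prop :=
  ∃ f, IsNormal q f x ∧ BadNormal q d j f x

lemma isClosed_setOf_isNormal (q : Fin 3 → Fin 3 → ℝ) :
    IsClosed {z : (Fin 3 → ℝ) × (Fin 3 → ℝ) | IsNormal q z.2 z.1} := by
  simp only [IsNormal, ofPred_forall]
  refine isClosed_iInter fun y => isClosed_iInter fun _ => isClosed_le ?_ ?_ <;> fun_prop

/-- A compact part of the core that misses one of the three kinds of contact points can be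
translated into the interior of the hull. -/
lemma exists_sub_mem_interior_of_not_contact {p : Fin 6 → ℝ} {d : Fin 3 → Fin 3 → ℝ}
    (hqd : Admissible (pairCoord p) d) {C : Set (Fin 3 → ℝ)} (hC : IsCompact C)
    (hCO : C ⊆ Oc p) (hcore : ∀ x ∈ C, InCore (pairCoord p) d x) (a : Fin 3)
    (ha : ∀ x ∈ C, ¬ Contact (pairCoord p) d a x) :
    ∃ w, ∀ x ∈ C, x - w ∈ interior (Oc p) := by
  obtain ⟨b, c, h⟩ := exists_distinct3 a
  set e : Fin 3 → Fin 3 → ℝ := fun j i => SignType.sign (d j i) with he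
  have hpos : ∀ (f : Fin 3 → ℝ) (j i : Fin 3), 0 < f i * d j i → 0 < f i * e j i := by
    intro f j i h
    simp only [he]
    rcases lt_trichotomy (d j i) 0 with h' | h' | h'
    · rw [sign_neg h']
      simp
      nlinarith
    · simp [h'] at h
    · rw [sign_pos h']
      simp
      nlinarith
  set u₁ : Fin 3 → ℝ := fun i => ∑ j, if j = i then 0 else e j i with hu₁
  set u₂ : Fin 3 → ℝ := fun i => if i = a then 0 else if i = b then e c b else e b c with hu₂
  have hu₁' : ∀ i j k, Distinct3 i j k →
      u₁ i = SignType.sign (d j i) + SignType.sign (d k i) := by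
    intro i j k h
    simp only [hu₁]
    rw [h.sum_eq]
    simp [h.1.symm, h.2.1.symm, he]
  have hN : IsCompact ((C ×ˢ Metric.sphere (0 : Fin 3 → ℝ) 1) ∩
      {z | IsNormal (pairCoord p) z.2 z.1}) :=
    (hC.prod (isCompact_sphere _ _)).inter_right (isClosed_setOf_isNormal _)
  obtain ⟨γ, -, hγ⟩ := hN.exists_pos_forall_add_mul_pos (g := fun z => z.2 ⬝ᵥ u₁)
    (h := fun z => z.2 ⬝ᵥ u₂) (by fun_prop) (by fun_prop) (by
      rintro ⟨x, f⟩ ⟨⟨hx, hf⟩, hn⟩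
      exact (hn.badNormal_or hqd (hcore x hx) (ne_zero_of_mem_unit_sphere ⟨f, hf⟩) u₁ hu₁').1)
    (by
      rintro ⟨x, f⟩ ⟨⟨hx, hf⟩, hn⟩ h0
      obtain ⟨j, hj⟩ :=
        (hn.badNormal_or hqd (hcore x hx) (ne_zero_of_mem_unit_sphere ⟨f, hf⟩) u₁ hu₁').2 h0
      have hdot : f ⬝ᵥ u₂ = f b * e c b + f c * e b c := by
        rw [h.dot_eq]
        simp [hu₂, h.1.symm, h.2.1.symm, h.2.2.symm]
      change 0 < f ⬝ᵥ u₂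
      rw [hdot]
      rcases h.eq_or j with rfl | rfl | rfl
      · exact absurd ⟨f, hn, hj⟩ (ha x hx)
      · have := hpos f j c (hj.2 c a h.rotate).1
        have hfj : f j = 0 := hj.1
        rw [hfj]
        linarith
      · have := hpos f j b (hj.2 b a h.rotate.rotate.swap).1
        have hfj : f j = 0 := hj.1
        rw [hfj]
        linarith)
  obtain ⟨ε, hε⟩ := exists_sub_mem_interior_Oc hC hCO (u₁ + γ • u₂) (by
    intro x hx f hf0 hf
    have hn : 0 < ‖f‖⁻¹ := inv_pos.2 (norm_pos_iff.2 hf0)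
    have := hγ (x, ‖f‖⁻¹ • f) ⟨⟨hx, by simp [norm_smul, hf0]⟩, fun y hy => by
      simp only [smul_dotProduct, smul_eq_mul]
      exact mul_le_mul_of_nonneg_left (hf y hy) hn.le⟩
    simp only [smul_dotProduct, smul_eq_mul] at this
    rw [dotProduct_add, dotProduct_smul, smul_eq_mul]
    refine (mul_pos_iff_of_pos_left hn).1 ?_
    linarith)
  exact ⟨_, hε⟩

/-- The points to be covered: the 1-skeleton of the cube and the six-point configuration `q`. -/
def Target (q : Fin 3 → Fin 3 → ℝ) (x : Fin 3 → ℝ) : Prop :=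
  x ∈ cubeSkel ∨ FacePoint q x

/-- Three target points `w j` that are contact points of the three kinds for the same translation
`t`, with the signs of the normals standardised. -/
structure StdTriple (q : Fin 3 → Fin 3 → ℝ) (t : Fin 3 → ℝ) (w : Fin 3 → Fin 3 → ℝ) : Prop where
  target : ∀ j, Target q (w j)
  apply_eq : ∀ j i, j ≠ i → w j i = t i + q j i
  diag : ∀ j, t j < w j j ∧ w j j < t j + 1
  nonneg : ∀ j i, j ≠ i → 0 ≤ q j i
  le_one : ∀ j i, j ≠ i → q j i ≤ 1
  lt_one : q 0 1 < 1 ∧ q 0 2 < 1 ∧ q 1 0 < 1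
  pos : 0 < q 1 2 ∧ 0 < q 2 0 ∧ 0 < q 2 1
  normal_zero : ∃ b c : ℝ, 0 < b ∧ 0 < c ∧ b * (1 - q 0 1) ≤ c * (q 0 2 - q 1 2) ∧
    c * (1 - q 0 2) ≤ b * (q 0 1 - q 2 1)
  normal_one : ∃ a c : ℝ, 0 < a ∧ 0 < c ∧ a * (1 - q 1 0) ≤ c * (q 0 2 - q 1 2) ∧
    c * q 1 2 ≤ a * (q 1 0 - q 2 0)

namespace StdTriple

variable {q : Fin 3 → Fin 3 → ℝ} {t : Fin 3 → ℝ} {w : Fin 3 → Fin 3 → ℝ}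

lemma diff_pos (h : StdTriple q t w) :
    0 < q 1 0 - q 2 0 ∧ 0 < q 0 1 - q 2 1 ∧ 0 < q 0 2 - q 1 2 := by
  obtain ⟨h01, h02, h10⟩ := h.lt_one
  obtain ⟨h12, h20, h21⟩ := h.pos
  obtain ⟨b, c, hb, hc, e1, e2⟩ := h.normal_zero
  obtain ⟨a', c', ha', hc', e3, e4⟩ := h.normal_one
  refine ⟨?_, ?_, ?_⟩
  · exact (mul_pos_iff_of_pos_left ha').1 ((mul_pos hc' h12).trans_le e4)
  · exact (mul_pos_iff_of_pos_left hb).1 ((mul_pos hc (sub_pos.2 h02)).trans_le e2)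
  · exact (mul_pos_iff_of_pos_left hc).1 ((mul_pos hb (sub_pos.2 h01)).trans_le e1)

lemma mem_Icc (h : StdTriple q t w) (j i : Fin 3) : 0 ≤ w j i ∧ w j i ≤ 1 := by
  rcases h.target j with hj | ⟨k, hk, hk'⟩
  · exact hj.1 i
  · by_cases hik : i = k
    · subst hik
      rcases hk with hk | hk <;> rw [hk] <;> norm_num
    · rw [hk' i hik]
      exact ⟨h.nonneg k i (Ne.symm hik), h.le_one k i (Ne.symm hik)⟩

lemma target_cases (h : StdTriple q t w) {j i k : Fin 3} (hd : Distinct3 j i k) :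
    (w j i = 0 ∨ w j i = 1) ∧ (w j j = 0 ∨ w j j = 1) ∨
    (w j k = 0 ∨ w j k = 1) ∧ (w j j = 0 ∨ w j j = 1) ∨
    (w j i = 0 ∨ w j i = 1) ∧ (w j k = 0 ∨ w j k = 1) ∨
    (t i = 0 ∧ t k = 0 ∧ t j ≠ 0) ∨
    (w j i = 0 ∨ w j i = 1) ∧ w j j = q i j ∧ w j k = q i k ∨
    (w j k = 0 ∨ w j k = 1) ∧ w j j = q k j ∧ w j i = q k i := by
  rcases h.target j with hj | ⟨a, ha, ha'⟩
  · obtain ⟨-, b, c, hbc, hb, hc⟩ := hj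
    rcases hd.eq_or b with rfl | rfl | rfl <;> rcases hd.eq_or c with rfl | rfl | rfl <;> tauto
  · rcases hd.eq_or a with rfl | rfl | rfl
    · have e1 := ha' i hd.1.symm
      have e2 := ha' k hd.2.1.symm
      have e3 := h.apply_eq _ _ hd.1
      have e4 := h.apply_eq _ _ hd.2.1
      refine Or.inr <| Or.inr <| Or.inr <| Or.inl ⟨by linarith, by linarith, fun h0 => ?_⟩
      have := h.diag a
      rcases ha with ha | ha <;> linarith
    · exact Or.inr <| Or.inr <| Or.inr <| Or.inr <| Or.inl
        ⟨ha, ha' _ hd.1, ha' _ hd.2.2.symm⟩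
    · exact Or.inr <| Or.inr <| Or.inr <| Or.inr <| Or.inr
        ⟨ha, ha' _ hd.2.1, ha' _ hd.2.2⟩

lemma diag_cases (h : StdTriple q t w) {j i k : Fin 3} (hd : Distinct3 j i k)
    (h0 : w j k ≠ 0) (h1 : w j k ≠ 1) (ht : t i ≠ 0) :
    (w j j = 0 ∨ w j j = 1) ∨ (w j j = q i j ∧ w j k = q i k) := by
  have hk : ¬(w j k = 0 ∨ w j k = 1) := not_or.2 ⟨h0, h1⟩
  rcases h.target_cases hd with h | h | h | h | h | h
  exacts [Or.inl h.2, Or.inl h.2, absurd h.2 hk, absurd h.1 ht, Or.inr h.2, absurd h.1 hk]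

/-- At most two translations have a triple of contact points. -/
lemma translation_eq (h : StdTriple q t w) :
    (t 0 = -q 2 0 ∧ t 1 = 1 - q 0 1 ∧ t 2 = -q 1 2) ∨
      (t 0 = 1 - q 1 0 ∧ t 1 = -q 2 1 ∧ t 2 = 1 - q 0 2) := by
  obtain ⟨h01, h02, h10⟩ := h.lt_one
  obtain ⟨h12, h20, h21⟩ := h.pos
  obtain ⟨dx, dy, dz⟩ := h.diff_pos
  have b := h.mem_Icc
  have e01 := h.apply_eq 0 1 (by decide)
  have e02 := h.apply_eq 0 2 (by decide)
  have e10 := h.apply_eq 1 0 (by decide)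
  have e12 := h.apply_eq 1 2 (by decide)
  have e20 := h.apply_eq 2 0 (by decide)
  have e21 := h.apply_eq 2 1 (by decide)
  have c0 : w 0 1 = 1 ∨ w 0 2 = 1 ∨ (t 1 = 0 ∧ t 2 = 0 ∧ t 0 ≠ 0) := by
    have n1 : w 0 1 ≠ 0 := by linarith [b 2 1]
    have n2 : w 0 2 ≠ 0 := by linarith [b 1 2]
    have := h.target_cases (j := 0) (i := 1) (k := 2) (by simp [Distinct3])
    tauto
  have c1 : w 1 0 = 1 ∨ w 1 2 = 0 ∨ (t 0 = 0 ∧ t 2 = 0 ∧ t 1 ≠ 0) := by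
    have n1 : w 1 0 ≠ 0 := by linarith [b 2 0]
    have n2 : w 1 2 ≠ 1 := by linarith [b 0 2]
    have := h.target_cases (j := 1) (i := 0) (k := 2) (by simp [Distinct3])
    tauto
  have c2 : w 2 0 = 0 ∨ w 2 1 = 0 ∨ (t 0 = 0 ∧ t 1 = 0 ∧ t 2 ≠ 0) := by
    have n1 : w 2 0 ≠ 1 := by linarith [b 1 0]
    have n2 : w 2 1 ≠ 1 := by linarith [b 0 1]
    have := h.target_cases (j := 2) (i := 0) (k := 1) (by simp [Distinct3])
    tauto
  rw [e01, e02] at c0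
  rw [e10, e12] at c1
  rw [e20, e21] at c2
  rcases c0 with c0 | c0 | ⟨c0, c0', c0''⟩ <;> rcases c1 with c1 | c1 | ⟨c1, c1', c1''⟩ <;>
    rcases c2 with c2 | c2 | ⟨c2, c2', c2''⟩
  all_goals first
    | (exfalso; linarith)
    | (exfalso; exact c0'' (by linarith))
    | (left; refine ⟨?_, ?_, ?_⟩ <;> linarith)
    | (right; refine ⟨?_, ?_, ?_⟩ <;> linarith)

/-- One of the three points lies in the relative interior of an edge of the cube, and is out of
reach of the other translation admitting a triple. -/
lemma exists_edge (h : StdTriple q t w) :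
    ∃ j m, m ≠ j ∧ (∀ i, i ≠ m → w j i = 0 ∨ w j i = 1) ∧ (0 < w j m ∧ w j m < 1) ∧
      ∀ t' w', StdTriple q t' w' → t' ≠ t → ∃ i, w j i - t' i < 0 ∨ 1 < w j i - t' i := by
  obtain ⟨h01, h02, h10⟩ := h.lt_one
  obtain ⟨h12, h20, h21⟩ := h.pos
  obtain ⟨dx, dy, dz⟩ := h.diff_pos
  have e01 := h.apply_eq 0 1 (by decide)
  have e02 := h.apply_eq 0 2 (by decide)
  have e10 := h.apply_eq 1 0 (by decide)
  have e12 := h.apply_eq 1 2 (by decide)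
  have e20 := h.apply_eq 2 0 (by decide)
  have e21 := h.apply_eq 2 1 (by decide)
  have g0 := h.diag 0
  have g1 := h.diag 1
  have g2 := h.diag 2
  have q01 := h.nonneg 0 1 (by decide)
  obtain ⟨b, c, hb, hc, e1, e2⟩ := h.normal_zero
  rcases h.translation_eq with ⟨t0, t1, t2⟩ | ⟨t0, t1, t2⟩
  · have sep : ∀ j, w j 0 = 0 → ∀ t' w', StdTriple q t' w' → t' ≠ t →
        ∃ i, w j i - t' i < 0 ∨ 1 < w j i - t' i := by
      intro j hj t' w' h' hne
      rcases h'.translation_eq with ⟨t0', t1', t2'⟩ | ⟨t0', t1', t2'⟩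
      · refine absurd ?_ hne
        ext i
        fin_cases i
        exacts [t0'.trans t0.symm, t1'.trans t1.symm, t2'.trans t2.symm]
      · exact ⟨0, Or.inl (by linarith)⟩
    have w01 : w 0 1 = 1 := by linarith
    have w02 : w 0 2 = q 0 2 - q 1 2 := by linarith
    have w20 : w 2 0 = 0 := by linarith
    have w21 : w 2 1 = 1 - (q 0 1 - q 2 1) := by linarith
    have c0 : w 0 0 = 0 ∨ (w 0 0 = q 1 0 ∧ w 0 2 = q 1 2) := by
      have n1 : w 0 0 ≠ 1 := by linarith
      have n2 : w 0 2 ≠ 0 := by linarith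
      have n3 : w 0 2 ≠ 1 := by linarith
      have n4 : t 1 ≠ 0 := by linarith
      have := h.diag_cases (j := 0) (i := 1) (k := 2) (by simp [Distinct3]) n2 n3 n4
      tauto
    have c2 : w 2 2 = 0 ∨ (w 2 2 = q 0 2 ∧ w 2 1 = q 0 1) := by
      have n1 : w 2 2 ≠ 1 := by linarith
      have n2 : w 2 1 ≠ 0 := by linarith
      have n3 : w 2 1 ≠ 1 := by linarith
      have n4 : t 0 ≠ 0 := by linarith
      have := h.diag_cases (j := 2) (i := 0) (k := 1) (by simp [Distinct3]) n2 n3 n4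
      tauto
    rcases c0 with c0 | ⟨c0, c0'⟩
    · refine ⟨0, 2, by decide, fun i hi => ?_, ⟨by linarith, by linarith⟩, sep 0 c0⟩
      fin_cases i
      exacts [Or.inl c0, Or.inr w01, absurd rfl hi]
    rcases c2 with c2 | ⟨c2, c2'⟩
    · refine ⟨2, 1, by decide, fun i hi => ?_, ⟨by linarith, by linarith⟩, sep 2 w20⟩
      fin_cases i
      exacts [Or.inl w20, absurd rfl hi, Or.inl c2]
    exfalso
    have : c * (1 - q 0 2) ≤ c * (q 0 2 - q 1 2) := by
      refine e2.trans (le_trans (le_of_eq ?_) e1)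
      congr 1
      linarith
    have := le_of_mul_le_mul_left this hc
    linarith
  · have sep : ∀ j, w j 0 = 1 → ∀ t' w', StdTriple q t' w' → t' ≠ t →
        ∃ i, w j i - t' i < 0 ∨ 1 < w j i - t' i := by
      intro j hj t' w' h' hne
      rcases h'.translation_eq with ⟨t0', t1', t2'⟩ | ⟨t0', t1', t2'⟩
      · exact ⟨0, Or.inr (by linarith)⟩
      · refine absurd ?_ hne
        ext i
        fin_cases i
        exacts [t0'.trans t0.symm, t1'.trans t1.symm, t2'.trans t2.symm]
    have w01 : w 0 1 = q 0 1 - q 2 1 := by linarith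
    have w02 : w 0 2 = 1 := by linarith
    have w10 : w 1 0 = 1 := by linarith
    have w12 : w 1 2 = 1 - (q 0 2 - q 1 2) := by linarith
    have c0 : w 0 0 = 1 ∨ (w 0 0 = q 2 0 ∧ w 0 1 = q 2 1) := by
      have n1 : w 0 0 ≠ 0 := by linarith
      have n2 : w 0 1 ≠ 0 := by linarith
      have n3 : w 0 1 ≠ 1 := by linarith
      have n4 : t 2 ≠ 0 := by linarith
      have := h.diag_cases (j := 0) (i := 2) (k := 1) (by simp [Distinct3]) n2 n3 n4
      tauto
    have c1 : w 1 1 = 0 ∨ (w 1 1 = q 0 1 ∧ w 1 2 = q 0 2) := by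
      have n1 : w 1 1 ≠ 1 := by linarith
      have n2 : w 1 2 ≠ 0 := by linarith
      have n3 : w 1 2 ≠ 1 := by linarith
      have n4 : t 0 ≠ 0 := by linarith
      have := h.diag_cases (j := 1) (i := 0) (k := 2) (by simp [Distinct3]) n2 n3 n4
      tauto
    rcases c0 with c0 | ⟨c0, c0'⟩
    · refine ⟨0, 1, by decide, fun i hi => ?_, ⟨by linarith, by linarith⟩, sep 0 c0⟩
      fin_cases i
      exacts [Or.inr c0, absurd rfl hi, Or.inr w02]
    rcases c1 with c1 | ⟨c1, c1'⟩
    · refine ⟨1, 2, by decide, fun i hi => ?_, ⟨by linarith, by linarith⟩, sep 1 w10⟩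
      fin_cases i
      exacts [Or.inr w10, Or.inl c1, absurd rfl hi]
    exfalso
    have : b * (1 - q 0 1) ≤ b * (q 0 1 - q 2 1) := by
      refine e1.trans (le_trans (le_of_eq ?_) e2)
      congr 1
      linarith
    have := le_of_mul_le_mul_left this hb
    linarith

end StdTriple

/-- Three target points `w j` that are contact points of the three kinds for the same
translation `t`. -/
structure Triple (q d : Fin 3 → Fin 3 → ℝ) (t : Fin 3 → ℝ) (w : Fin 3 → Fin 3 → ℝ) : Prop where
  target : ∀ j, Target q (w j)
  contact : ∀ j, Contact q d j (w j - t)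
  diag : ∀ j, 0 < w j j - t j ∧ w j j - t j < 1

/-- Reflection of the unit cube in the coordinates with `s i = -1`. -/
noncomputable def cubeReflect (s x : Fin 3 → ℝ) (i : Fin 3) : ℝ := s i * x i + (1 - s i) / 2

section Reflect

variable {q d : Fin 3 → Fin 3 → ℝ} {s x : Fin 3 → ℝ}

lemma cubeReflect_eq_iff (hs : ∀ i, s i = 1 ∨ s i = -1) (i : Fin 3) :
    cubeReflect s x i = 0 ∨ cubeReflect s x i = 1 ↔ x i = 0 ∨ x i = 1 := by
  unfold cubeReflect
  rcases hs i with h | h <;> rw [h]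
  · simp
  · constructor <;> rintro (h | h)
    · exact Or.inr (by linarith)
    · exact Or.inl (by linarith)
    · exact Or.inr (by linarith)
    · exact Or.inl (by linarith)

lemma cubeReflect_mem_Icc_iff (hs : ∀ i, s i = 1 ∨ s i = -1) (i : Fin 3) :
    0 ≤ cubeReflect s x i ∧ cubeReflect s x i ≤ 1 ↔ 0 ≤ x i ∧ x i ≤ 1 := by
  unfold cubeReflect
  rcases hs i with h | h <;> rw [h] <;> constructor <;> rintro ⟨h1, h2⟩ <;> constructor <;> linarith

lemma cubeReflect_mem_Ioo_iff (hs : ∀ i, s i = 1 ∨ s i = -1) (i : Fin 3) :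
    0 < cubeReflect s x i ∧ cubeReflect s x i < 1 ↔ 0 < x i ∧ x i < 1 := by
  unfold cubeReflect
  rcases hs i with h | h <;> rw [h] <;> constructor <;> rintro ⟨h1, h2⟩ <;> constructor <;> linarith

lemma Target.cubeReflect (hs : ∀ i, s i = 1 ∨ s i = -1) (hx : Target q x) :
    Target (fun j => cubeReflect s (q j)) (cubeReflect s x) := by
  rcases hx with ⟨h, i, j, hij, hi, hj⟩ | ⟨j, hj, h⟩
  · exact Or.inl ⟨fun i => (cubeReflect_mem_Icc_iff hs i).2 (h i), i, j, hij,
      (cubeReflect_eq_iff hs i).2 hi, (cubeReflect_eq_iff hs j).2 hj⟩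
  · refine Or.inr ⟨j, (cubeReflect_eq_iff hs j).2 hj, fun i hi => ?_⟩
    simp only [_root_.cubeReflect, h i hi]

lemma cubeReflect_lt_one (hqd : Admissible q d) (hs : ∀ i, s i = 1 ∨ s i = -1) {j i : Fin 3}
    (hji : j ≠ i) (h : 0 < s i * d j i) : cubeReflect s (q j) i < 1 := by
  unfold cubeReflect
  obtain ⟨-, h1, h2, h3, h4⟩ := hqd j i hji
  rcases hs i with e | e <;> rw [e] at h ⊢ <;> linarith

lemma cubeReflect_pos (hqd : Admissible q d) (hs : ∀ i, s i = 1 ∨ s i = -1) {j i : Fin 3}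
    (hji : j ≠ i) (h : s i * d j i < 0) : 0 < cubeReflect s (q j) i := by
  unfold cubeReflect
  obtain ⟨-, h1, h2, h3, h4⟩ := hqd j i hji
  rcases hs i with e | e <;> rw [e] at h ⊢ <;> linarith

end Reflect

lemma max_zero_eq_of_sign {f g : ℝ} (hg : g = 1 ∨ g = -1) (h : 0 < g * f) :
    max f 0 = (f + g * f) / 2 := by
  rcases hg with rfl | rfl
  · rw [max_eq_left (by linarith)]
    ring
  · rw [max_eq_right (by linarith)]
    ring

namespace Triple

variable {q d : Fin 3 → Fin 3 → ℝ} {t : Fin 3 → ℝ} {w : Fin 3 → Fin 3 → ℝ}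

lemma apply_eq (h : Triple q d t w) {j i : Fin 3} (hji : j ≠ i) : w j i = t i + q j i := by
  obtain ⟨k, hd⟩ := exists_distinct3_of_ne hji
  obtain ⟨f, -, -, hf⟩ := h.contact j
  have := (hf i k hd).2.1
  rw [Pi.sub_apply] at this
  linarith

lemma exists_normal (h : Triple q d t w) {j i k : Fin 3} (hd : Distinct3 j i k) :
    ∃ a b : ℝ, 0 < a * d j i ∧ 0 < b * d j k ∧ d j i * d k i < 0 ∧ d j k * d i k < 0 ∧
      max a 0 + b * q i k ≤ a * q j i + b * q j k ∧
      max b 0 + a * q k i ≤ a * q j i + b * q j k := by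
  obtain ⟨f, hn, hf0, hf⟩ := h.contact j
  obtain ⟨h1, e1, o1⟩ := hf i k hd
  obtain ⟨h2, e2, o2⟩ := hf k i hd.swap
  have n1 := hn.pair_le hd.rotate
  have n2 := hn.pair_le hd.rotate.rotate
  rw [hd.dot_eq, e1, e2, hf0] at n1 n2
  exact ⟨f i, f k, h1, h2, o1, o2, by linarith, by linarith⟩

lemma stdTriple (hqd : Admissible q d) {s : Fin 3 → ℝ} (hs : ∀ i, s i = 1 ∨ s i = -1)
    (h0 : 0 < s 0 * d 1 0) (h1 : 0 < s 1 * d 0 1) (h2 : 0 < s 2 * d 0 2) (h : Triple q d t w) :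
    StdTriple (fun j => cubeReflect s (q j)) (s * t) (fun j => cubeReflect s (w j)) := by
  have hsq : ∀ i, s i * s i = 1 := fun i => by rcases hs i with e | e <;> rw [e] <;> norm_num
  obtain ⟨b, c, hb, hc, ob, oc, n1, n2⟩ :=
    h.exists_normal (j := 0) (i := 1) (k := 2) (by simp [Distinct3])
  obtain ⟨a', c', ha', hc', oa', oc', n3, n4⟩ :=
    h.exists_normal (j := 1) (i := 0) (k := 2) (by simp [Distinct3])
  have flip : ∀ {g x y : ℝ}, 0 < g * x → x * y < 0 → g * y < 0 := by
    intro g x y h1 h2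
    have hx : x ≠ 0 := by rintro rfl; simp at h1
    have : (x * x) * (g * y) < 0 := by nlinarith
    exact (pos_iff_neg_of_mul_neg this).1 (mul_self_pos.2 hx)
  have same : ∀ {g x y : ℝ}, 0 < g * x → 0 < y * x → 0 < g * y := by
    intro g x y h1 h2
    have hx : x ≠ 0 := by rintro rfl; simp at h1
    have : 0 < (x * x) * (g * y) := by nlinarith
    exact (mul_pos_iff_of_pos_left (mul_self_pos.2 hx)).1 this
  have d21 := flip h1 ob
  have d12 := flip h2 oc
  have d20 := flip h0 oa'
  have sb := same h1 hb
  have sc := same h2 hc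
  have sa' := same h0 ha'
  have sc' : 0 < -s 2 * c' := same (x := d 1 2) (by linarith) hc'
  have hs' : -s 2 = 1 ∨ -s 2 = -1 := by
    rcases hs 2 with e | e <;> rw [e] <;> norm_num
  rw [max_zero_eq_of_sign (hs 1) sb] at n1
  rw [max_zero_eq_of_sign (hs 2) sc] at n2
  rw [max_zero_eq_of_sign (hs 0) sa'] at n3
  rw [max_zero_eq_of_sign hs' sc'] at n4
  refine ⟨fun j => (h.target j).cubeReflect hs, fun j i hji => ?_, fun j => ?_, fun j i hji => ?_,
    fun j i hji => ?_, ⟨?_, ?_, ?_⟩, ⟨?_, ?_, ?_⟩, ⟨s 1 * b, s 2 * c, sb, sc, ?_, ?_⟩,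
    ⟨s 0 * a', -s 2 * c', sa', sc', ?_, ?_⟩⟩
  · simp only [cubeReflect, h.apply_eq hji, Pi.mul_apply]
    ring
  · obtain ⟨g1, g2⟩ := h.diag j
    simp only [cubeReflect, Pi.mul_apply]
    rcases hs j with e | e <;> rw [e] <;> constructor <;> linarith
  · exact ((cubeReflect_mem_Icc_iff hs i).2 ⟨(hqd j i hji).2.1, (hqd j i hji).2.2.1⟩).1
  · exact ((cubeReflect_mem_Icc_iff hs i).2 ⟨(hqd j i hji).2.1, (hqd j i hji).2.2.1⟩).2
  · exact cubeReflect_lt_one hqd hs (by decide) h1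
  · exact cubeReflect_lt_one hqd hs (by decide) h2
  · exact cubeReflect_lt_one hqd hs (by decide) h0
  · exact cubeReflect_pos hqd hs (by decide) d12
  · exact cubeReflect_pos hqd hs (by decide) d20
  · exact cubeReflect_pos hqd hs (by decide) d21
  · simp only [cubeReflect]
    linear_combination n1 + (b / 2 - b * q 0 1) * hsq 1 - c * (q 0 2 - q 1 2) * hsq 2
  · simp only [cubeReflect]
    linear_combination n2 + (c / 2 - c * q 0 2) * hsq 2 - b * (q 0 1 - q 2 1) * hsq 1
  · simp only [cubeReflect]
    linear_combination n3 + (a' / 2 - a' * q 1 0) * hsq 0 + c' * (q 0 2 - q 1 2) * hsq 2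
  · simp only [cubeReflect]
    linear_combination n4 + (c' / 2 - c' * q 1 2) * hsq 2 - a' * (q 1 0 - q 2 0) * hsq 0

/-- One of the three points of a triple lies in the relative interior of an edge of the cube, and
is out of reach of any other translation admitting a triple. -/
lemma exists_edge (hqd : Admissible q d) (h : Triple q d t w) :
    ∃ j m, m ≠ j ∧ (∀ i, i ≠ m → w j i = 0 ∨ w j i = 1) ∧ (0 < w j m ∧ w j m < 1) ∧
      ∀ t' w', Triple q d t' w' → t' ≠ t → ∃ i, w j i - t' i < 0 ∨ 1 < w j i - t' i := by
  have key : ∀ x : ℝ, x ≠ 0 → ∃ g : ℝ, (g = 1 ∨ g = -1) ∧ 0 < g * x := by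
    intro x hx
    rcases lt_or_gt_of_ne hx with h | h
    · exact ⟨-1, Or.inr rfl, by linarith⟩
    · exact ⟨1, Or.inl rfl, by linarith⟩
  obtain ⟨g0, hg0, h0⟩ := key _ (hqd 1 0 (by decide)).1
  obtain ⟨g1, hg1, h1⟩ := key _ (hqd 0 1 (by decide)).1
  obtain ⟨g2, hg2, h2⟩ := key _ (hqd 0 2 (by decide)).1
  have hs : ∀ i, (![g0, g1, g2] : Fin 3 → ℝ) i = 1 ∨ (![g0, g1, g2] : Fin 3 → ℝ) i = -1 := by
    intro i
    fin_cases i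
    exacts [hg0, hg1, hg2]
  generalize hsdef : (![g0, g1, g2] : Fin 3 → ℝ) = s at hs
  have e0 : s 0 = g0 := by simp [← hsdef]
  have e1 : s 1 = g1 := by simp [← hsdef]
  have e2 : s 2 = g2 := by simp [← hsdef]
  rw [← e0] at h0
  rw [← e1] at h1
  rw [← e2] at h2
  obtain ⟨j, m, hm, hw, hmw, hsep⟩ := (h.stdTriple hqd hs h0 h1 h2).exists_edge
  refine ⟨j, m, hm, fun i hi => (cubeReflect_eq_iff hs i).1 (hw i hi),
    (cubeReflect_mem_Ioo_iff hs m).1 hmw, fun t' w' h' hne => ?_⟩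
  obtain ⟨i, hi⟩ := hsep _ _ (h'.stdTriple hqd hs h0 h1 h2) fun e => hne <| by
    ext i
    have := congrFun e i
    simp only [Pi.mul_apply] at this
    rcases hs i with e | e <;> rw [e] at this <;> linarith
  refine ⟨i, ?_⟩
  simp only [cubeReflect, Pi.mul_apply] at hi
  rcases hs i with e | e <;> rw [e] at hi <;> rcases hi with hi | hi
  · exact Or.inl (by linarith)
  · exact Or.inr (by linarith)
  · exact Or.inr (by linarith)
  · exact Or.inl (by linarith)

end Triple

lemma isClosed_cubeSkel : IsClosed cubeSkel := by
  have h : ∀ i : Fin 3, IsClosed {x : Fin 3 → ℝ | x i = 0 ∨ x i = 1} := fun i =>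
    (isClosed_eq (continuous_apply i) continuous_const).union
      (isClosed_eq (continuous_apply i) continuous_const)
  have e : cubeSkel = (⋂ i, {x : Fin 3 → ℝ | x i ∈ Icc (0 : ℝ) 1}) ∩
      ⋃ i, ⋃ j, ⋃ _ : i ≠ j, {x : Fin 3 → ℝ | x i = 0 ∨ x i = 1} ∩ {x | x j = 0 ∨ x j = 1} := by
    ext x
    simp only [cubeSkel, mem_ofPred_eq, mem_inter_iff, mem_iInter, mem_iUnion, exists_prop]
  rw [e]
  refine (isClosed_iInter fun i => isClosed_Icc.preimage (continuous_apply i)).inter ?_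
  refine isClosed_iUnion_of_finite fun i => isClosed_iUnion_of_finite fun j =>
    isClosed_iUnion_of_finite fun _ => (h i).inter (h j)

lemma setOf_target_eq (p : Fin 6 → ℝ) : {x | Target (pairCoord p) x} = cubeSkel ∪ Vpts p := by
  ext x
  simp [Target, mem_Vpts_iff]

lemma isClosed_setOf_target (p : Fin 6 → ℝ) : IsClosed {x | Target (pairCoord p) x} := by
  rw [setOf_target_eq]
  exact isClosed_cubeSkel.union (finite_Vpts p).isClosed

section Cover

variable {p : Fin 6 → ℝ} {d : Fin 3 → Fin 3 → ℝ} {Q : Set (Fin 3 → ℝ)}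

/-- If the part of `S` in a translate of `Q` cannot be covered by a translate of the interior of
`Oc p`, it contains a triple of contact points. -/
lemma exists_triple (hqd : Admissible (pairCoord p) d) (hQ : IsCompact Q) (hQO : Q ⊆ Oc p)
    (hcore : ∀ x ∈ Q, InCore (pairCoord p) d x) {S : Set (Fin 3 → ℝ)} (hS : IsClosed S)
    (hST : ∀ x ∈ S, Target (pairCoord p) x) {t : Fin 3 → ℝ}
    (ht : ¬ ∃ v, ∀ x ∈ Q, t + x ∈ S → t + x - v ∈ interior (Oc p)) :
    ∃ w, Triple (pairCoord p) d t w ∧ ∀ j, w j ∈ S ∧ w j - t ∈ Q := by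
  have hC : IsCompact (Q ∩ {x | t + x ∈ S}) :=
    hQ.inter_right (hS.preimage (continuous_const.add continuous_id))
  have hex : ∀ j, ∃ x ∈ Q ∩ {x | t + x ∈ S}, Contact (pairCoord p) d j x := by
    intro j
    by_contra! hj
    obtain ⟨v, hv⟩ := exists_sub_mem_interior_of_not_contact hqd hC
      (inter_subset_left.trans hQO) (fun x hx => hcore x hx.1) j hj
    refine ht ⟨t + v, fun x hx hxS => ?_⟩
    rw [add_sub_add_left_eq_sub]
    exact hv x ⟨hx, hxS⟩
  choose x hx hxc using hex
  refine ⟨fun j => t + x j, ⟨fun j => hST _ (hx j).2, fun j => ?_, fun j => ?_⟩,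
    fun j => ⟨(hx j).2, ?_⟩⟩
  · rw [add_sub_cancel_left]
    exact hxc j
  · rw [Pi.add_apply, add_sub_cancel_left]
    exact (hcore _ (hx j).1).pos_lt_one hqd j
  · rw [add_sub_cancel_left]
    exact (hx j).1

/-- A contact point in the relative interior of an edge of the cube is also covered by a
further translate. -/
lemma exists_ne_of_mem_edge (hQ : IsCompact Q) (hQO : Q ⊆ Oc p) {T : Finset (Fin 3 → ℝ)}
    (hT : ∀ x ∈ cubeSkel, ∃ t ∈ T, x - t ∈ Q) {t y : Fin 3 → ℝ} {j m : Fin 3} (hm : m ≠ j)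
    (hy : ∀ i, i ≠ m → y i = 0 ∨ y i = 1) (hym : 0 < y m ∧ y m < 1)
    (hc : Contact (pairCoord p) d j (y - t)) : ∃ t' ∈ T, t' ≠ t ∧ y - t' ∈ Q := by
  obtain ⟨f, hn, -, hf⟩ := hc
  obtain ⟨k, hd⟩ := exists_distinct3_of_ne hm.symm
  have hfm : f m ≠ 0 := by
    intro h0
    have := (hf m k hd).1
    simp [h0] at this
  have hZ : IsClosed (⋃ t' ∈ T.erase t, {z | z - t' ∈ Q}) :=
    (T.erase t).finite_toSet.isClosed_biUnion fun t' _ =>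
      hQ.isClosed.preimage (continuous_id.sub continuous_const)
  set γ : ℝ → Fin 3 → ℝ := fun ε => y + ε • Pi.single m (f m) with hγ
  have hγc : Continuous γ := by fun_prop
  have hγ0 : γ 0 = y := by simp [hγ]
  have hγi : ∀ ε i, i ≠ m → γ ε i = y i := fun ε i hi => by simp [hγ, hi]
  have hev : ∀ᶠ ε in nhdsWithin (0 : ℝ) (Ioi 0), γ ε ∈ ⋃ t' ∈ T.erase t, {z | z - t' ∈ Q} := by
    have hnear : ∀ᶠ ε in nhdsWithin (0 : ℝ) (Ioi 0), γ ε m ∈ Ioo (0 : ℝ) 1 := by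
      refine Filter.Eventually.filter_mono nhdsWithin_le_nhds ?_
      refine ((continuous_apply m).comp hγc).continuousAt.eventually_mem (isOpen_Ioo.mem_nhds ?_)
      simp [hγ0, hym]
    filter_upwards [hnear, self_mem_nhdsWithin] with ε hε hε0
    have hskel : γ ε ∈ cubeSkel := by
      refine ⟨fun i => ?_, j, k, hd.2.1, ?_, ?_⟩
      · by_cases hi : i = m
        · exact hi ▸ Ioo_subset_Icc_self hε
        · rw [hγi ε i hi]
          rcases hy i hi with h | h <;> simp [h]
      · rw [hγi ε j hm.symm]
        exact hy j hm.symm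
      · rw [hγi ε k hd.2.2.symm]
        exact hy k hd.2.2.symm
    obtain ⟨t', ht', hQt'⟩ := hT _ hskel
    simp only [mem_iUnion, Finset.mem_erase]
    refine ⟨t', ⟨?_, ht'⟩, hQt'⟩
    rintro rfl
    have h1 : f ⬝ᵥ (γ ε - t') ≤ f ⬝ᵥ (y - t') :=
      dotProduct_le_of_mem_Oc (hQO hQt') fun z hz => hn z ((mem_Vpts_iff p z).1 hz)
    have h2 : f ⬝ᵥ (γ ε - t') = f ⬝ᵥ (y - t') + ε * (f m * f m) := by
      simp only [hγ, dotProduct_sub, dotProduct_add, dotProduct_smul, dotProduct_single,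
        smul_eq_mul]
      ring
    have h3 : 0 < ε * (f m * f m) := mul_pos hε0 (mul_self_pos.2 hfm)
    linarith
  have hmem := hZ.mem_of_tendsto ((hγc.tendsto 0).mono_left nhdsWithin_le_nhds) hev
  rw [hγ0] at hmem
  simp only [mem_iUnion, Finset.mem_erase] at hmem
  obtain ⟨t', ⟨hne, ht'⟩, h⟩ := hmem
  exact ⟨t', ht', hne, h⟩

/-- A cover of the target by translates of `Q` can be replaced by a cover by as many translates of
the interior of `Oc p`. -/
lemma exists_cover_interior (hqd : Admissible (pairCoord p) d) (hQ : IsCompact Q) (hQO : Q ⊆ Oc p)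
    (hcore : ∀ x ∈ Q, InCore (pairCoord p) d x) {T : Finset (Fin 3 → ℝ)}
    (hT : ∀ x, Target (pairCoord p) x → ∃ t ∈ T, x - t ∈ Q) :
    ∃ v : (Fin 3 → ℝ) → Fin 3 → ℝ,
      ∀ x, Target (pairCoord p) x → ∃ t ∈ T, x - v t ∈ interior (Oc p) := by
  classical
  set F : Set (Fin 3 → ℝ) := {x | Target (pairCoord p) x} with hF
  have hFc : IsClosed F := isClosed_setOf_target p
  set movable : (Fin 3 → ℝ) → Prop := fun t =>
    ∃ v, ∀ x ∈ Q, t + x ∈ F → t + x - v ∈ interior (Oc p)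
  have hv : ∃ v : (Fin 3 → ℝ) → Fin 3 → ℝ, ∀ t, movable t →
      ∀ x ∈ Q, t + x ∈ F → t + x - v t ∈ interior (Oc p) := by
    choose! v hv using fun t (ht : movable t) => ht
    exact ⟨v, hv⟩
  obtain ⟨v, hv⟩ := hv
  set G : Set (Fin 3 → ℝ) := {y | ∃ t ∈ T, movable t ∧ y - v t ∈ interior (Oc p)} with hG
  have hGo : IsOpen G := by
    have : G = ⋃ t ∈ T, ⋃ _ : movable t, {y | y - v t ∈ interior (Oc p)} := by
      ext y
      simp only [hG, mem_ofPred_eq, mem_iUnion, exists_prop]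
    rw [this]
    exact isOpen_iUnion fun t => isOpen_iUnion fun _ => isOpen_iUnion fun _ =>
      isOpen_interior.preimage (continuous_id.sub continuous_const)
  have hrest : ∀ t ∈ T, ¬ movable t →
      ∃ v', ∀ x ∈ Q, t + x ∈ F ∩ Gᶜ → t + x - v' ∈ interior (Oc p) := by
    intro t ht hnm
    by_contra hcon
    obtain ⟨w, hw, hwS⟩ := exists_triple hqd hQ hQO hcore (hFc.inter hGo.isClosed_compl)
      (fun x hx => hx.1) hcon
    obtain ⟨j, m, hm, hj, hjm, hsep⟩ := hw.exists_edge hqd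
    obtain ⟨t', ht', hne, hQt'⟩ := exists_ne_of_mem_edge hQ hQO (fun x hx => hT x (Or.inl hx))
      hm hj hjm (hw.contact j)
    by_cases hmt : movable t'
    · refine (hwS j).1.2 ⟨t', ht', hmt, ?_⟩
      have := hv t' hmt _ hQt'
      rw [add_sub_cancel] at this
      exact this (hwS j).1.1
    · obtain ⟨w', hw', -⟩ := exists_triple hqd hQ hQO hcore hFc (fun x hx => hx) hmt
      obtain ⟨i, hi⟩ := hsep t' w' hw' hne
      have := (hcore _ hQt').pos_lt_one hqd i
      rw [Pi.sub_apply] at this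
      rcases hi with hi | hi <;> linarith
  choose! v' hv' using hrest
  refine ⟨fun t => if movable t then v t else v' t, fun x hx => ?_⟩
  by_cases hxG : x ∈ G
  · obtain ⟨t, ht, hmt, h⟩ := hxG
    exact ⟨t, ht, by simpa only [if_pos hmt] using h⟩
  · obtain ⟨t, ht, hQt⟩ := hT x hx
    have hadd : t + (x - t) = x := add_sub_cancel _ _
    refine ⟨t, ht, ?_⟩
    dsimp only
    split_ifs with hmt
    · have := hv t hmt _ hQt
      rw [hadd] at this
      exact this hx
    · have := hv' t ht hmt _ hQt
      rw [hadd] at this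
      exact this ⟨hx, hxG⟩

end Cover

lemma exists_pairCoord_eq {j i : Fin 3} (h : j ≠ i) :
    ∃ k, ∀ p, pairCoord p j i = p k := by
  fin_cases j <;> fin_cases i
  exacts [absurd rfl h, ⟨0, fun _ => rfl⟩, ⟨1, fun _ => rfl⟩, ⟨2, fun _ => rfl⟩, absurd rfl h,
    ⟨3, fun _ => rfl⟩, ⟨4, fun _ => rfl⟩, ⟨5, fun _ => rfl⟩, absurd rfl h]

lemma exists_eq_pairCoord (r : Fin 3 → Fin 3 → ℝ) :
    ∃ v, (∀ j i, j ≠ i → pairCoord v j i = r j i) ∧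
      ∀ k, ∃ j i, j ≠ i ∧ v k = r j i ∧ ∀ p, pairCoord p j i = p k := by
  refine ⟨![r 0 1, r 0 2, r 1 0, r 1 2, r 2 0, r 2 1], fun j i h => ?_, fun k => ?_⟩
  · fin_cases j <;> fin_cases i
    exacts [absurd rfl h, rfl, rfl, rfl, absurd rfl h, rfl, rfl, rfl, absurd rfl h]
  · fin_cases k
    exacts [⟨0, 1, by decide, rfl, fun _ => rfl⟩, ⟨0, 2, by decide, rfl, fun _ => rfl⟩,
      ⟨1, 0, by decide, rfl, fun _ => rfl⟩, ⟨1, 2, by decide, rfl, fun _ => rfl⟩,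
      ⟨2, 0, by decide, rfl, fun _ => rfl⟩, ⟨2, 1, by decide, rfl, fun _ => rfl⟩]

lemma isCompact_Oc (p : Fin 6 → ℝ) : IsCompact (Oc p) :=
  (finite_Vpts p).isCompact_convexHull ℝ

/-- The intersection of the hulls over the vertices of a box is contained in the hull of every
parameter in the box. -/
lemma iInter_vertices_subset_Oc {a δ v : Fin 6 → ℝ} (hv : ∀ i, v i ∈ Icc (a i) (a i + δ i)) :
    (⋂ v ∈ {v : Fin 6 → ℝ | ∀ i, v i = a i ∨ v i = a i + δ i}, Oc v) ⊆ Oc v := by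
  intro x hx
  by_contra hxv
  obtain ⟨φ, M, hφ, hφx⟩ := geometric_hahn_banach_closed_point (convex_convexHull ℝ (Vpts v))
    (isCompact_Oc v).isClosed hxv
  obtain ⟨f, hf⟩ := exists_dotProduct_eq φ
  set c : Fin 6 → ℝ := ![f 1, f 2, f 0, f 2, f 0, f 1] with hc
  set v' : Fin 6 → ℝ := fun k => if 0 ≤ c k then a k else a k + δ k with hv'
  have hle : ∀ k, c k * v' k ≤ c k * v k := by
    intro k
    simp only [hv']
    split_ifs with h
    · exact mul_le_mul_of_nonneg_left (hv k).1 h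
    · exact mul_le_mul_of_nonpos_left (hv k).2 (not_le.1 h).le
  have hxv' : x ∈ Oc v' := by
    simp only [mem_iInter] at hx
    refine hx v' fun k => ?_
    simp only [hv']
    split_ifs
    exacts [Or.inl rfl, Or.inr rfl]
  have hM : ∀ y ∈ Vpts v, f ⬝ᵥ y < M := fun y hy => hf y ▸ hφ y (subset_convexHull ℝ _ hy)
  refine (lt_of_lt_of_le hφx ?_).false
  rw [hf]
  refine dotProduct_le_of_mem_Oc hxv' fun y hy => ?_
  simp only [Vpts, mem_insert_iff, mem_singleton_iff, forall_eq_or_imp, forall_eq] at hM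
  simp only [dotProduct, Fin.sum_univ_three] at hM ⊢
  have l0 := hle 0
  have l1 := hle 1
  have l2 := hle 2
  have l3 := hle 3
  have l4 := hle 4
  have l5 := hle 5
  simp [hc] at l0 l1 l2 l3 l4 l5 hM
  rcases hy with rfl | rfl | rfl | rfl | rfl | rfl <;> simp <;> linarith

lemma HullRep.congr {q r : Fin 3 → Fin 3 → ℝ} {x μ σ : Fin 3 → ℝ} (h : HullRep q x μ σ)
    (hqr : ∀ j i, j ≠ i → q j i = r j i) : HullRep r x μ σ :=
  ⟨h.1, h.2.1, fun i j k hd => by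
    rw [h.2.2 i j k hd, hqr j i hd.1.symm, hqr k i hd.2.1.symm]⟩

lemma exists_ne_zero_add_mem_Icc {a δ x : ℝ} (hδ : 0 < δ) (hx : x ∈ Icc a (a + δ)) :
    ∃ e, e ≠ 0 ∧ x + e ∈ Icc a (a + δ) := by
  obtain ⟨h1, h2⟩ := hx
  by_cases h : x ≤ a + δ / 2
  · exact ⟨δ / 2, by positivity, by linarith, by linarith⟩
  · exact ⟨-(δ / 2), by linarith, by linarith, by linarith⟩

theorem iSup_coverNum_le_coverNum_QP (a δ : Fin 6 → ℝ) (hδ : ∀ i, 0 < δ i)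
    (ha : ∀ i, 0 ≤ a i) (hb : ∀ i, a i + δ i ≤ 1) :
    (⨆ p ∈ {p : Fin 6 → ℝ | ∀ i, p i ∈ Icc (a i) (a i + δ i)},
        coverNum (cubeSkel ∪ Vpts p) (interior (Oc p))) ≤
      coverNum
        (cubeSkel ∪ ⋃ p ∈ {p : Fin 6 → ℝ | ∀ i, p i ∈ Icc (a i) (a i + δ i)}, Vpts p)
        (⋂ v ∈ {v : Fin 6 → ℝ | ∀ i, v i = a i ∨ v i = a i + δ i}, Oc v) := by
  refine iSup₂_le fun p hp => le_sInf ?_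
  rintro n ⟨T, rfl, hT⟩
  set Q := ⋂ v ∈ {v : Fin 6 → ℝ | ∀ i, v i = a i ∨ v i = a i + δ i}, Oc v with hQ
  choose e he0 he using fun i => exists_ne_zero_add_mem_Icc (hδ i) (hp i)
  have hqd : Admissible (pairCoord p) (pairCoord e) := by
    intro j i hji
    obtain ⟨k, hk⟩ := exists_pairCoord_eq hji
    rw [hk, hk]
    obtain ⟨h1, h2⟩ := hp k
    obtain ⟨h3, h4⟩ := he k
    have := ha k
    have := hb k
    exact ⟨he0 k, by linarith, by linarith, by linarith, by linarith⟩
  have hQO : Q ⊆ Oc p := iInter_vertices_subset_Oc hp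
  have hQc : IsCompact Q := (isCompact_Oc p).of_isClosed_subset
    (isClosed_biInter fun v _ => (isCompact_Oc v).isClosed) hQO
  have hcore : ∀ x ∈ Q, InCore (pairCoord p) (pairCoord e) x := by
    intro x hx r hr
    obtain ⟨v, hvr, hv⟩ := exists_eq_pairCoord r
    have hvP : ∀ k, v k ∈ Icc (a k) (a k + δ k) := by
      intro k
      obtain ⟨j, i, hji, hk, hpk⟩ := hv k
      rw [hk]
      rcases hr j i hji with h | h <;> rw [h]
      · rw [hpk]
        exact hp k
      · rw [hpk, hpk]
        exact he k
    obtain ⟨μ, σ, h⟩ := exists_hullRep_of_mem_Oc (iInter_vertices_subset_Oc hvP hx)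
    exact ⟨μ, σ, h.congr hvr⟩
  obtain ⟨v, hv⟩ := exists_cover_interior hqd hQc hQO hcore (T := T) (by
    intro x hx
    have hxT : x ∈ ⋃ t ∈ T, (t +ᵥ Q) := by
      refine hT (hx.imp id fun h => ?_)
      exact mem_biUnion (x := p) hp ((mem_Vpts_iff p x).2 h)
    simp only [mem_iUnion, exists_prop] at hxT
    obtain ⟨t, ht, y, hy, rfl⟩ := hxT
    exact ⟨t, ht, by simpa using hy⟩)
  classical
  have hcov : cubeSkel ∪ Vpts p ⊆ ⋃ t ∈ T.image v, (t +ᵥ interior (Oc p)) := by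
    intro x hx
    rw [← setOf_target_eq] at hx
    obtain ⟨t, ht, h⟩ := hv x hx
    simp only [mem_iUnion, exists_prop]
    exact ⟨v t, Finset.mem_image_of_mem v ht, x - v t, h, by simp⟩
  have hle : coverNum (cubeSkel ∪ Vpts p) (interior (Oc p)) ≤ ((T.image v).card : ℕ∞) :=
    sInf_le ⟨T.image v, rfl, hcov⟩
  exact hle.trans (by exact_mod_cast Finset.card_image_le)
end

section
/- Let P = ∏_{i=1}^{6} [a_i, a_i+δ_i] ⊆ [0,1]⁶ with all δ_i > 0, Q_P = ⋂_{v ∈ U_P} O_v, and R_P = ⋃_{p ∈ P} V_p. Enumerate the 12 edges of the cube as E_k = [v_k, v_k + u_k], k = 1,…,12, with v_k a vertex and u_k ∈ {e₁,e₂,e₃}, and the 6 faces as F_{ij} = {x ∈ [0,1]³ : x_i = j}. Suppose there exist an injective map τ from the six faces into {1,…,12}, vectors a(v) ∈ ℝ³ for each vertex v of the cube, vectors b_{ij} ∈ ℝ³ for each face F_{ij}, and real numbers t_k for every k and s_k for every k in the image of τ, such that: (1) v ∈ a(v) + Q_P for every vertex v; (2) R_P ∩ F_{ij} ⊆ b_{ij}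 + Q_P for every face; (3) for each edge E_k with k not in the image of τ, the point v_k + t_k u_k lies in both a(v_k) + Q_P and a(v_k+u_k) + Q_P; (4) for each edge E_k with k = τ(i,j), one has v_k + t_k u_k ∈ a(v_k) + Q_P, v_k + s_k u_k ∈ a(v_k+u_k) + Q_P, and both v_k + t_k u_k and v_k + s_k u_k lie in b_{ij} + Q_P. Then C(E ∪ R_P, Q_P) ≤ 14. -/
open Set Pointwise

/-- An edge of the unit cube: a base vertex together with an axis direction in which
the base vertex has coordinate `0`; the edge is `[base, base + e_dir]`. -/
structure CubeEdge where
  base : Fin 3 → ℝ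
  dir : Fin 3
  base_mem : ∀ i, base i = 0 ∨ base i = 1
  base_dir : base dir = 0

/-- The face `F_{ij} = {x ∈ [0,1]³ : x_i = j}` of the unit cube. -/
def cubeFace (f : Fin 3 × Fin 2) : Set (Fin 3 → ℝ) :=
  {x | (∀ i, x i ∈ Icc (0:ℝ) 1) ∧ x f.1 = ((f.2 : ℕ) : ℝ)}

/-- A convex set containing the points with parameters `c` and `d` of the line `v + ℝ u` contains
every point whose parameter lies between them. -/
theorem Convex.add_smul_mem_of_mem_Icc {S : Set (Fin 3 → ℝ)} (hS : Convex ℝ S)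
    {v u : Fin 3 → ℝ} {c d y : ℝ} (hc : v + c • u ∈ S) (hd : v + d • u ∈ S)
    (hy : y ∈ Icc c d) : v + y • u ∈ S := by
  have hline : Convex ℝ {y : ℝ | v + y • u ∈ S} := by
    have heq : {y : ℝ | v + y • u ∈ S} =
        (AffineMap.lineMap v (v + u) : ℝ →ᵃ[ℝ] (Fin 3 → ℝ)) ⁻¹' S := by
      ext y
      simp [AffineMap.lineMap_apply, add_comm]
    rw [heq]
    exact hS.affine_preimage _
  exact hline.ordConnected.out hc hd hy

/-- Every point of the 1-skeleton lies on an edge of the cube. -/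
theorem exists_cubeEdge_of_mem_cubeSkel {x : Fin 3 → ℝ} (hx : x ∈ cubeSkel) :
    ∃ e : CubeEdge, ∃ y ∈ Icc (0 : ℝ) 1,
      x = e.base + y • (Pi.single e.dir 1 : Fin 3 → ℝ) := by
  obtain ⟨hx, i, j, hij, hi, hj⟩ := hx
  obtain ⟨k, hk⟩ : ∃ k : Fin 3, ∀ l, l ≠ k → l = i ∨ l = j := by
    clear * - hij
    revert i j
    decide
  refine ⟨⟨Function.update x k 0, k, fun l => ?_, by simp⟩, x k, hx k, ?_⟩
  · by_cases hl : l = k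
    · simp [hl]
    · rcases hk l hl with rfl | rfl <;> simpa [hl]
  · ext l
    by_cases hl : l = k
    · subst hl; simp
    · simp [hl]

/-- Every point of `V_p` lies on a face of the cube. -/
theorem exists_mem_cubeFace_of_mem_Vpts {p : Fin 6 → ℝ} {x : Fin 3 → ℝ}
    (hp : ∀ i, p i ∈ Icc (0 : ℝ) 1) (hx : x ∈ Vpts p) : ∃ f, x ∈ cubeFace f := by
  rcases hx with rfl | rfl | rfl | rfl | rfl | rfl
  · exact ⟨(0, 0), by simpa [cubeFace, Fin.forall_fin_succ] using ⟨hp 0, hp 1⟩⟩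
  · exact ⟨(0, 1), by simpa [cubeFace, Fin.forall_fin_succ] using ⟨hp 0, hp 1⟩⟩
  · exact ⟨(1, 0), by simpa [cubeFace, Fin.forall_fin_succ] using ⟨hp 2, hp 3⟩⟩
  · exact ⟨(1, 1), by simpa [cubeFace, Fin.forall_fin_succ] using ⟨hp 2, hp 3⟩⟩
  · exact ⟨(2, 0), by simpa [cubeFace, Fin.forall_fin_succ] using ⟨hp 4, hp 5⟩⟩
  · exact ⟨(2, 1), by simpa [cubeFace, Fin.forall_fin_succ] using ⟨hp 4, hp 5⟩⟩

theorem coverNum_le_card {S B : Set (Fin 3 → ℝ)} (T : Finset (Fin 3 → ℝ))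
    (h : S ⊆ ⋃ t ∈ T, (t +ᵥ B)) : coverNum S B ≤ T.card :=
  sInf_le ⟨T, rfl, h⟩

theorem coverNum_QP_le_14 (a δ : Fin 6 → ℝ) (hδ : ∀ i, 0 < δ i)
    (ha : ∀ i, 0 ≤ a i) (hb : ∀ i, a i + δ i ≤ 1)
    (QP RP : Set (Fin 3 → ℝ))
    (hQ : QP = ⋂ v ∈ {v : Fin 6 → ℝ | ∀ i, v i = a i ∨ v i = a i + δ i}, Oc v)
    (hR : RP = ⋃ p ∈ {p : Fin 6 → ℝ | ∀ i, p i ∈ Icc (a i) (a i + δ i)}, Vpts p)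
    (τ : Fin 3 × Fin 2 → CubeEdge) (hτ : Function.Injective τ)
    (A : (Fin 3 → ℝ) → (Fin 3 → ℝ)) (b : Fin 3 × Fin 2 → (Fin 3 → ℝ))
    (t s : CubeEdge → ℝ)
    (h1 : ∀ v : Fin 3 → ℝ, (∀ i, v i = 0 ∨ v i = 1) → v ∈ A v +ᵥ QP)
    (h2 : ∀ f : Fin 3 × Fin 2, RP ∩ cubeFace f ⊆ b f +ᵥ QP)
    (h3 : ∀ e : CubeEdge, e ∉ Set.range τ →
      e.base + t e • (Pi.single e.dir 1 : Fin 3 → ℝ) ∈ A e.base +ᵥ QP ∧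
      e.base + t e • (Pi.single e.dir 1 : Fin 3 → ℝ) ∈ A (e.base + (Pi.single e.dir 1 : Fin 3 → ℝ)) +ᵥ QP)
    (h4 : ∀ f : Fin 3 × Fin 2,
      (τ f).base + t (τ f) • (Pi.single (τ f).dir 1 : Fin 3 → ℝ) ∈ A (τ f).base +ᵥ QP ∧
      (τ f).base + s (τ f) • (Pi.single (τ f).dir 1 : Fin 3 → ℝ) ∈
        A ((τ f).base + (Pi.single (τ f).dir 1 : Fin 3 → ℝ)) +ᵥ QP ∧
      (τ f).base + t (τ f) • (Pi.single (τ f).dir 1 : Fin 3 → ℝ) ∈ b f +ᵥ QP ∧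
      (τ f).base + s (τ f) • (Pi.single (τ f).dir 1 : Fin 3 → ℝ) ∈ b f +ᵥ QP) :
    coverNum (cubeSkel ∪ RP) QP ≤ 14 := by
  classical
  have hconv : Convex ℝ QP := by
    rw [hQ]
    exact convex_iInter₂ fun v _ => convex_convexHull ℝ _
  have hconv' (w : Fin 3 → ℝ) : Convex ℝ (w +ᵥ QP) := hconv.vadd w
  set W : Finset (Fin 3 → ℝ) := Fintype.piFinset fun _ => {0, 1} with hW
  have mem_W (v : Fin 3 → ℝ) : v ∈ W ↔ ∀ i, v i = 0 ∨ v i = 1 := by simp [hW]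
  set T := W.image A ∪ Finset.univ.image b
  have hcard : T.card ≤ 14 :=
    calc T.card ≤ W.card + (Finset.univ : Finset (Fin 3 × Fin 2)).card :=
          (Finset.card_union_le _ _).trans
            (add_le_add Finset.card_image_le Finset.card_image_le)
      _ = 14 := by simp [hW]
  have cov_A {v x} (hv : ∀ i, v i = 0 ∨ v i = 1) (hx : x ∈ A v +ᵥ QP) :
      x ∈ ⋃ t ∈ T, (t +ᵥ QP) :=
    mem_biUnion (Finset.mem_union_left _ (Finset.mem_image_of_mem A ((mem_W v).2 hv))) hx
  have cov_b {f x} (hx : x ∈ b f +ᵥ QP) : x ∈ ⋃ t ∈ T, (t +ᵥ QP) :=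
    mem_biUnion (Finset.mem_union_right _ (Finset.mem_image_of_mem b (Finset.mem_univ f))) hx
  refine (coverNum_le_card T ?_).trans (by exact_mod_cast hcard)
  rintro x (hx | hx)
  · obtain ⟨e, y, hy, rfl⟩ := exists_cubeEdge_of_mem_cubeSkel hx
    have htop : ∀ i, (e.base + (Pi.single e.dir 1 : Fin 3 → ℝ)) i = 0 ∨
        (e.base + (Pi.single e.dir 1 : Fin 3 → ℝ)) i = 1 := fun i => by
      by_cases hi : i = e.dir
      · subst hi; simp [e.base_dir]
      · simpa [hi] using e.base_mem i
    have lower {c : ℝ} (hyc : y ≤ c)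
        (hc : e.base + c • (Pi.single e.dir 1 : Fin 3 → ℝ) ∈ A e.base +ᵥ QP) :=
      cov_A e.base_mem ((hconv' _).add_smul_mem_of_mem_Icc
        (by simpa only [zero_smul, add_zero] using h1 _ e.base_mem) hc ⟨hy.1, hyc⟩)
    have upper {c : ℝ} (hcy : c ≤ y)
        (hc : e.base + c • (Pi.single e.dir 1 : Fin 3 → ℝ) ∈
          A (e.base + (Pi.single e.dir 1 : Fin 3 → ℝ)) +ᵥ QP) :=
      cov_A htop ((hconv' _).add_smul_mem_of_mem_Icc hc
        (by simpa only [one_smul] using h1 _ htop) ⟨hcy, hy.2⟩)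
    by_cases he : e ∈ Set.range τ
    · obtain ⟨f, rfl⟩ := he
      obtain ⟨ht, hs, hbt, hbs⟩ := h4 f
      rcases le_total y (t (τ f)) with hyt | hty
      · exact lower hyt ht
      rcases le_total (s (τ f)) y with hsy | hys
      · exact upper hsy hs
      · exact cov_b ((hconv' _).add_smul_mem_of_mem_Icc hbt hbs ⟨hty, hys⟩)
    · obtain ⟨ht, ht'⟩ := h3 e he
      rcases le_total y (t e) with hyt | hty
      · exact lower hyt ht
      · exact upper hty ht'
  · have hx' := hx
    rw [hR] at hx'
    obtain ⟨p, hp, hxp⟩ := mem_iUnion₂.1 hx'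
    obtain ⟨f, hf⟩ := exists_mem_cubeFace_of_mem_Vpts
      (fun i => ⟨(ha i).trans (hp i).1, (hp i).2.trans (hb i)⟩) hxp
    exact cov_b (h2 f ⟨hx, hf⟩)
end

section
/- Let p̄ = (1/2,1/2,1/2,1/2,1/2,1/2) ∈ [0,1]⁶. Then C(E ∪ V_{p̄}, int(O_{p̄})) ≥ 14. -/
open Set Pointwise

theorem sum_abs_sub_half_le_of_mem_Oc {x : Fin 3 → ℝ} (hx : x ∈ Oc (fun _ => 1/2)) :
    ∑ i, |x i - 1/2| ≤ 1/2 := by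
  have hconv : ConvexOn ℝ univ (fun x : Fin 3 → ℝ => ∑ i, |x i - 1/2|) := by
    refine ⟨convex_univ, fun x _ y _ a b ha hb hab => ?_⟩
    simp only [smul_eq_mul, Finset.mul_sum, ← Finset.sum_add_distrib]
    refine Finset.sum_le_sum fun i _ => ?_
    calc |(a • x + b • y) i - 1/2| = |a * (x i - 1/2) + b * (y i - 1/2)| := by
          congr 1
          simp only [Pi.add_apply, Pi.smul_apply, smul_eq_mul]
          linear_combination (1/2) * hab
      _ ≤ |a * (x i - 1/2)| + |b * (y i - 1/2)| := abs_add_le _ _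
      _ = a * |x i - 1/2| + b * |y i - 1/2| := by
          rw [abs_mul, abs_mul, abs_of_nonneg ha, abs_of_nonneg hb]
  have hsub : Oc (fun _ => 1/2) ⊆
      {x ∈ (univ : Set (Fin 3 → ℝ)) | ∑ i, |x i - 1/2| ≤ 1/2} := by
    refine convexHull_min ?_ (hconv.convex_le _)
    rintro y (rfl | rfl | rfl | rfl | rfl | rfl) <;>
      simp [Fin.sum_univ_three] <;> norm_num [abs_of_pos, abs_of_neg]
  exact (hsub hx).2

theorem sum_abs_sub_half_lt_of_mem_interior_Oc {x : Fin 3 → ℝ}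
    (hx : x ∈ interior (Oc (fun _ => 1/2))) : ∑ i, |x i - 1/2| < 1/2 := by
  have hcont : Filter.Tendsto (fun t : ℝ => x + t • (x - fun _ => 1/2))
      (nhdsWithin 0 (Ioi 0)) (nhds x) := by
    have h : Continuous (fun t : ℝ => x + t • (x - fun _ => 1/2)) := by fun_prop
    simpa using (h.tendsto 0).mono_left nhdsWithin_le_nhds
  obtain ⟨t, ht, (htpos : 0 < t)⟩ :=
    ((hcont.eventually (mem_interior_iff_mem_nhds.1 hx)).and self_mem_nhdsWithin).exists
  have hle := sum_abs_sub_half_le_of_mem_Oc ht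
  have hscale : ∑ i, |(x + t • (x - fun _ => 1/2) : Fin 3 → ℝ) i - 1/2| =
      (1 + t) * ∑ i, |x i - 1/2| := by
    rw [Finset.mul_sum]
    refine Finset.sum_congr rfl fun i _ => ?_
    rw [← abs_of_pos (show 0 < 1 + t by linarith), ← abs_mul]
    congr 1
    simp only [Pi.add_apply, Pi.smul_apply, Pi.sub_apply, smul_eq_mul]
    ring
  rw [hscale] at hle
  by_contra! h
  nlinarith

theorem sum_abs_sub_lt_one_of_mem_vadd {t x y : Fin 3 → ℝ}
    (hx : x ∈ t +ᵥ interior (Oc (fun _ => 1/2)))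
    (hy : y ∈ t +ᵥ interior (Oc (fun _ => 1/2))) : ∑ i, |x i - y i| < 1 := by
  obtain ⟨u, hu, rfl⟩ := hx
  obtain ⟨v, hv, rfl⟩ := hy
  have hu := sum_abs_sub_half_lt_of_mem_interior_Oc hu
  have hv := sum_abs_sub_half_lt_of_mem_interior_Oc hv
  calc ∑ i, |(t +ᵥ u) i - (t +ᵥ v) i| ≤ ∑ i, (|u i - 1/2| + |v i - 1/2|) := by
        refine Finset.sum_le_sum fun i _ => ?_
        have h : (t +ᵥ u) i - (t +ᵥ v) i = (u i - 1/2) - (v i - 1/2) := by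
          simp only [vadd_eq_add, Pi.add_apply]
          ring
        rw [h]
        exact abs_sub _ _
    _ < 1 := by
        rw [Finset.sum_add_distrib]
        linarith

/-- Twice the coordinates of the eight vertices and the six face centers of the unit cube. -/
def doubledVertexOrFaceCenter : Fin 14 → Fin 3 → ℤ :=
  ![![0, 0, 0], ![0, 0, 2], ![0, 2, 0], ![0, 2, 2], ![2, 0, 0], ![2, 0, 2], ![2, 2, 0],
    ![2, 2, 2], ![0, 1, 1], ![2, 1, 1], ![1, 0, 1], ![1, 2, 1], ![1, 1, 0], ![1, 1, 2]]

theorem two_le_sum_abs_sub_doubledVertexOrFaceCenter : ∀ k l : Fin 14, k ≠ l →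
    2 ≤ ∑ i, |doubledVertexOrFaceCenter k i - doubledVertexOrFaceCenter l i| := by
  decide

theorem doubledVertexOrFaceCenter_cases : ∀ k : Fin 14,
    (∀ i, doubledVertexOrFaceCenter k i = 0 ∨ doubledVertexOrFaceCenter k i = 2) ∨
      doubledVertexOrFaceCenter k ∈ [![0, 1, 1], ![2, 1, 1], ![1, 0, 1], ![1, 2, 1],
        ![1, 1, 0], ![1, 1, 2]] := by
  decide

/-- The eight vertices and the six face centers of the unit cube. -/
noncomputable def vertexOrFaceCenter (k : Fin 14) : Fin 3 → ℝ :=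
  fun i => (doubledVertexOrFaceCenter k i : ℝ) / 2

theorem vertexOrFaceCenter_mem (k : Fin 14) :
    vertexOrFaceCenter k ∈ cubeSkel ∪ Vpts (fun _ => 1/2) := by
  rcases doubledVertexOrFaceCenter_cases k with h | h
  · have hk : ∀ i, vertexOrFaceCenter k i = 0 ∨ vertexOrFaceCenter k i = 1 := fun i => by
      rcases h i with h | h <;> simp [vertexOrFaceCenter, h]
    refine Or.inl ⟨fun i => ?_, 0, 1, by decide, hk 0, hk 1⟩
    rcases hk i with h | h <;> simp [h]
  · right
    have key : ∀ a b c : ℤ, doubledVertexOrFaceCenter k = ![a, b, c] →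
        vertexOrFaceCenter k = ![(a : ℝ) / 2, (b : ℝ) / 2, (c : ℝ) / 2] := fun a b c h => by
      ext i
      fin_cases i <;> simp [vertexOrFaceCenter, h]
    simp only [List.mem_cons, List.not_mem_nil, or_false] at h
    rcases h with h | h | h | h | h | h <;> rw [key _ _ _ h] <;> norm_num [Vpts]

theorem one_le_sum_abs_sub_vertexOrFaceCenter {k l : Fin 14} (hkl : k ≠ l) :
    1 ≤ ∑ i, |vertexOrFaceCenter k i - vertexOrFaceCenter l i| := by
  have h : (2 : ℝ) ≤ ∑ i, |(doubledVertexOrFaceCenter k i : ℝ) - doubledVertexOrFaceCenter l i| :=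
    mod_cast two_le_sum_abs_sub_doubledVertexOrFaceCenter k l hkl
  have hhalf : ∑ i, |vertexOrFaceCenter k i - vertexOrFaceCenter l i| =
      (∑ i, |(doubledVertexOrFaceCenter k i : ℝ) - doubledVertexOrFaceCenter l i|) / 2 := by
    rw [Finset.sum_div]
    refine Finset.sum_congr rfl fun i _ => ?_
    rw [vertexOrFaceCenter, vertexOrFaceCenter, ← sub_div, abs_div, abs_two]
  linarith

theorem fourteen_le_coverNum_center :
    14 ≤ coverNum (cubeSkel ∪ Vpts (fun _ => 1/2)) (interior (Oc (fun _ => 1/2))) := by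
  refine le_sInf ?_
  rintro n ⟨T, rfl, hT⟩
  have hcov : ∀ k, ∃ t ∈ T, vertexOrFaceCenter k ∈ t +ᵥ interior (Oc (fun _ => 1/2)) :=
    fun k => by simpa only [mem_iUnion, exists_prop] using hT (vertexOrFaceCenter_mem k)
  choose t htT ht using hcov
  have hinj : Function.Injective t := fun k l hkl => by
    by_contra hne
    exact (one_le_sum_abs_sub_vertexOrFaceCenter hne).not_gt
      (sum_abs_sub_lt_one_of_mem_vadd (ht k) (hkl ▸ ht l))
  have hcard := Finset.card_le_card_of_injOn (s := Finset.univ) t (fun k _ => htT k)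
    hinj.injOn
  rw [Finset.card_univ, Fintype.card_fin] at hcard
  exact_mod_cast hcard
end

section
/- Let p̄ = (1/2,…,1/2) ∈ [0,1]⁶ and let W be the 14-point set consisting of the 8 vertices of the unit cube [0,1]³ together with the 6 points of V_{p̄}. Then for every w ∈ ℝ³, the translate w + int(O_{p̄}) contains at most one point of W. -/
open Set Pointwise

/-- The octahedron `O_{p̄}` lies in the half-spaces `∑ sᵢ (xᵢ - 1/2) ≤ 1/2` for `|sᵢ| ≤ 1`. -/
lemma sum_mul_sub_le_of_mem_Oc {s x : Fin 3 → ℝ} (hs : ∀ i, |s i| ≤ 1)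
    (hx : x ∈ Oc (fun _ => 1/2)) : ∑ i, s i * (x i - 1/2) ≤ 1/2 := by
  have hconv : Convex ℝ {x : Fin 3 → ℝ | ∑ i, s i * (x i - 1/2) ≤ 1/2} := by
    intro a ha b hb t u ht hu htu
    simp only [mem_ofPred_eq, Fin.sum_univ_three, Pi.add_apply, Pi.smul_apply,
      smul_eq_mul] at ha hb ⊢
    obtain rfl : u = 1 - t := by linarith
    nlinarith [mul_le_mul_of_nonneg_left ha ht, mul_le_mul_of_nonneg_left hb hu]
  refine convexHull_min ?_ hconv hx
  have h0 := abs_le.mp (hs 0)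
  have h1 := abs_le.mp (hs 1)
  have h2 := abs_le.mp (hs 2)
  rintro v (rfl | rfl | rfl | rfl | rfl | rfl) <;>
    simp [Fin.sum_univ_three] <;> linarith

/-- Interior points of `O_{p̄}` satisfy the facet inequalities strictly. -/
lemma sum_mul_sub_lt_of_mem_interior_Oc {s x : Fin 3 → ℝ} (hs : ∀ i, |s i| = 1)
    (hx : x ∈ interior (Oc (fun _ => 1/2))) : ∑ i, s i * (x i - 1/2) < 1/2 := by
  have hc : Filter.Tendsto (fun t : ℝ => x + t • s) (nhdsWithin 0 (Ioi 0)) (nhds x) := by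
    have : Continuous (fun t : ℝ => x + t • s) := by fun_prop
    simpa using (this.tendsto 0).mono_left nhdsWithin_le_nhds
  obtain ⟨t, htO, ht⟩ :=
    ((hc.eventually (mem_interior_iff_mem_nhds.mp hx)).and self_mem_nhdsWithin).exists
  have hle := sum_mul_sub_le_of_mem_Oc (fun i => (hs i).le) htO
  have hsq : ∀ i, s i * s i = 1 := fun i => by
    rw [← abs_mul_abs_self, hs, one_mul]
  have ht0 : 0 < t := ht
  simp only [Fin.sum_univ_three, Pi.add_apply, Pi.smul_apply, smul_eq_mul] at hle ⊢
  nlinarith [hsq 0, hsq 1, hsq 2]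

/-- Two points in a common translate of the interior of `O_{p̄}` have `ℓ¹`-distance below `1`. -/
lemma sum_abs_sub_lt_one {w x y : Fin 3 → ℝ} (hx : x ∈ w +ᵥ interior (Oc (fun _ => 1/2)))
    (hy : y ∈ w +ᵥ interior (Oc (fun _ => 1/2))) : ∑ i, |x i - y i| < 1 := by
  obtain ⟨a, ha, rfl⟩ := hx
  obtain ⟨b, hb, rfl⟩ := hy
  let s : Fin 3 → ℝ := fun i => if 0 ≤ a i - b i then 1 else -1
  have hs : ∀ i, |s i| = 1 := fun i => by
    simp only [s]; split_ifs <;> simp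
  have hsd : ∀ i, |a i - b i| = s i * (a i - b i) := fun i => by
    simp only [s]
    split_ifs with h
    · rw [abs_of_nonneg h, one_mul]
    · rw [abs_of_neg (not_le.mp h), neg_one_mul]
  have h1 := sum_mul_sub_lt_of_mem_interior_Oc hs ha
  have h2 := sum_mul_sub_lt_of_mem_interior_Oc (s := -s) (by simpa using hs) hb
  simp only [Fin.sum_univ_three, Pi.neg_apply, vadd_eq_add, Pi.add_apply,
    add_sub_add_left_eq_sub, hsd] at h1 h2 ⊢
  linarith

/-- A cube vertex is at `ℓ¹`-distance at least `1` from every face center. -/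
lemma one_le_sum_abs_sub_of_vertex_of_mem_Vpts {x y : Fin 3 → ℝ} (hx : ∀ i, x i = 0 ∨ x i = 1)
    (hy : y ∈ Vpts (fun _ => 1/2)) : 1 ≤ ∑ i, |x i - y i| := by
  have hhalf : ∀ i, |x i - 1/2| = 1/2 := fun i => by
    rcases hx i with h | h <;> rw [h] <;> norm_num [abs_of_pos, abs_of_neg]
  have h0 := hhalf 0
  have h1 := hhalf 1
  have h2 := hhalf 2
  rcases hy with rfl | rfl | rfl | rfl | rfl | rfl <;>
    simp only [Fin.sum_univ_three, Matrix.cons_val_zero, Matrix.cons_val_one,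
      Matrix.cons_val, h0, h1, h2] <;>
    linarith [abs_nonneg (x 0 - 0), abs_nonneg (x 0 - 1), abs_nonneg (x 1 - 0),
      abs_nonneg (x 1 - 1), abs_nonneg (x 2 - 0), abs_nonneg (x 2 - 1)]

/-- Two face centers at `ℓ¹`-distance less than `1` coincide. -/
lemma eq_of_mem_Vpts_of_sum_abs_sub_lt_one {x y : Fin 3 → ℝ} (hx : x ∈ Vpts (fun _ => 1/2))
    (hy : y ∈ Vpts (fun _ => 1/2)) (h : ∑ i, |x i - y i| < 1) : x = y := by
  rcases hx with rfl | rfl | rfl | rfl | rfl | rfl <;>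
    rcases hy with rfl | rfl | rfl | rfl | rfl | rfl <;>
    first
    | rfl
    | (exfalso
       simp only [Fin.sum_univ_three, Matrix.cons_val_zero, Matrix.cons_val_one,
         Matrix.cons_val] at h
       norm_num [abs_of_pos, abs_of_neg] at h)

/-- Two cube vertices at `ℓ¹`-distance less than `1` coincide. -/
lemma eq_of_vertex_of_sum_abs_sub_lt_one {x y : Fin 3 → ℝ} (hx : ∀ i, x i = 0 ∨ x i = 1)
    (hy : ∀ i, y i = 0 ∨ y i = 1) (h : ∑ i, |x i - y i| < 1) : x = y := by
  funext i
  have hi : |x i - y i| < 1 :=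
    (Finset.single_le_sum (f := fun i => |x i - y i|) (fun _ _ => abs_nonneg _)
      (Finset.mem_univ i)).trans_lt h
  rcases hx i with h1 | h1 <;> rcases hy i with h2 | h2 <;> rw [h1, h2] at hi ⊢ <;>
    norm_num at hi

theorem translate_interior_octahedron_subsingleton (w : Fin 3 → ℝ) :
    Set.Subsingleton ((w +ᵥ interior (Oc (fun _ => 1/2))) ∩
      ({v : Fin 3 → ℝ | ∀ i, v i = 0 ∨ v i = 1} ∪ Vpts (fun _ => 1/2))) := by
  rintro x ⟨hxO, hx⟩ y ⟨hyO, hy⟩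
  have h := sum_abs_sub_lt_one hxO hyO
  rcases hx with hx | hx <;> rcases hy with hy | hy
  · exact eq_of_vertex_of_sum_abs_sub_lt_one hx hy h
  · exact absurd h (one_le_sum_abs_sub_of_vertex_of_mem_Vpts hx hy).not_gt
  · exact absurd (sum_abs_sub_lt_one hyO hxO)
      (one_le_sum_abs_sub_of_vertex_of_mem_Vpts hy hx).not_gt
  · exact eq_of_mem_Vpts_of_sum_abs_sub_lt_one hx hy h
end

section
/- Let P = ∏_{i=1}^{6} [a_i, a_i+δ_i] ⊆ [0,1]⁶ with all δ_i > 0, let U_P be the set of 64 vertices of P, and let Q_P = ⋂_{v ∈ U_P} O_v. Then Q_P is disjoint from the boundary of the unit cube [0,1]³, i.e., Q_P ⊆ (0,1)³. -/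
open Set Pointwise

/-- If every point of a set satisfies `f < c`, or `f = c` and `g = d`, then so does every point
of its convex hull: the face of the hull where `f = c` lies in the hyperplane `g = d`. -/
theorem lt_or_eq_and_eq_of_mem_convexHull {E : Type*} [AddCommGroup E] [Module ℝ E]
    (f g : E →ₗ[ℝ] ℝ) {c d : ℝ} {s : Set E} (hs : ∀ y ∈ s, f y < c ∨ f y = c ∧ g y = d)
    {x : E} (hx : x ∈ convexHull ℝ s) : f x < c ∨ f x = c ∧ g x = d := by
  refine convexHull_min (t := {y | f y < c ∨ f y = c ∧ g y = d}) hs ?_ hx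
  rw [convex_iff_forall_pos]
  intro y hy z hz u v hu hv huv
  obtain rfl : v = 1 - u := by linarith
  simp only [mem_ofPred_eq, map_add, map_smul, smul_eq_mul] at hy hz ⊢
  rcases hy with hy | ⟨hy, hy'⟩ <;> rcases hz with hz | ⟨hz, hz'⟩
  · left; nlinarith
  · left; nlinarith
  · left; nlinarith
  · right; constructor
    · rw [hy, hz]; ring
    · rw [hy', hz']; ring

/-- A strict bound on the convex hulls of two sets at once, when the faces of the two hulls on
the hyperplane `f = c` lie in distinct level sets of `g`. -/
theorem lt_of_mem_convexHull_of_mem_convexHull {E : Type*} [AddCommGroup E] [Module ℝ E]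
    (f g : E →ₗ[ℝ] ℝ) {c d d' : ℝ} (hd : d ≠ d') {s t : Set E}
    (hs : ∀ y ∈ s, f y < c ∨ f y = c ∧ g y = d) (ht : ∀ y ∈ t, f y < c ∨ f y = c ∧ g y = d')
    {x : E} (hxs : x ∈ convexHull ℝ s) (hxt : x ∈ convexHull ℝ t) : f x < c := by
  rcases lt_or_eq_and_eq_of_mem_convexHull f g hs hxs with h | ⟨-, h⟩
  · exact h
  rcases lt_or_eq_and_eq_of_mem_convexHull f g ht hxt with h' | ⟨-, h'⟩
  · exact h'
  · exact absurd (h.symm.trans h') hd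

theorem QP_subset_open_cube (a δ : Fin 6 → ℝ) (hδ : ∀ i, 0 < δ i)
    (ha : ∀ i, 0 ≤ a i) (hb : ∀ i, a i + δ i ≤ 1) :
    (⋂ v ∈ {v : Fin 6 → ℝ | ∀ i, v i = a i ∨ v i = a i + δ i}, Oc v) ⊆
      {x : Fin 3 → ℝ | ∀ i, x i ∈ Ioo (0:ℝ) 1} := by
  intro x hx
  simp only [mem_iInter, mem_ofPred_eq] at hx
  have hpos : ∀ i, 0 < a i + δ i := fun i => add_pos_of_nonneg_of_pos (ha i) (hδ i)
  have hlt : ∀ i, a i < 1 := fun i => by linarith [hδ i, hb i]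
  have hne : ∀ i, a i ≠ a i + δ i := fun i => by linarith [hδ i]
  have hlow : ∀ k, x ∈ Oc (Function.update (fun i => a i + δ i) k (a k)) := fun k =>
    hx _ fun i => by by_cases h : i = k <;> simp [h]
  have hhigh : ∀ k, x ∈ Oc (Function.update a k (a k + δ k)) := fun k =>
    hx _ fun i => by by_cases h : i = k <;> simp [h]
  have htop : x ∈ Oc (fun i => a i + δ i) := hx _ fun i => Or.inr rfl
  have hbot : x ∈ Oc a := hx _ fun i => Or.inl rfl
  have lower : ∀ i j k, _ → _ → 0 < x i := fun i j k h h' =>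
    neg_lt_zero.1 <| lt_of_mem_convexHull_of_mem_convexHull
      (-LinearMap.proj (R := ℝ) (φ := fun _ : Fin 3 => ℝ) i)
      (LinearMap.proj (R := ℝ) (φ := fun _ : Fin 3 => ℝ) j) (hne k) h h' (hlow k) htop
  have upper : ∀ i j k, _ → _ → x i < 1 := fun i j k h h' =>
    lt_of_mem_convexHull_of_mem_convexHull
      (LinearMap.proj (R := ℝ) (φ := fun _ : Fin 3 => ℝ) i)
      (LinearMap.proj (R := ℝ) (φ := fun _ : Fin 3 => ℝ) j) (hne k) h h' hbot (hhigh k)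
  intro i
  fin_cases i
  · exact ⟨lower 0 1 0 (by simp [Vpts, hpos]) (by simp [Vpts, hpos]),
      upper 0 1 0 (by simp [Vpts, hlt]) (by simp [Vpts, hlt])⟩
  · exact ⟨lower 1 0 2 (by simp [Vpts, hpos]) (by simp [Vpts, hpos]),
      upper 1 0 2 (by simp [Vpts, hlt]) (by simp [Vpts, hlt])⟩
  · exact ⟨lower 2 0 4 (by simp [Vpts, hpos]) (by simp [Vpts, hpos]),
      upper 2 0 4 (by simp [Vpts, hlt]) (by simp [Vpts, hlt])⟩
end

section
/- For every p ∈ [0,1]⁶ and every rectangular parallelepiped B ⊆ ℝ³ with edges parallel to the coordinate axes whose three edge lengths sum to strictly less than 1, there exists a vector w ∈ ℝ³ such that w + B ⊆ int(O_p). -/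
open Set Pointwise

/-- The hull `O_p` contains every box with edge lengths `l i` summing to `1`, placed at the convex
combination with weights `l i` of the lower end points of its three axis-parallel unit segments. -/
theorem add_mem_Oc (p : Fin 6 → ℝ) (l y : Fin 3 → ℝ) (hl : l 0 + l 1 + l 2 = 1)
    (hy0 : ∀ i, 0 ≤ y i) (hyl : ∀ i, y i ≤ l i) :
    l 0 • ![0, p 0, p 1] + l 1 • ![p 2, 0, p 3] + l 2 • ![p 4, p 5, 0] + y ∈ Oc p := by
  have h := (convex_convexHull ℝ (Vpts p)).sum_mem (t := Finset.univ)
    (w := ![l 0 - y 0, y 0, l 1 - y 1, y 1, l 2 - y 2, y 2])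
    (z := ![![0, p 0, p 1], ![1, p 0, p 1], ![p 2, 0, p 3],
      ![p 2, 1, p 3], ![p 4, p 5, 0], ![p 4, p 5, 1]])
    (by intro i _; fin_cases i <;> simp [hy0, hyl])
    (by simp [Fin.sum_univ_six]; linarith)
    (by intro i _; apply subset_convexHull; fin_cases i <;> simp [Vpts])
  rw [Oc]
  convert h using 1
  ext i
  fin_cases i <;> simp [Fin.sum_univ_six] <;> ring

theorem exists_translate_box_subset_interior_Oc (p : Fin 6 → ℝ)
    (hp : ∀ i, p i ∈ Icc (0:ℝ) 1)
    (a b : Fin 3 → ℝ) (hab : ∀ i, a i < b i) (hsum : ∑ i, (b i - a i) < 1) :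
    ∃ w : Fin 3 → ℝ, (w +ᵥ Icc a b) ⊆ interior (Oc p) := by
  obtain ⟨δ, hδ⟩ : ∃ δ, δ = (1 - ∑ i, (b i - a i)) / 3 := ⟨_, rfl⟩
  have hδ0 : 0 < δ := by linarith
  rw [Fin.sum_univ_three] at hδ
  set l : Fin 3 → ℝ := fun i => b i - a i + δ with hl
  set c : Fin 3 → ℝ := l 0 • ![0, p 0, p 1] + l 1 • ![p 2, 0, p 3] + l 2 • ![p 4, p 5, 0]
  refine ⟨fun i => c i + δ / 2 - a i, ?_⟩
  have hopen : IsOpen (univ.pi fun i => Ioo (c i) (c i + l i)) :=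
    isOpen_set_pi finite_univ fun i _ => isOpen_Ioo
  refine Subset.trans ?_ (interior_maximal (fun x hx => ?_) hopen)
  · rintro _ ⟨x, ⟨hax, hxb⟩, rfl⟩ i -
    have h1 := hax i
    have h2 := hxb i
    simp only [vadd_eq_add, Pi.add_apply, mem_Ioo, hl]
    constructor <;> linarith
  · have h := add_mem_Oc p l (x - c) (by simp only [hl]; linarith)
      (fun i => by have := (hx i trivial).1; simp only [Pi.sub_apply]; linarith)
      (fun i => by have := (hx i trivial).2; simp only [Pi.sub_apply]; linarith)
    rwa [add_sub_cancel] at h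
end
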